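/- arXiv:1404.6192 — 2 statements merged into one kernel-verified Lean document; each statement's English description precedes it below -/
import Mathlib

section
/- Let Λ = {λ_n} be an increasing sequence of positive numbers with λ_n → ∞ such that liminf_{n→∞} λ_{2n}/λ_n = q > 1. Then Λ#BV = CΛ#V, i.e. every 2π-periodic (in each variable) function f : ℝ² → ℝ with Λ#V₁(f) + Λ#V₂(f) < ∞ is continuous in Λ#-variation. -/
open scoped ENNReal BigOperators
open Filter Set

noncomputable section

/-- A collection of `n` pairwise nonoverlapping subintervals of `T = [0, 2π]`,
given as pairs of endpoints. -/
def NonoverlapIcc (n : ℕ) (I : Fin n → ℝ × ℝ) : Prop :=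
  (∀ i, 0 ≤ (I i).1 ∧ (I i).1 < (I i).2 ∧ (I i).2 ≤ 2 * Real.pi) ∧
    ∀ i j, i ≠ j → (I i).2 ≤ (I j).1 ∨ (I j).2 ≤ (I i).1

/-- `f : ℝ² → ℝ` (curried) is `2π`-periodic in each variable. -/
def Periodic2 (f : ℝ → ℝ → ℝ) : Prop :=
  ∀ x y : ℝ, f (x + 2 * Real.pi) y = f x y ∧ f x (y + 2 * Real.pi) = f x y

/-- `ΛV₁(f)`: partial `Λ`-variation in the first variable. -/
def LamV1 (Λ : ℕ → ℝ) (f : ℝ → ℝ → ℝ) : ℝ≥0∞ :=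
  ⨆ (y ∈ Icc (0:ℝ) (2 * Real.pi)) (n : ℕ) (I : Fin n → ℝ × ℝ) (_ : NonoverlapIcc n I),
    ENNReal.ofReal (∑ i, |f (I i).2 y - f (I i).1 y| / Λ ((i : ℕ) + 1))

/-- `ΛV₂(f)`: partial `Λ`-variation in the second variable. -/
def LamV2 (Λ : ℕ → ℝ) (f : ℝ → ℝ → ℝ) : ℝ≥0∞ :=
  ⨆ (x ∈ Icc (0:ℝ) (2 * Real.pi)) (m : ℕ) (J : Fin m → ℝ × ℝ) (_ : NonoverlapIcc m J),
    ENNReal.ofReal (∑ j, |f x (J j).2 - f x (J j).1| / Λ ((j : ℕ) + 1))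

/-- `ΛV₁,₂(f)`: mixed `Λ`-variation. -/
def LamV12 (Λ : ℕ → ℝ) (f : ℝ → ℝ → ℝ) : ℝ≥0∞ :=
  ⨆ (n : ℕ) (m : ℕ) (I : Fin n → ℝ × ℝ) (J : Fin m → ℝ × ℝ)
    (_ : NonoverlapIcc n I) (_ : NonoverlapIcc m J),
    ENNReal.ofReal (∑ i, ∑ j,
      |f (I i).1 (J j).1 - f (I i).1 (J j).2 - f (I i).2 (J j).1 + f (I i).2 (J j).2| /
        (Λ ((i : ℕ) + 1) * Λ ((j : ℕ) + 1)))

/-- Total harmonic variation `HV(f) = HV₁(f) + HV₂(f) + HV₁,₂(f)` (with `λ_n = n`).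
`f ∈ HBV` iff `HarmonicV f ≠ ⊤`. -/
def HarmonicV (f : ℝ → ℝ → ℝ) : ℝ≥0∞ :=
  LamV1 (fun n => (n : ℝ)) f + LamV2 (fun n => (n : ℝ)) f + LamV12 (fun n => (n : ℝ)) f

/-- `Λ#V₁(f)`. -/
def LamSharpV1 (Λ : ℕ → ℝ) (f : ℝ → ℝ → ℝ) : ℝ≥0∞ :=
  ⨆ (n : ℕ) (I : Fin n → ℝ × ℝ) (y : Fin n → ℝ)
    (_ : NonoverlapIcc n I) (_ : ∀ i, y i ∈ Icc (0:ℝ) (2 * Real.pi)),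
    ENNReal.ofReal (∑ i, |f (I i).2 (y i) - f (I i).1 (y i)| / Λ ((i : ℕ) + 1))

/-- `Λ#V₂(f)`. -/
def LamSharpV2 (Λ : ℕ → ℝ) (f : ℝ → ℝ → ℝ) : ℝ≥0∞ :=
  ⨆ (m : ℕ) (J : Fin m → ℝ × ℝ) (x : Fin m → ℝ)
    (_ : NonoverlapIcc m J) (_ : ∀ j, x j ∈ Icc (0:ℝ) (2 * Real.pi)),
    ENNReal.ofReal (∑ j, |f (x j) (J j).2 - f (x j) (J j).1| / Λ ((j : ℕ) + 1))

/-- A collection of `n` pairwise nonoverlapping rectangles `[α,β] × [γ,δ] ⊆ T²`,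
encoded as `((α, β), (γ, δ))`. -/
def NonoverlapRect (n : ℕ) (A : Fin n → (ℝ × ℝ) × (ℝ × ℝ)) : Prop :=
  (∀ k, 0 ≤ (A k).1.1 ∧ (A k).1.1 < (A k).1.2 ∧ (A k).1.2 ≤ 2 * Real.pi ∧
        0 ≤ (A k).2.1 ∧ (A k).2.1 < (A k).2.2 ∧ (A k).2.2 ≤ 2 * Real.pi) ∧
    ∀ k l, k ≠ l →
      Disjoint (Ioo (A k).1.1 (A k).1.2 ×ˢ Ioo (A k).2.1 (A k).2.2)
        (Ioo (A l).1.1 (A l).1.2 ×ˢ Ioo (A l).2.1 (A l).2.2)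

/-- `Λ*V(f)` of Dyachenko–Waterman. -/
def LamStarV (Λ : ℕ → ℝ) (f : ℝ → ℝ → ℝ) : ℝ≥0∞ :=
  ⨆ (n : ℕ) (A : Fin n → (ℝ × ℝ) × (ℝ × ℝ)) (_ : NonoverlapRect n A),
    ENNReal.ofReal (∑ k,
      |f (A k).1.1 (A k).2.1 - f (A k).1.1 (A k).2.2 -
        f (A k).1.2 (A k).2.1 + f (A k).1.2 (A k).2.2| / Λ ((k : ℕ) + 1))

/-- Partial `p`-variation (first variable); with `Φ(u) = u^p`. -/
def PV1pow (p : ℝ) (f : ℝ → ℝ → ℝ) : ℝ≥0∞ :=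
  ⨆ (y ∈ Icc (0:ℝ) (2 * Real.pi)) (n : ℕ) (I : Fin n → ℝ × ℝ) (_ : NonoverlapIcc n I),
    ENNReal.ofReal (∑ i, |f (I i).2 y - f (I i).1 y| ^ p)

/-- Partial `p`-variation (second variable). -/
def PV2pow (p : ℝ) (f : ℝ → ℝ → ℝ) : ℝ≥0∞ :=
  ⨆ (x ∈ Icc (0:ℝ) (2 * Real.pi)) (m : ℕ) (J : Fin m → ℝ × ℝ) (_ : NonoverlapIcc m J),
    ENNReal.ofReal (∑ j, |f x (J j).2 - f x (J j).1| ^ p)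

/-- `V#_{Φ,1}(f)` for the class `B#V_Φ`. -/
def PhiSharpV1 (Φ : ℝ → ℝ) (f : ℝ → ℝ → ℝ) : ℝ≥0∞ :=
  ⨆ (n : ℕ) (I : Fin n → ℝ × ℝ) (y : Fin n → ℝ)
    (_ : NonoverlapIcc n I) (_ : ∀ i, y i ∈ Icc (0:ℝ) (2 * Real.pi)),
    ENNReal.ofReal (∑ i, Φ |f (I i).2 (y i) - f (I i).1 (y i)|)

/-- `V#_{Φ,2}(f)` for the class `B#V_Φ`. -/
def PhiSharpV2 (Φ : ℝ → ℝ) (f : ℝ → ℝ → ℝ) : ℝ≥0∞ :=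
  ⨆ (m : ℕ) (J : Fin m → ℝ × ℝ) (x : Fin m → ℝ)
    (_ : NonoverlapIcc m J) (_ : ∀ j, x j ∈ Icc (0:ℝ) (2 * Real.pi)),
    ENNReal.ofReal (∑ j, Φ |f (x j) (J j).2 - f (x j) (J j).1|)

/-- Partial modulus of variation `v₁(n, f)`. -/
def modV1 (f : ℝ → ℝ → ℝ) (n : ℕ) : ℝ≥0∞ :=
  ⨆ (y ∈ Icc (0:ℝ) (2 * Real.pi)) (I : Fin n → ℝ × ℝ) (_ : NonoverlapIcc n I),
    ENNReal.ofReal (∑ i, |f (I i).2 y - f (I i).1 y|)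

/-- Partial modulus of variation `v₂(m, f)`. -/
def modV2 (f : ℝ → ℝ → ℝ) (m : ℕ) : ℝ≥0∞ :=
  ⨆ (x ∈ Icc (0:ℝ) (2 * Real.pi)) (J : Fin m → ℝ × ℝ) (_ : NonoverlapIcc m J),
    ENNReal.ofReal (∑ j, |f x (J j).2 - f x (J j).1|)

/-- `v₁#(n, f)`. -/
def modSharpV1 (f : ℝ → ℝ → ℝ) (n : ℕ) : ℝ≥0∞ :=
  ⨆ (I : Fin n → ℝ × ℝ) (y : Fin n → ℝ)
    (_ : NonoverlapIcc n I) (_ : ∀ i, y i ∈ Icc (0:ℝ) (2 * Real.pi)),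
    ENNReal.ofReal (∑ i, |f (I i).2 (y i) - f (I i).1 (y i)|)

/-- `v₂#(m, f)`. -/
def modSharpV2 (f : ℝ → ℝ → ℝ) (m : ℕ) : ℝ≥0∞ :=
  ⨆ (J : Fin m → ℝ × ℝ) (x : Fin m → ℝ)
    (_ : NonoverlapIcc m J) (_ : ∀ j, x j ∈ Icc (0:ℝ) (2 * Real.pi)),
    ENNReal.ofReal (∑ j, |f (x j) (J j).2 - f (x j) (J j).1|)

/-- The shifted sequence `Λ_n = {λ_k}_{k=n}^∞`: its `i`-th member (`i ≥ 1`) is `λ_{n+i-1}`. -/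
def ShiftSeq (Λ : ℕ → ℝ) (n : ℕ) : ℕ → ℝ := fun k => Λ (k + n - 1)

/-- The sequence `λ_n = n / log n` (for `n ≥ 2`; the value at `n ≤ 1` is irrelevant). -/
def nlogSeq : ℕ → ℝ := fun n => if n ≤ 1 then 1 else (n : ℝ) / Real.log n

/-- Double Fourier coefficient
`f̂(m,n) = (1/(4π²)) ∫₀^{2π}∫₀^{2π} f(x,y) e^{-imx} e^{-iny} dx dy`. -/
def fCoef (f : ℝ → ℝ → ℝ) (m n : ℤ) : ℂ :=
  (4 * (Real.pi : ℂ) ^ 2)⁻¹ *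
    ∫ x in (0:ℝ)..(2 * Real.pi), ∫ y in (0:ℝ)..(2 * Real.pi),
      (f x y : ℂ) * Complex.exp (-(Complex.I * (m : ℂ) * (x : ℂ))) *
        Complex.exp (-(Complex.I * (n : ℂ) * (y : ℂ)))

/-- Rectangular partial sum `S_{M,N}[f,(x,y)]` of the double Fourier series. -/
def SRect (f : ℝ → ℝ → ℝ) (M N : ℕ) (x y : ℝ) : ℂ :=
  ∑ m ∈ Finset.Icc (-(M : ℤ)) (M : ℤ), ∑ n ∈ Finset.Icc (-(N : ℤ)) (N : ℤ),
    fCoef f m n * Complex.exp (Complex.I * (m : ℂ) * (x : ℂ)) *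
      Complex.exp (Complex.I * (n : ℂ) * (y : ℂ))

/-- One-sided punctured neighborhood filter: from the right if `s = true`,
from the left if `s = false`. -/
def sideF (x : ℝ) (s : Bool) : Filter ℝ :=
  if s then nhdsWithin x (Ioi x) else nhdsWithin x (Iio x)

/-- `HasQuadLim f x y s t L` means the open-quadrant limit of `f` at `(x,y)` from the
quadrant with horizontal direction `s` and vertical direction `t` exists and equals `L`
(e.g. `s = true, t = false` is `f(x+0, y-0)`). -/
def HasQuadLim (f : ℝ → ℝ → ℝ) (x y : ℝ) (s t : Bool) (L : ℝ) : Prop :=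
  Tendsto (fun p : ℝ × ℝ => f p.1 p.2) ((sideF x s) ×ˢ (sideF y t)) (nhds L)

/-- Cesàro numbers `A_k^α = (α+1)(α+2)⋯(α+k)/k!`. -/
def AA (α : ℝ) : ℕ → ℝ
  | 0 => 1
  | k + 1 => AA α k * (α + ((k : ℝ) + 1)) / ((k : ℝ) + 1)

/-- Cesàro `(C; α, β)` means of the double Fourier series of `f`. -/
def cesaro (f : ℝ → ℝ → ℝ) (α β : ℝ) (n m : ℕ) (x y : ℝ) : ℂ :=
  ((1 / (AA α n * AA β m) : ℝ) : ℂ) *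
    ∑ i ∈ Finset.range (n + 1), ∑ j ∈ Finset.range (m + 1),
      ((AA (α - 1) (n - i) * AA (β - 1) (m - j) : ℝ) : ℂ) * SRect f i j x y

end

/-- The intervals `I i`, `i ∈ s`, are pairwise nonoverlapping subintervals of `[0, 2π]`. -/
def NonoverlapOn {ι : Type*} (s : Finset ι) (I : ι → ℝ × ℝ) : Prop :=
  (∀ i ∈ s, 0 ≤ (I i).1 ∧ (I i).1 < (I i).2 ∧ (I i).2 ≤ 2 * Real.pi) ∧
    ∀ i ∈ s, ∀ j ∈ s, i ≠ j → (I i).2 ≤ (I j).1 ∨ (I j).2 ≤ (I i).1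

lemma le_of_one_le_of_le_succ {Λ : ℕ → ℝ} (hmono : ∀ n, 1 ≤ n → Λ n ≤ Λ (n + 1)) {a b : ℕ}
    (ha : 1 ≤ a) (hab : a ≤ b) : Λ a ≤ Λ b := by
  induction b, hab using Nat.le_induction with
  | base => exact le_rfl
  | succ k hk ih => exact ih.trans (hmono k (ha.trans hk))

/-- Terms of a `Λ_n#`-sum may be placed at arbitrary distinct positions `p i ≥ n`. -/
lemma ofReal_sum_le_lamSharpV1 {Λ : ℕ → ℝ} (hpos : ∀ n, 1 ≤ n → 0 < Λ n)
    (hmono : ∀ n, 1 ≤ n → Λ n ≤ Λ (n + 1)) (f : ℝ → ℝ → ℝ) {n : ℕ} (hn : 1 ≤ n)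
    {ι : Type*} (s : Finset ι) (p : ι → ℕ) (I : ι → ℝ × ℝ) (y : ι → ℝ)
    (hinj : Set.InjOn p s) (hp : ∀ i ∈ s, n ≤ p i) (hI : NonoverlapOn s I)
    (hy : ∀ i ∈ s, y i ∈ Icc (0 : ℝ) (2 * Real.pi)) :
    ENNReal.ofReal (∑ i ∈ s, |f (I i).2 (y i) - f (I i).1 (y i)| / Λ (p i)) ≤
      LamSharpV1 (ShiftSeq Λ n) f := by
  classical
  set t := s.image p
  have hex : ∀ x : t, ∃ i ∈ s, p i = x := fun x => by
    exact Finset.mem_image.1 x.2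
  choose g hgs hgp using hex
  set e := t.orderIsoOfFin rfl
  have hlow : ∀ j : Fin t.card, n + (j : ℕ) ≤ (e j : ℕ) := by
    rintro ⟨j, hj⟩
    induction j with
    | zero =>
      have := hp _ (hgs (e ⟨0, hj⟩))
      rw [hgp] at this
      simpa using this
    | succ j ih =>
      have h1 := ih (by omega)
      have h2 : e ⟨j, by omega⟩ < e ⟨j + 1, hj⟩ := e.lt_iff_lt.2 (by simp [Fin.lt_def])
      have h3 : (e ⟨j, by omega⟩ : ℕ) < (e ⟨j + 1, hj⟩ : ℕ) := h2
      simp only at h1 ⊢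
      omega
  have hsum : ∑ i ∈ s, |f (I i).2 (y i) - f (I i).1 (y i)| / Λ (p i) =
      ∑ j : Fin t.card, |f (I (g (e j))).2 (y (g (e j))) - f (I (g (e j))).1 (y (g (e j)))| /
        Λ (e j) := by
    symm
    refine Finset.sum_bij (fun j _ => g (e j)) (fun j _ => hgs _) ?_ ?_ ?_
    · intro a _ b _ hab
      have := congrArg p hab
      simp only [hgp] at this
      exact e.injective (Subtype.ext this)
    · intro i hi
      refine ⟨e.symm ⟨p i, Finset.mem_image_of_mem p hi⟩, Finset.mem_univ _, ?_⟩
      apply hinj (hgs _) hi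
      simp [hgp]
    · intro j _
      rw [hgp]
  rw [hsum]
  have hno : NonoverlapIcc t.card (fun j => I (g (e j))) := by
    refine ⟨fun j => hI.1 _ (hgs _), fun i j hij => hI.2 _ (hgs _) _ (hgs _) fun h => hij ?_⟩
    have := congrArg p h
    simp only [hgp] at this
    exact e.injective (Subtype.ext this)
  refine le_trans (ENNReal.ofReal_le_ofReal (Finset.sum_le_sum fun j _ => ?_))
    (le_iSup_of_le t.card <| le_iSup_of_le (fun j => I (g (e j))) <|
      le_iSup_of_le (fun j => y (g (e j))) <| le_iSup_of_le hno <|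
      le_iSup_of_le (fun j => hy _ (hgs _)) le_rfl)
  have hj : (j : ℕ) + 1 + n - 1 = n + j := by omega
  simp only [ShiftSeq, hj]
  exact div_le_div_of_nonneg_left (abs_nonneg _) (hpos _ (by omega))
    (le_of_one_le_of_le_succ hmono (by omega) (hlow j))

/-- Two mutually nonoverlapping families placed at distinct positions have their joint sum
controlled by a single `Λ_n#`-variation. -/
lemma ofReal_sum_add_sum_le_lamSharpV1 {Λ : ℕ → ℝ} (hpos : ∀ n, 1 ≤ n → 0 < Λ n)
    (hmono : ∀ n, 1 ≤ n → Λ n ≤ Λ (n + 1)) (f : ℝ → ℝ → ℝ) {n : ℕ} (hn : 1 ≤ n)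
    {ι κ : Type*} (s : Finset ι) (t : Finset κ) (p : ι → ℕ) (q : κ → ℕ)
    (I : ι → ℝ × ℝ) (J : κ → ℝ × ℝ) (y : ι → ℝ) (z : κ → ℝ)
    (hp : Set.InjOn p s) (hq : Set.InjOn q t) (hnp : ∀ i ∈ s, n ≤ p i)
    (hpq : ∀ i ∈ s, ∀ j ∈ t, p i < q j) (hnq : ∀ j ∈ t, n ≤ q j)
    (hI : NonoverlapOn s I) (hJ : NonoverlapOn t J)
    (hIJ : ∀ i ∈ s, ∀ j ∈ t, (I i).2 ≤ (J j).1 ∨ (J j).2 ≤ (I i).1)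
    (hy : ∀ i ∈ s, y i ∈ Icc (0 : ℝ) (2 * Real.pi))
    (hz : ∀ j ∈ t, z j ∈ Icc (0 : ℝ) (2 * Real.pi)) :
    ENNReal.ofReal (∑ i ∈ s, |f (I i).2 (y i) - f (I i).1 (y i)| / Λ (p i) +
      ∑ j ∈ t, |f (J j).2 (z j) - f (J j).1 (z j)| / Λ (q j)) ≤
      LamSharpV1 (ShiftSeq Λ n) f := by
  have h := ofReal_sum_le_lamSharpV1 hpos hmono f hn (s.disjSum t) (Sum.elim p q)
    (Sum.elim I J) (Sum.elim y z) ?_ ?_ ⟨?_, ?_⟩ ?_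
  · simpa [Finset.sum_disjSum] using h
  · rintro (a | a) ha (b | b) hb hab <;> simp at ha hb hab
    · rw [hp ha hb hab]
    · exact absurd hab (hpq _ ha _ hb).ne
    · exact absurd hab.symm (hpq _ hb _ ha).ne
    · rw [hq ha hb hab]
  · rintro (a | a) ha <;> simp at ha
    exacts [hnp a ha, hnq a ha]
  · rintro (a | a) ha <;> simp at ha
    exacts [hI.1 a ha, hJ.1 a ha]
  · rintro (a | a) ha (b | b) hb hab <;> simp at ha hb hab
    exacts [hI.2 a ha b hb hab, hIJ a ha b hb, (hIJ b hb a ha).symm, hJ.2 a ha b hb hab]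
  · rintro (a | a) ha <;> simp at ha
    exacts [hy a ha, hz a ha]

lemma exists_lt_sum_of_lt_lamSharpV1 {Λ : ℕ → ℝ} {f : ℝ → ℝ → ℝ} {n : ℕ} {r : ℝ} (hr : 0 ≤ r)
    (h : ENNReal.ofReal r < LamSharpV1 (ShiftSeq Λ n) f) :
    ∃ (k : ℕ) (I : Fin k → ℝ × ℝ) (y : Fin k → ℝ), NonoverlapIcc k I ∧
      (∀ i, y i ∈ Icc (0 : ℝ) (2 * Real.pi)) ∧
      r < ∑ i, |f (I i).2 (y i) - f (I i).1 (y i)| / Λ (n + i) := by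
  simp only [LamSharpV1, lt_iSup_iff] at h
  obtain ⟨k, I, y, hI, hy, h⟩ := h
  refine ⟨k, I, y, hI, hy, ?_⟩
  rw [ENNReal.ofReal_lt_ofReal_iff_of_nonneg hr] at h
  convert h using 4 with i
  simp only [ShiftSeq]
  congr 1
  omega

lemma shiftSeq_one (Λ : ℕ → ℝ) : ShiftSeq Λ 1 = Λ := by
  funext k
  simp [ShiftSeq]

lemma lamSharpV1_shiftSeq_antitone {Λ : ℕ → ℝ} (hpos : ∀ n, 1 ≤ n → 0 < Λ n)
    (hmono : ∀ n, 1 ≤ n → Λ n ≤ Λ (n + 1)) (f : ℝ → ℝ → ℝ) {m n : ℕ} (hm : 1 ≤ m)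
    (hmn : m ≤ n) : LamSharpV1 (ShiftSeq Λ n) f ≤ LamSharpV1 (ShiftSeq Λ m) f := by
  conv_lhs => rw [LamSharpV1]
  refine iSup_le fun k => iSup_le fun I => iSup_le fun y => iSup_le fun hI => iSup_le fun hy => ?_
  refine ofReal_sum_le_lamSharpV1 hpos hmono f hm Finset.univ (fun i : Fin k => (i : ℕ) + 1 + n - 1) I y
    ?_ ?_ ⟨fun i _ => hI.1 i, fun i _ j _ => hI.2 i j⟩ fun i _ => hy i
  · intro a _ b _ hab
    simp only at hab
    exact Fin.ext (by omega)
  · intro i _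
    omega

/-- At most one interval of a nonoverlapping family contains a given point in its interior, so
the intervals containing one of `k` given points contribute at most `k` terms. -/
lemma sum_filter_exists_mem_Ioo_le {k l : ℕ} (r : Fin k → ℝ) {J : Fin l → ℝ × ℝ}
    (hJ : NonoverlapIcc l J) {b : Fin l → ℝ} {K : ℝ} (hK : 0 ≤ K) (hb : ∀ j, b j ≤ K)
    [DecidablePred fun j => ∃ i, r i ∈ Ioo (J j).1 (J j).2] :
    ∑ j with ∃ i, r i ∈ Ioo (J j).1 (J j).2, b j ≤ k * K := by
  classical
  have hsub : (Finset.univ.filter fun j => ∃ i, r i ∈ Ioo (J j).1 (J j).2) ⊆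
      (Finset.univ : Finset (Fin k)).biUnion
        fun i => Finset.univ.filter fun j => r i ∈ Ioo (J j).1 (J j).2 := by
    intro j hj
    simpa using hj
  have hcard : (Finset.univ.filter fun j => ∃ i, r i ∈ Ioo (J j).1 (J j).2).card ≤ k := by
    refine (Finset.card_le_card hsub).trans ?_
    refine (Finset.card_biUnion_le_card_mul _ _ 1 fun i _ => Finset.card_le_one.2 ?_).trans
      (by simp)
    intro a ha b hb
    simp only [Finset.mem_filter, Finset.mem_univ, true_and, mem_Ioo] at ha hb
    by_contra hab
    rcases hJ.2 a b hab with h | h <;> linarith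
  calc ∑ j with ∃ i, r i ∈ Ioo (J j).1 (J j).2, b j
      ≤ (Finset.univ.filter fun j => ∃ i, r i ∈ Ioo (J j).1 (J j).2).card • K :=
        Finset.sum_le_card_nsmul _ _ _ fun j _ => hb j
    _ ≤ k * K := by
        rw [nsmul_eq_mul]
        gcongr

/-- The key inequality: two families almost attaining the limiting variation, the second far out,
recombine along the even and odd members of the first. -/
lemma mul_limit_le {Λ : ℕ → ℝ} (hpos : ∀ n, 1 ≤ n → 0 < Λ n)
    (hmono : ∀ n, 1 ≤ n → Λ n ≤ Λ (n + 1)) (htop : Tendsto Λ atTop atTop) {f : ℝ → ℝ → ℝ}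
    {c d ε : ℝ} (hε : 0 < ε) (hεd : ε < d) (hc : 0 ≤ c) {N : ℕ} (hN : 1 ≤ N)
    (hratio : ∀ n, N ≤ n → c * Λ n ≤ Λ (2 * n))
    (hlow : ∀ n, 1 ≤ n → ENNReal.ofReal d ≤ LamSharpV1 (ShiftSeq Λ n) f)
    (hup : LamSharpV1 (ShiftSeq Λ N) f ≤ ENNReal.ofReal (d + ε)) :
    (c - 1) * d ≤ (c + 4) * ε := by
  classical
  have hlt : ENNReal.ofReal (d - ε) < ENNReal.ofReal d :=
    (ENNReal.ofReal_lt_ofReal_iff (by linarith)).2 (by linarith)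
  obtain ⟨k, I, y, hI, hy, hIsum⟩ := exists_lt_sum_of_lt_lamSharpV1 (by linarith)
    (hlt.trans_le (hlow (2 * N) (by omega)))
  set K := Λ N * (d + ε)
  have hΛN := hpos N hN
  have hK0 : 0 < K := mul_pos hΛN (by linarith)
  have hosc : ∀ (a b z : ℝ), 0 ≤ a → a < b → b ≤ 2 * Real.pi → z ∈ Icc (0 : ℝ) (2 * Real.pi) →
      |f b z - f a z| ≤ K := by
    intro a b z ha hab hb hz
    have h := ofReal_sum_le_lamSharpV1 hpos hmono f hN ({()} : Finset Unit) (fun _ => N)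
      (fun _ => (a, b)) (fun _ => z) (by simp) (by simp) ⟨by simp [ha, hab, hb], by simp⟩
      (fun _ _ => hz)
    have h' := (ENNReal.ofReal_le_ofReal_iff (by linarith)).1 (h.trans hup)
    simp only [Finset.sum_singleton] at h'
    rwa [div_le_iff₀ hΛN, mul_comm] at h'
  obtain ⟨M, hMk, hMΛ⟩ : ∃ M, N + k ≤ M ∧ k * K / ε ≤ Λ M :=
    ((eventually_ge_atTop (N + k)).and (htop.eventually_ge_atTop _)).exists
  have hM1 : 1 ≤ M := by omega
  have hΛM := hpos M hM1
  obtain ⟨l, J, z, hJ, hz, hJsum⟩ := exists_lt_sum_of_lt_lamSharpV1 (by linarith)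
    (hlt.trans_le (hlow M hM1))
  set a : Fin k → ℝ := fun i => |f (I i).2 (y i) - f (I i).1 (y i)| / Λ (N + (i : ℕ) / 2) with ha
  set b : Fin l → ℝ := fun j => |f (J j).2 (z j) - f (J j).1 (z j)| / Λ (M + j)
  have hb0 : ∀ j, 0 ≤ b j := fun j => div_nonneg (abs_nonneg _) (hpos _ (by omega)).le
  have hbK : ∀ j, b j ≤ K / Λ M := fun j =>
    div_le_div₀ hK0.le (hosc _ _ _ (hJ.1 j).1 (hJ.1 j).2.1 (hJ.1 j).2.2 (hz j)) hΛM
      (le_of_one_le_of_le_succ hmono hM1 (by omega))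
  have hbad := sum_filter_exists_mem_Ioo_le (fun i => (I i).2) hJ (by positivity) hbK
  have hbadε : (k : ℝ) * (K / Λ M) ≤ ε := by
    rw [div_le_iff₀ hε] at hMΛ
    rw [← mul_div_assoc, div_le_iff₀ hΛM]
    linarith
  have hasum : c * (d - ε) ≤ ∑ i, a i := by
    refine (mul_le_mul_of_nonneg_left hIsum.le hc).trans ?_
    rw [Finset.mul_sum]
    refine Finset.sum_le_sum fun i _ => ?_
    have h1 := hpos (N + (i : ℕ) / 2) (by omega)
    have h2 := hpos (2 * N + i) (by omega)
    have h3 : c * Λ (N + (i : ℕ) / 2) ≤ Λ (2 * N + i) :=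
      (hratio _ (by omega)).trans (le_of_one_le_of_le_succ hmono (by omega) (by omega))
    rw [ha, ← mul_div_assoc, div_le_div_iff₀ h2 h1]
    nlinarith [mul_le_mul_of_nonneg_left h3 (abs_nonneg (f (I i).2 (y i) - f (I i).1 (y i)))]
  set S : ℕ → Finset (Fin k) := fun r => Finset.univ.filter fun i => (i : ℕ) % 2 = r with hS
  set G : ℕ → Finset (Fin l) := fun r =>
    Finset.univ.filter fun j => ∀ i ∈ S r, (I i).2 ≤ (J j).1 ∨ (J j).2 ≤ (I i).1 with hG
  have hcomb : ∀ r, ∑ i ∈ S r, a i + ∑ j ∈ G r, b j ≤ d + ε := by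
    intro r
    refine (ENNReal.ofReal_le_ofReal_iff (by linarith)).1 (le_trans ?_ hup)
    refine ofReal_sum_add_sum_le_lamSharpV1 hpos hmono f hN (S r) (G r)
      (fun i => N + (i : ℕ) / 2) (fun j => M + j) I J y z ?_ ?_ ?_ ?_ ?_
      ⟨fun i _ => hI.1 i, fun i _ j _ => hI.2 i j⟩
      ⟨fun i _ => hJ.1 i, fun i _ j _ => hJ.2 i j⟩ ?_ (fun i _ => hy i) (fun j _ => hz j)
    · intro u hu v hv huv
      simp [hS] at hu hv huv
      exact Fin.ext (by omega)
    · intro u _ v _ huv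
      simp at huv
      exact Fin.ext (by omega)
    · intro i _
      omega
    · intro i _ j _
      omega
    · intro j _
      omega
    · intro i hi j hj
      exact (Finset.mem_filter.1 hj).2 i hi
  have hasplit : ∑ i, a i ≤ ∑ i ∈ S 0, a i + ∑ i ∈ S 1, a i := by
    rw [← Finset.sum_filter_add_sum_filter_not Finset.univ (fun i : Fin k => (i : ℕ) % 2 = 0)]
    simp [hS]
  have hcover : (Finset.univ : Finset (Fin l)) ⊆
      (Finset.univ.filter fun j => ∃ i, (I i).2 ∈ Ioo (J j).1 (J j).2) ∪ (G 0 ∪ G 1) := by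
    intro j _
    by_contra hj
    simp only [hG, Finset.mem_union, Finset.mem_filter, Finset.mem_univ, true_and, not_or,
      not_forall, not_exists, mem_Ioo, not_and_or, not_le, not_lt] at hj
    obtain ⟨hj0, ⟨u, hu, hu1, hu2⟩, v, hv, hv1, hv2⟩ := hj
    have huv : u ≠ v := by
      rintro rfl
      simp [hS] at hu hv
      omega
    rcases hI.2 u v huv with h | h
    · rcases hj0 u with h' | h' <;> linarith
    · rcases hj0 v with h' | h' <;> linarith
  have hbsplit : ∑ j, b j ≤ ε + (∑ j ∈ G 0, b j + ∑ j ∈ G 1, b j) := by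
    refine (Finset.sum_le_sum_of_subset_of_nonneg hcover fun j _ _ => hb0 j).trans ?_
    have h1 := Finset.sum_union_inter
      (s₁ := Finset.univ.filter fun j => ∃ i, (I i).2 ∈ Ioo (J j).1 (J j).2)
      (s₂ := G 0 ∪ G 1) (f := b)
    have h2 := Finset.sum_union_inter (s₁ := G 0) (s₂ := G 1) (f := b)
    have h3 := Finset.sum_nonneg fun j
      (_ : j ∈ (Finset.univ.filter fun j => ∃ i, (I i).2 ∈ Ioo (J j).1 (J j).2) ∩ (G 0 ∪ G 1)) =>
        hb0 j
    have h4 := Finset.sum_nonneg fun j (_ : j ∈ G 0 ∩ G 1) => hb0 j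
    linarith
  have e0 := hcomb 0
  have e1 := hcomb 1
  nlinarith

lemma tendsto_lamSharpV1_shiftSeq {Λ : ℕ → ℝ} (hpos : ∀ n, 1 ≤ n → 0 < Λ n)
    (hmono : ∀ n, 1 ≤ n → Λ n ≤ Λ (n + 1)) (htop : Tendsto Λ atTop atTop)
    (hq : 1 < Filter.liminf (fun n : ℕ => Λ (2 * n) / Λ n) atTop) {f : ℝ → ℝ → ℝ}
    (hf : LamSharpV1 Λ f ≠ ⊤) :
    Tendsto (fun n : ℕ => LamSharpV1 (ShiftSeq Λ n) f) atTop (nhds 0) := by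
  obtain ⟨c, hc1, hcq⟩ := exists_between hq
  have hbdd : IsBoundedUnder (· ≥ ·) atTop (fun n : ℕ => Λ (2 * n) / Λ n) :=
    isBoundedUnder_of_eventually_ge (a := 0) <| (eventually_ge_atTop 1).mono fun n hn =>
      div_nonneg (hpos _ (by omega)).le (hpos _ hn).le
  obtain ⟨N₀, hN₀⟩ := eventually_atTop.1 (eventually_lt_of_lt_liminf hcq hbdd)
  rw [← tendsto_add_atTop_iff_nat 1]
  have hanti : Antitone fun n : ℕ => LamSharpV1 (ShiftSeq Λ (n + 1)) f := fun m n hmn =>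
    lamSharpV1_shiftSeq_antitone hpos hmono f (by omega) (by omega)
  have hlim := tendsto_atTop_iInf hanti
  set δ := ⨅ n : ℕ, LamSharpV1 (ShiftSeq Λ (n + 1)) f
  have hδtop : δ ≠ ⊤ := ne_top_of_le_ne_top hf <| by
    simpa [shiftSeq_one] using iInf_le (fun n : ℕ => LamSharpV1 (ShiftSeq Λ (n + 1)) f) 0
  suffices hδ0 : δ = 0 by rwa [hδ0] at hlim
  by_contra hne
  set d := δ.toReal
  have hd0 : 0 < d := ENNReal.toReal_pos hne hδtop
  have hdδ : ENNReal.ofReal d = δ := ENNReal.ofReal_toReal hδtop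
  have hkey : ∀ ε, 0 < ε → ε < d → (c - 1) * d ≤ (c + 4) * ε := by
    intro ε hε hεd
    have hlt : δ < ENNReal.ofReal (d + ε) := by
      rw [← hdδ]
      exact (ENNReal.ofReal_lt_ofReal_iff (by linarith)).2 (by linarith)
    obtain ⟨N, hN, hNup⟩ :=
      ((eventually_ge_atTop N₀).and (hlim.eventually_lt_const hlt)).exists
    refine mul_limit_le hpos hmono htop (N := N + 1) hε hεd (by linarith) (by omega)
      (fun n hn => ?_) (fun n hn => ?_) hNup.le
    · exact ((lt_div_iff₀ (hpos n (by omega))).1 (hN₀ n (by omega))).le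
    · rw [hdδ]
      obtain ⟨m, rfl⟩ := Nat.exists_eq_add_of_le' hn
      exact iInf_le _ m
  have hc4 : 0 < c + 4 := by linarith
  set ε := min (d / 2) ((c - 1) * d / (2 * (c + 4)))
  have hcd : 0 < (c - 1) * d := mul_pos (by linarith) hd0
  have h := hkey ε (lt_min (by linarith) (by positivity))
    ((min_le_left _ _).trans_lt (by linarith))
  have h2 : (c + 4) * ε ≤ (c - 1) * d / 2 := by
    calc (c + 4) * ε ≤ (c + 4) * ((c - 1) * d / (2 * (c + 4))) := by
          gcongr
          exact min_le_right _ _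
      _ = (c - 1) * d / 2 := by field_simp
  linarith

/-- if `liminf λ_{2n}/λ_n = q > 1` then `Λ#BV = CΛ#V`, i.e. every
`f ∈ Λ#BV` is continuous in `Λ#`-variation. -/
theorem stmt9 (Λ : ℕ → ℝ)
    (hpos : ∀ n, 1 ≤ n → 0 < Λ n) (hmono : ∀ n, 1 ≤ n → Λ n ≤ Λ (n + 1))
    (htop : Tendsto Λ atTop atTop)
    (hq : 1 < Filter.liminf (fun n : ℕ => Λ (2 * n) / Λ n) atTop)
    (f : ℝ → ℝ → ℝ) (hper : Periodic2 f)
    (hsharp : LamSharpV1 Λ f + LamSharpV2 Λ f ≠ ⊤) :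
    Tendsto (fun n : ℕ => LamSharpV1 (ShiftSeq Λ n) f) atTop (nhds 0) ∧
    Tendsto (fun n : ℕ => LamSharpV2 (ShiftSeq Λ n) f) atTop (nhds 0) := by
  exact ⟨tendsto_lamSharpV1_shiftSeq hpos hmono htop hq (ENNReal.add_ne_top.1 hsharp).1,
    tendsto_lamSharpV1_shiftSeq (f := fun x y => f y x) hpos hmono htop hq
      (ENNReal.add_ne_top.1 hsharp).2⟩
end

section
/- Let α, β > 0 with α + β < 1. Then for every continuous function f : ℝ² → ℝ, 2π-periodic in each variable, with f ∈ PBV, the Cesàro (C; −α, −β) means σ_{n,m}^{−α,−β}(f;x,y) of the double Fourier series of f converge to f uniformly on [0,2π]² as n,m → ∞. -/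
open scoped ENNReal BigOperators
open Filter Set

lemma AA_mul (γ : ℝ) (n : ℕ) : γ * AA γ n = (γ + n) * AA (γ - 1) n := by
  induction n with
  | zero => simp [AA]
  | succ n ih =>
    have h : ((n : ℝ) + 1) ≠ 0 := by positivity
    simp only [AA]
    rw [mul_div_assoc', mul_div_assoc', ← mul_assoc, ih]
    push_cast
    ring

lemma AA_succ_sub (γ : ℝ) (n : ℕ) : AA γ (n + 1) = AA γ n + AA (γ - 1) (n + 1) := by
  have h : ((n : ℝ) + 1) ≠ 0 := by positivity
  have := AA_mul γ n
  simp only [AA]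
  field_simp
  linear_combination this

lemma AA_sum (γ : ℝ) (n : ℕ) : ∑ j ∈ Finset.range (n + 1), AA (γ - 1) j = AA γ n := by
  induction n with
  | zero => simp [AA]
  | succ n ih => rw [Finset.sum_range_succ, ih, ← AA_succ_sub]

lemma AA_zero_left (n : ℕ) : AA 0 n = 1 := by
  induction n with
  | zero => simp [AA]
  | succ n ih =>
    have h : ((n : ℝ) + 1) ≠ 0 := by positivity
    simp [AA, ih, h]

lemma AA_one_left (n : ℕ) : AA 1 n = n + 1 := by
  have := AA_mul 1 n
  simp [AA_zero_left] at this
  linarith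

lemma AA_pos {γ : ℝ} (hγ : -1 < γ) (n : ℕ) : 0 < AA γ n := by
  induction n with
  | zero => simp [AA]
  | succ n ih =>
    have h : (0 : ℝ) ≤ n := by positivity
    simp only [AA]
    have : 0 < γ + (n + 1) := by linarith
    positivity

lemma AA_antitone {α : ℝ} (h0 : 0 ≤ α) (h1 : α < 1) : Antitone (AA (-α)) := by
  refine antitone_nat_of_succ_le fun n => ?_
  have hp := AA_pos (γ := -α) (by linarith) n
  have h : (0 : ℝ) < n + 1 := by positivity
  simp only [AA]
  rw [div_le_iff₀ h]
  nlinarith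

lemma AA_monotone {γ : ℝ} (h0 : 0 ≤ γ) : Monotone (AA γ) := by
  refine monotone_nat_of_le_succ fun n => ?_
  have hp := AA_pos (γ := γ) (by linarith) n
  have h : (0 : ℝ) < n + 1 := by positivity
  simp only [AA]
  rw [le_div_iff₀ h]
  nlinarith

lemma AA_le_rpow {α : ℝ} (h0 : 0 ≤ α) (h1 : α < 1) (n : ℕ) :
    AA (-α) n ≤ ((n : ℝ) + 1) ^ (-α) := by
  induction n with
  | zero => simp [AA]
  | succ n ih =>
    have h : (0 : ℝ) < n + 1 := by positivity
    have hn : (0 : ℝ) ≤ n := by positivity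
    have hb : 1 + (-α) * ((n : ℝ) + 1)⁻¹ ≤ (1 + ((n : ℝ) + 1)⁻¹) ^ (-α) := by
      have hs : 0 ≤ ((n : ℝ) + 1)⁻¹ := by positivity
      have h2 := rpow_one_add_le_one_add_mul_self (s := ((n : ℝ) + 1)⁻¹) (by linarith) h0 h1.le
      have h3 : 0 < (1 + ((n : ℝ) + 1)⁻¹) ^ α := by positivity
      rw [Real.rpow_neg (by positivity), ← mul_le_mul_iff_left₀ h3, inv_mul_cancel₀ h3.ne']
      have h4 : 0 ≤ α * ((n : ℝ) + 1)⁻¹ := by positivity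
      by_cases h5 : 1 + -α * ((n : ℝ) + 1)⁻¹ ≤ 0
      · exact (mul_nonpos_of_nonpos_of_nonneg h5 h3.le).trans zero_le_one
      · nlinarith
    have e1 : AA (-α) (n + 1) = AA (-α) n * (1 + (-α) * ((n : ℝ) + 1)⁻¹) := by
      simp only [AA]; field_simp; ring
    have e2 : (((n + 1 : ℕ) : ℝ) + 1) ^ (-α) =
        ((n : ℝ) + 1) ^ (-α) * (1 + ((n : ℝ) + 1)⁻¹) ^ (-α) := by
      rw [← Real.mul_rpow h.le (by positivity)]
      congr 1
      push_cast
      field_simp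
    rw [e1, e2]
    have h3 : 0 ≤ 1 + (-α) * ((n : ℝ) + 1)⁻¹ := by
      have : α * ((n : ℝ) + 1)⁻¹ ≤ 1 := by
        rw [← div_eq_mul_inv, div_le_one h]; linarith
      linarith
    gcongr

lemma rpow_le_AA {α : ℝ} (h0 : 0 ≤ α) (h1 : α < 1) (n : ℕ) :
    (1 - α) * ((n : ℝ) + 1) ^ (-α) ≤ AA (-α) n := by
  have key : ∀ k : ℕ, (1 - α) * ((k : ℝ) + 1) ^ (-α) ≤ AA (-α) (k + 1) := by
    intro k
    induction k with
    | zero => simp [AA]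
    | succ k ih =>
      have h : (0 : ℝ) < k + 2 := by positivity
      have h' : (0 : ℝ) < k + 1 := by positivity
      have hb : (1 + (-((k : ℝ) + 2)⁻¹)) ^ α ≤ 1 + α * (-((k : ℝ) + 2)⁻¹) := by
        refine rpow_one_add_le_one_add_mul_self ?_ h0 h1.le
        have : ((k : ℝ) + 2)⁻¹ ≤ 1 := inv_le_one_of_one_le₀ (by linarith)
        linarith
      have e1 : AA (-α) (k + 1 + 1) = AA (-α) (k + 1) * (1 + α * (-((k : ℝ) + 2)⁻¹)) := by
        rw [AA]; push_cast
        have : (k : ℝ) + 1 + 1 = k + 2 := by ring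
        rw [this]
        field_simp; ring
      have e2 : (((k + 1 : ℕ) : ℝ) + 1) ^ (-α) =
          ((k : ℝ) + 1) ^ (-α) * (1 + (-((k : ℝ) + 2)⁻¹)) ^ α := by
        have : 1 + (-((k : ℝ) + 2)⁻¹) = (k + 1) / (k + 2) := by field_simp; ring
        rw [this, Real.div_rpow h'.le h.le, Real.rpow_neg h'.le]
        push_cast
        rw [show (k : ℝ) + 1 + 1 = k + 2 by ring, Real.rpow_neg h.le]
        have : 0 < ((k : ℝ) + 1) ^ α := by positivity
        field_simp
      rw [e1, e2, ← mul_assoc]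
      have hp := AA_pos (γ := -α) (by linarith) (k + 1)
      have h3 : 0 ≤ (1 + (-((k : ℝ) + 2)⁻¹)) ^ α := by
        apply Real.rpow_nonneg
        have : ((k : ℝ) + 2)⁻¹ ≤ 1 := inv_le_one_of_one_le₀ (by linarith)
        linarith
      gcongr
  cases n with
  | zero => simp [AA]; linarith
  | succ k =>
    refine le_trans ?_ (key k)
    have : (((k + 1 : ℕ) : ℝ) + 1) ^ (-α) ≤ ((k : ℝ) + 1) ^ (-α) := by
      apply Real.rpow_le_rpow_of_nonpos (by positivity) (by push_cast; linarith) (by linarith)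
    have : 0 ≤ 1 - α := by linarith
    gcongr

lemma abel_identity (b : ℕ → ℂ) (z : ℂ) (n : ℕ) :
    (1 - z) * ∑ k ∈ Finset.range n, b k * z ^ k =
      b 0 - b n * z ^ n + ∑ k ∈ Finset.range n, (b (k + 1) - b k) * z ^ (k + 1) := by
  induction n with
  | zero => simp
  | succ n ih => rw [Finset.sum_range_succ, Finset.sum_range_succ, mul_add, ih]; ring

lemma abel_bound (b : ℕ → ℝ) (hb : Antitone b) (h0 : ∀ k, 0 ≤ b k) (z : ℂ) (hz : ‖z‖ = 1)
    (n : ℕ) : ‖1 - z‖ * ‖∑ k ∈ Finset.range n, (b k : ℂ) * z ^ k‖ ≤ 2 * b 0 := by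
  rw [← norm_mul, abel_identity (fun k => (b k : ℂ))]
  have h1 : ‖∑ k ∈ Finset.range n, ((b (k + 1) : ℂ) - b k) * z ^ (k + 1)‖ ≤ b 0 - b n := by
    refine (norm_sum_le _ _).trans ?_
    rw [← Finset.sum_range_sub' b n]
    refine Finset.sum_le_sum fun k _ => ?_
    rw [norm_mul, norm_pow, hz, one_pow, mul_one, ← Complex.ofReal_sub, Complex.norm_real,
      Real.norm_eq_abs, abs_sub_comm, abs_of_nonneg]
    linarith [hb (Nat.le_succ k)]
  have h2 : ‖(b n : ℂ) * z ^ n‖ = b n := by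
    rw [norm_mul, norm_pow, hz, one_pow, mul_one, Complex.norm_real, Real.norm_eq_abs,
      abs_of_nonneg (h0 n)]
  have h3 : ‖(b 0 : ℂ)‖ = b 0 := by
    rw [Complex.norm_real, Real.norm_eq_abs, abs_of_nonneg (h0 0)]
  calc _ ≤ ‖(b 0 : ℂ)‖ + ‖(b n : ℂ) * z ^ n‖ + _ := (norm_add_le _ _).trans
        (add_le_add_left (norm_sub_le _ _) _)
    _ ≤ _ := by rw [h2, h3]; linarith

lemma norm_one_sub_exp_ge {t : ℝ} (ht : |t| ≤ Real.pi) :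
    2 * |t| / Real.pi ≤ ‖1 - Complex.exp (Complex.I * t)‖ := by
  have h := Real.mul_abs_le_abs_sin (x := t / 2)
    (by rw [abs_div, abs_of_pos (zero_lt_two' ℝ)]; linarith)
  have e : ‖1 - Complex.exp (Complex.I * t)‖ = 2 * |Real.sin (t / 2)| := by
    rw [norm_sub_rev, Complex.norm_exp_I_mul_ofReal_sub_one]
    rw [Real.norm_eq_abs, abs_mul, abs_of_pos (zero_lt_two' ℝ)]
  rw [e]
  rw [abs_div, abs_of_pos (zero_lt_two' ℝ)] at h
  calc _ = 2 * (2 / Real.pi * (|t| / 2)) := by ring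
    _ ≤ _ := by linarith

/-- The even trigonometric polynomial of degree at most `n` with Fourier coefficients `c |k|`. -/
noncomputable def evenKer (c : ℕ → ℝ) (n : ℕ) (t : ℝ) : ℂ :=
  ∑ k ∈ Finset.Icc (-(n : ℤ)) n, (c k.natAbs : ℂ) * Complex.exp (-(Complex.I * (k : ℂ) * (t : ℂ)))

/-- The Cesàro kernel of order `γ`. -/
noncomputable def cesaroKer (γ : ℝ) (n : ℕ) : ℝ → ℂ :=
  evenKer (fun k => AA γ (n - k) / AA γ n) n

/-- The polynomial `∑_{j ≤ n} A_j^γ w^j`. -/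
noncomputable def powSum (γ : ℝ) (n : ℕ) (w : ℂ) : ℂ :=
  ∑ j ∈ Finset.range (n + 1), (AA γ j : ℂ) * w ^ j

lemma sum_Icc_neg_self {E : Type*} [AddCommGroup E] (φ : ℤ → E) (n : ℕ) :
    ∑ k ∈ Finset.Icc (-(n : ℤ)) n, φ k =
      ∑ k ∈ Finset.range (n + 1), φ k + ∑ k ∈ Finset.range (n + 1), φ (-(k : ℤ)) - φ 0 := by
  induction n with
  | zero => simp
  | succ n ih =>
    have : Finset.Icc (-((n + 1 : ℕ) : ℤ)) ((n + 1 : ℕ) : ℤ) =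
        insert ((n : ℤ) + 1) (insert (-((n : ℤ) + 1)) (Finset.Icc (-(n : ℤ)) n)) := by
      ext k; simp only [Finset.mem_Icc, Finset.mem_insert]; push_cast; omega
    rw [this, Finset.sum_insert, Finset.sum_insert, ih, Finset.sum_range_succ _ (n + 1),
      Finset.sum_range_succ _ (n + 1)]
    · push_cast; abel
    · simp
    · simp only [Finset.mem_Icc, Finset.mem_insert]; omega

lemma continuous_evenKer (c : ℕ → ℝ) (n : ℕ) : Continuous (evenKer c n) := by
  unfold evenKer; fun_prop

lemma norm_exp_I_mul_int (k : ℤ) (t : ℝ) :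
    ‖Complex.exp (Complex.I * (k : ℂ) * (t : ℂ))‖ = 1 := by
  rw [show Complex.I * (k : ℂ) * (t : ℂ) = ((k * t : ℝ) : ℂ) * Complex.I by push_cast; ring]
  exact Complex.norm_exp_ofReal_mul_I _

lemma norm_exp_neg_I_mul_int (k : ℤ) (t : ℝ) :
    ‖Complex.exp (-(Complex.I * (k : ℂ) * (t : ℂ)))‖ = 1 := by
  rw [Complex.exp_neg, norm_inv, norm_exp_I_mul_int, inv_one]

lemma norm_evenKer_le (c : ℕ → ℝ) (n : ℕ) (t : ℝ) :
    ‖evenKer c n t‖ ≤ ∑ k ∈ Finset.Icc (-(n : ℤ)) n, |c k.natAbs| := by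
  refine (norm_sum_le _ _).trans (Finset.sum_le_sum fun k _ => ?_)
  rw [norm_mul, norm_exp_neg_I_mul_int, mul_one, Complex.norm_real, Real.norm_eq_abs]

lemma powSum_mul (γ : ℝ) (n : ℕ) (w : ℂ) :
    (1 - w) * powSum γ n w = powSum (γ - 1) n w - AA γ n * w ^ (n + 1) := by
  unfold powSum
  induction n with
  | zero => simp [AA]
  | succ n ih =>
    rw [Finset.sum_range_succ, mul_add, ih, Finset.sum_range_succ _ (n + 1), AA_succ_sub γ n]
    push_cast
    ring

lemma AA_mul_cesaroKer {γ : ℝ} (hγ : -1 < γ) (n : ℕ) (t : ℝ) :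
    (AA γ n : ℂ) * cesaroKer γ n t =
      Complex.exp (Complex.I * t) ^ n * powSum γ n (Complex.exp (-(Complex.I * t))) +
      Complex.exp (-(Complex.I * t)) ^ n * powSum γ n (Complex.exp (Complex.I * t)) - AA γ n := by
  have hA : (AA γ n : ℂ) ≠ 0 := by exact_mod_cast (AA_pos hγ n).ne'
  have hzw : Complex.exp (Complex.I * t) * Complex.exp (-(Complex.I * t)) = 1 := by
    rw [← Complex.exp_add]; simp
  set z := Complex.exp (Complex.I * t) with hz
  set w := Complex.exp (-(Complex.I * t)) with hw
  have key : ∀ a b : ℂ, a * b = 1 → a ^ n * powSum γ n b =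
      ∑ k ∈ Finset.range (n + 1), (AA γ (n - k) : ℂ) * a ^ k := by
    intro a b hab
    unfold powSum
    rw [Finset.mul_sum, ← Finset.sum_range_reflect]
    refine Finset.sum_congr rfl fun k hk => ?_
    have hk' : k ≤ n := by simpa [Nat.lt_succ_iff] using hk
    have h1 : n + 1 - 1 - k = n - k := by omega
    rw [h1]
    have h2 : a ^ n = a ^ k * a ^ (n - k) := by rw [← pow_add]; congr 1; omega
    have h3 : a ^ (n - k) * b ^ (n - k) = 1 := by rw [← mul_pow, hab, one_pow]
    rw [h2]
    linear_combination (a ^ k * (AA γ (n - k) : ℂ)) * h3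
  rw [key z w hzw, key w z (by rw [mul_comm]; exact hzw)]
  unfold cesaroKer evenKer
  rw [sum_Icc_neg_self, mul_sub, mul_add, Finset.mul_sum, Finset.mul_sum, add_comm]
  congr 1
  · congr 1
    · refine Finset.sum_congr rfl fun k _ => ?_
      rw [hz, ← Complex.exp_nat_mul]
      simp only [Int.natAbs_neg, Int.natAbs_natCast]
      push_cast
      rw [show -(Complex.I * -(k : ℂ) * t) = k * (Complex.I * t) by ring]
      field_simp
    · refine Finset.sum_congr rfl fun k _ => ?_
      rw [hw, ← Complex.exp_nat_mul]
      simp only [Int.natAbs_natCast]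
      push_cast
      rw [show -(Complex.I * (k : ℂ) * t) = k * -(Complex.I * t) by ring]
      field_simp
  · simp [div_self hA]

lemma norm_exp_I_mul (t : ℝ) : ‖Complex.exp (Complex.I * t)‖ = 1 := by
  simp

lemma exp_neg_I_mul (t : ℝ) :
    Complex.exp (-(Complex.I * t)) = Complex.exp (Complex.I * ((-t : ℝ) : ℂ)) := by
  push_cast; ring_nf

lemma norm_cesaroKer_le_of_powSum {γ : ℝ} (hγ : -1 < γ) (n : ℕ) (t : ℝ) {B : ℝ}
    (h1 : ‖powSum γ n (Complex.exp (Complex.I * t))‖ ≤ B)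
    (h2 : ‖powSum γ n (Complex.exp (Complex.I * ((-t : ℝ) : ℂ)))‖ ≤ B) :
    AA γ n * ‖cesaroKer γ n t‖ ≤ 2 * B + AA γ n := by
  have hA := AA_pos hγ n
  have e : AA γ n * ‖cesaroKer γ n t‖ = ‖(AA γ n : ℂ) * cesaroKer γ n t‖ := by
    rw [norm_mul, Complex.norm_real, Real.norm_eq_abs, abs_of_pos hA]
  rw [e, AA_mul_cesaroKer hγ, exp_neg_I_mul]
  refine (norm_sub_le _ _).trans ?_
  rw [Complex.norm_real, Real.norm_eq_abs, abs_of_pos hA]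
  gcongr
  refine (norm_add_le _ _).trans ?_
  rw [norm_mul, norm_mul, norm_pow, norm_pow, norm_exp_I_mul, norm_exp_I_mul]
  simp only [one_pow, one_mul]
  linarith

lemma norm_cesaroKer_le_of_powSum_sub_one {γ : ℝ} (hγ : -1 < γ) (n : ℕ) {t : ℝ} (ht0 : t ≠ 0)
    (ht : |t| ≤ Real.pi) {B : ℝ}
    (h1 : ‖powSum (γ - 1) n (Complex.exp (Complex.I * t))‖ ≤ B)
    (h2 : ‖powSum (γ - 1) n (Complex.exp (Complex.I * ((-t : ℝ) : ℂ)))‖ ≤ B) :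
    AA γ n * ‖cesaroKer γ n t‖ ≤ Real.pi * B / |t| := by
  have hA := AA_pos hγ n
  have hB : 0 ≤ B := (norm_nonneg _).trans h1
  have htp : 0 < |t| := abs_pos.2 ht0
  have e : AA γ n * ‖cesaroKer γ n t‖ = ‖(AA γ n : ℂ) * cesaroKer γ n t‖ := by
    rw [norm_mul, Complex.norm_real, Real.norm_eq_abs, abs_of_pos hA]
  have g1 := norm_one_sub_exp_ge ht
  have g2 := norm_one_sub_exp_ge (t := -t) (by rwa [abs_neg])
  rw [abs_neg] at g2
  have hzw : Complex.exp (Complex.I * t) * Complex.exp (Complex.I * ((-t : ℝ) : ℂ)) = 1 := by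
    rw [← Complex.exp_add]; simp
  have m1 := powSum_mul γ n (Complex.exp (Complex.I * t))
  have m2 := powSum_mul γ n (Complex.exp (Complex.I * ((-t : ℝ) : ℂ)))
  rw [e, AA_mul_cesaroKer hγ, exp_neg_I_mul]
  have nz := norm_exp_I_mul t
  have nw := norm_exp_I_mul (-t)
  set z := Complex.exp (Complex.I * t)
  set w := Complex.exp (Complex.I * ((-t : ℝ) : ℂ))
  have hpos : 0 < 2 * |t| / Real.pi := by positivity
  have hz : 1 - z ≠ 0 := by rw [← norm_pos_iff]; linarith
  have hw : 1 - w ≠ 0 := by rw [← norm_pos_iff]; linarith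
  have hn : z ^ n * w ^ n = 1 := by rw [← mul_pow, hzw, one_pow]
  have key : z ^ n * powSum γ n w + w ^ n * powSum γ n z - AA γ n =
      z ^ n * (powSum (γ - 1) n w / (1 - w)) + w ^ n * (powSum (γ - 1) n z / (1 - z)) := by
    have p1 : powSum γ n w = (powSum (γ - 1) n w - AA γ n * w ^ (n + 1)) / (1 - w) := by
      rw [eq_div_iff hw, mul_comm]; exact m2
    have p2 : powSum γ n z = (powSum (γ - 1) n z - AA γ n * z ^ (n + 1)) / (1 - z) := by
      rw [eq_div_iff hz, mul_comm]; exact m1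
    rw [p1, p2]
    field_simp
    rw [pow_succ, pow_succ]
    linear_combination (-(AA γ n : ℂ) * (w * (1 - z) + z * (1 - w))) * hn +
      (AA γ n : ℂ) * hzw
  rw [key]
  have q1 : ‖z ^ n * (powSum (γ - 1) n w / (1 - w))‖ ≤ B / (2 * |t| / Real.pi) := by
    rw [norm_mul, norm_pow, nz, one_pow, one_mul, norm_div]
    gcongr
  have q2 : ‖w ^ n * (powSum (γ - 1) n z / (1 - z))‖ ≤ B / (2 * |t| / Real.pi) := by
    rw [norm_mul, norm_pow, nw, one_pow, one_mul, norm_div]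
    gcongr
  refine (norm_add_le _ _).trans ((add_le_add q1 q2).trans (le_of_eq ?_))
  field_simp
  ring

lemma sum_AA_neg {α : ℝ} (h1 : α < 1) (n : ℕ) :
    ∑ j ∈ Finset.range (n + 1), AA (-α) j = (1 - α + n) * AA (-α) n / (1 - α) := by
  have h := AA_mul (1 - α) n
  have e : 1 - α - 1 = -α := by ring
  have hs := AA_sum (1 - α) n
  rw [e] at h hs
  rw [hs, eq_div_iff (by linarith), mul_comm]
  exact h

lemma sum_AA_neg_le {α : ℝ} (h0 : 0 ≤ α) (h1 : α < 1) {N : ℕ} (hN : 1 ≤ N) :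
    ∑ j ∈ Finset.range N, AA (-α) j ≤ (N : ℝ) ^ (1 - α) / (1 - α) := by
  obtain ⟨n, rfl⟩ : ∃ n, N = n + 1 := ⟨N - 1, by omega⟩
  rw [sum_AA_neg h1]
  have hα : 0 < 1 - α := by linarith
  have hn : (0 : ℝ) < n + 1 := by positivity
  have hp := AA_le_rpow h0 h1 n
  have e : ((n + 1 : ℕ) : ℝ) ^ (1 - α) = ((n : ℝ) + 1) * ((n : ℝ) + 1) ^ (-α) := by
    push_cast
    rw [sub_eq_add_neg, Real.rpow_add hn, Real.rpow_one]
  rw [e]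
  have hA := AA_pos (γ := -α) (by linarith) n
  exact div_le_div_of_nonneg_right (mul_le_mul (by linarith) hp hA.le hn.le) hα.le

lemma norm_powSum_le {α : ℝ} (h0 : 0 ≤ α) (h1 : α < 1) (n : ℕ) {t : ℝ} (ht0 : t ≠ 0)
    (ht : |t| ≤ Real.pi) :
    ‖powSum (-α) n (Complex.exp (Complex.I * t))‖ ≤ (5 / (1 - α) + Real.pi) * |t| ^ (α - 1) := by
  have htp : 0 < |t| := abs_pos.2 ht0
  have hα : 0 < 1 - α := by linarith
  have hpi := Real.pi_pos
  set z := Complex.exp (Complex.I * t) with hz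
  have nz : ‖z‖ = 1 := norm_exp_I_mul t
  set N := ⌈|t|⁻¹⌉₊ with hN
  have hNpos : 1 ≤ N := Nat.one_le_iff_ne_zero.2 (Nat.ceil_pos.2 (by positivity)).ne'
  have hN1 : |t|⁻¹ ≤ N := Nat.le_ceil _
  have hN2 : (N : ℝ) ≤ |t|⁻¹ + 1 := (Nat.ceil_lt_add_one (by positivity)).le
  have hN3 : (N : ℝ) ≤ 5 * |t|⁻¹ := by
    have : Real.pi⁻¹ ≤ |t|⁻¹ := by gcongr
    have h4 : 1 ≤ 4 * Real.pi⁻¹ := by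
      rw [← div_eq_mul_inv, le_div_iff₀ hpi]; linarith [Real.pi_le_four]
    linarith
  have hApos := AA_pos (γ := -α) (by linarith)
  have nterm : ∀ j, ‖(AA (-α) j : ℂ) * z ^ j‖ = AA (-α) j := fun j => by
    rw [norm_mul, norm_pow, nz, one_pow, mul_one, Complex.norm_real, Real.norm_eq_abs,
      abs_of_pos (hApos j)]
  have hsmall : ∑ j ∈ Finset.range N, AA (-α) j ≤ 5 / (1 - α) * |t| ^ (α - 1) := by
    refine (sum_AA_neg_le h0 h1 hNpos).trans ?_
    have a1 : (N : ℝ) ^ (1 - α) ≤ (5 * |t|⁻¹) ^ (1 - α) := by gcongr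
    have a2 : (5 * |t|⁻¹) ^ (1 - α) = (5 : ℝ) ^ (1 - α) * |t| ^ (α - 1) := by
      rw [Real.mul_rpow (by norm_num) (by positivity), Real.inv_rpow htp.le,
        ← Real.rpow_neg htp.le, neg_sub]
    have a3 : (5 : ℝ) ^ (1 - α) ≤ 5 := by
      calc (5 : ℝ) ^ (1 - α) ≤ (5 : ℝ) ^ (1 : ℝ) :=
            Real.rpow_le_rpow_of_exponent_le (by norm_num) (by linarith)
        _ = 5 := Real.rpow_one 5
    have a4 : 0 < |t| ^ (α - 1) := by positivity
    rw [div_mul_eq_mul_div]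
    gcongr
    calc _ ≤ _ := a1
      _ = _ := a2
      _ ≤ _ := by gcongr
  have hpow : 0 ≤ |t| ^ (α - 1) := by positivity
  by_cases hc : n + 1 ≤ N
  · unfold powSum
    refine (norm_sum_le _ _).trans ?_
    simp only [nterm]
    refine (Finset.sum_le_sum_of_subset_of_nonneg (Finset.range_mono hc)
      fun j _ _ => (hApos j).le).trans (hsmall.trans ?_)
    gcongr
    linarith
  · obtain ⟨L, hL⟩ : ∃ L, n + 1 = N + L := ⟨n + 1 - N, by omega⟩
    unfold powSum
    rw [hL, Finset.sum_range_add, add_mul]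
    refine (norm_add_le _ _).trans (add_le_add ?_ ?_)
    · refine (norm_sum_le _ _).trans ?_
      simp only [nterm]
      exact hsmall
    · have hab := abel_bound (fun j => AA (-α) (N + j))
        (fun i j hij => AA_antitone h0 h1 (by omega)) (fun j => (hApos _).le) z nz L
      have e : ∑ x ∈ Finset.range L, (AA (-α) (N + x) : ℂ) * z ^ (N + x) =
          z ^ N * ∑ x ∈ Finset.range L, (AA (-α) (N + x) : ℂ) * z ^ x := by
        rw [Finset.mul_sum]
        refine Finset.sum_congr rfl fun x _ => ?_
        rw [pow_add]; ring
      rw [e, norm_mul, norm_pow, nz, one_pow, one_mul]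
      have hge := norm_one_sub_exp_ge ht
      rw [← hz] at hge
      set X := ‖∑ x ∈ Finset.range L, (AA (-α) (N + x) : ℂ) * z ^ x‖
      have hX : 0 ≤ X := norm_nonneg _
      have hAN : AA (-α) N ≤ |t| ^ α := by
        refine (AA_le_rpow h0 h1 N).trans ?_
        have : |t|⁻¹ ≤ (N : ℝ) + 1 := by linarith
        calc ((N : ℝ) + 1) ^ (-α) ≤ (|t|⁻¹) ^ (-α) :=
              Real.rpow_le_rpow_of_nonpos (by positivity) this (by linarith)
          _ = |t| ^ α := by rw [Real.inv_rpow htp.le, Real.rpow_neg htp.le, inv_inv]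
      have h5 : 2 * |t| / Real.pi * X ≤ 2 * |t| ^ α := by
        calc _ ≤ ‖1 - z‖ * X := by gcongr
          _ ≤ 2 * AA (-α) (N + 0) := hab
          _ ≤ _ := by rw [add_zero]; gcongr
      have h6 : |t| ^ (α - 1) = |t| ^ α / |t| := by
        rw [Real.rpow_sub htp, Real.rpow_one]
      rw [h6]
      rw [mul_div_assoc', le_div_iff₀ htp]
      have h7 : 2 * |t| / Real.pi * X * Real.pi = 2 * (X * |t|) := by field_simp
      have h8 := mul_le_mul_of_nonneg_right h5 hpi.le
      rw [h7] at h8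
      linarith

lemma le_mul_one_add_rpow {X a c₁ c₂ p t : ℝ} (ha : 0 < a) (hp : 0 ≤ p) (hc₁ : 0 ≤ c₁)
    (hc₂ : 0 ≤ c₂) (h1 : X ≤ c₁ * a) (h2 : t ≠ 0 → X ≤ c₂ * (a * (a * |t|) ^ (-p))) :
    X ≤ 2 ^ p * (c₁ + c₂) * (a * (1 + a * |t|) ^ (-p)) := by
  have hat : 0 ≤ a * |t| := by positivity
  by_cases h : a * |t| ≤ 1
  · have : (2 : ℝ) ^ (-p) ≤ (1 + a * |t|) ^ (-p) :=
      Real.rpow_le_rpow_of_nonpos (by positivity) (by linarith) (by linarith)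
    calc X ≤ c₁ * a := h1
      _ = 2 ^ p * c₁ * (a * 2 ^ (-p)) := by
        rw [Real.rpow_neg (by norm_num)]
        field_simp
      _ ≤ _ := by gcongr; linarith
  · push Not at h
    have ht0 : t ≠ 0 := by rintro rfl; simp at h; linarith
    have h3 : (2 * (a * |t|)) ^ (-p) ≤ (1 + a * |t|) ^ (-p) :=
      Real.rpow_le_rpow_of_nonpos (by positivity) (by linarith) (by linarith)
    calc X ≤ c₂ * (a * (a * |t|) ^ (-p)) := h2 ht0
      _ = 2 ^ p * c₂ * (a * (2 * (a * |t|)) ^ (-p)) := by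
        rw [Real.mul_rpow (by norm_num) hat, Real.rpow_neg (by norm_num : (0 : ℝ) ≤ 2)]
        field_simp
      _ ≤ _ := by gcongr; linarith

lemma norm_cesaroKer_neg_le_trivial {α : ℝ} (h0 : 0 ≤ α) (h1 : α < 1) (n : ℕ) (t : ℝ) :
    ‖cesaroKer (-α) n t‖ ≤ 3 / (1 - α) * ((n : ℝ) + 1) := by
  have hα : 0 < 1 - α := by linarith
  have hA := AA_pos (γ := -α) (by linarith)
  have hb : ∀ s : ℝ, ‖powSum (-α) n (Complex.exp (Complex.I * s))‖ ≤
      (1 - α + n) * AA (-α) n / (1 - α) := by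
    intro s
    rw [← sum_AA_neg h1]
    refine (norm_sum_le _ _).trans (Finset.sum_le_sum fun j _ => ?_)
    rw [norm_mul, norm_pow, norm_exp_I_mul, one_pow, mul_one, Complex.norm_real, Real.norm_eq_abs,
      abs_of_pos (hA j)]
  have h := norm_cesaroKer_le_of_powSum (γ := -α) (by linarith) n t (hb t) (hb (-t))
  have hAn := hA n
  have hn : (0 : ℝ) ≤ n := by positivity
  have e : 2 * ((1 - α + n) * AA (-α) n / (1 - α)) + AA (-α) n =
      AA (-α) n * ((2 * (1 - α + n) + (1 - α)) / (1 - α)) := by field_simp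
  rw [e, mul_le_mul_iff_right₀ hAn] at h
  refine h.trans ?_
  rw [div_mul_eq_mul_div]
  gcongr
  nlinarith

lemma exists_norm_cesaroKer_neg_le {α : ℝ} (h0 : 0 ≤ α) (h1 : α < 1) :
    ∃ C, 0 ≤ C ∧ ∀ (n : ℕ) (t : ℝ), |t| ≤ Real.pi →
      ‖cesaroKer (-α) n t‖ ≤ C * (((n : ℝ) + 1) * (1 + ((n : ℝ) + 1) * |t|) ^ (-(1 - α))) := by
  have hα : 0 < 1 - α := by linarith
  have hpi := Real.pi_pos
  set D := 5 / (1 - α) + Real.pi with hD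
  have hDp : 0 < D := by positivity
  refine ⟨2 ^ (1 - α) * (3 / (1 - α) + (2 * D / (1 - α) + Real.pi)), by positivity,
    fun n t ht => ?_⟩
  have ha : (0 : ℝ) < n + 1 := by positivity
  refine le_mul_one_add_rpow ha hα.le (by positivity) (by positivity)
    (norm_cesaroKer_neg_le_trivial h0 h1 n t) fun ht0 => ?_
  have htp : 0 < |t| := abs_pos.2 ht0
  have h := norm_cesaroKer_le_of_powSum (γ := -α) (by linarith) n t
    (norm_powSum_le h0 h1 n ht0 ht)
    (by simpa using norm_powSum_le h0 h1 n (neg_ne_zero.2 ht0) (by rwa [abs_neg]))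
  have hA := AA_pos (γ := -α) (by linarith) n
  have hAl := rpow_le_AA h0 h1 n
  have e1 : ((n : ℝ) + 1) * (((n : ℝ) + 1) * |t|) ^ (-(1 - α)) =
      |t| ^ (α - 1) / ((n : ℝ) + 1) ^ (-α) := by
    rw [Real.mul_rpow ha.le htp.le, neg_sub, Real.rpow_sub ha, Real.rpow_one,
      Real.rpow_neg ha.le]
    field_simp
  rw [e1]
  set P := |t| ^ (α - 1) with hP
  set Q := ((n : ℝ) + 1) ^ (-α) with hQ
  have hPp : 0 < P := by positivity
  have hQp : 0 < Q := by positivity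
  have hQ1 : Q ≤ 1 := Real.rpow_le_one_of_one_le_of_nonpos (by
    have : (0 : ℝ) ≤ n := by positivity
    linarith) (by linarith)
  have hP1 : 1 ≤ Real.pi * P := by
    have : Real.pi ^ (α - 1) ≤ P := Real.rpow_le_rpow_of_nonpos htp ht (by linarith)
    have h2 : Real.pi ^ (-1 : ℝ) ≤ Real.pi ^ (α - 1) :=
      Real.rpow_le_rpow_of_exponent_le (by linarith [Real.pi_gt_three]) (by linarith)
    calc (1 : ℝ) = Real.pi * Real.pi ^ (-1 : ℝ) := by rw [Real.rpow_neg_one]; field_simp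
      _ ≤ _ := by gcongr; linarith
  have h3 : ‖cesaroKer (-α) n t‖ ≤ 2 * (D * P) / AA (-α) n + 1 := by
    rw [div_add_one hA.ne', le_div_iff₀ hA, mul_comm]
    exact h
  have h4 : 2 * (D * P) / AA (-α) n ≤ 2 * (D * P) / ((1 - α) * Q) := by gcongr
  have h5 : 1 ≤ Real.pi * (P / Q) := by
    calc 1 ≤ Real.pi * P := hP1
      _ ≤ Real.pi * (P / Q) := by
        gcongr
        exact le_div_self hPp.le hQp hQ1
  calc _ ≤ _ := h3
    _ ≤ 2 * (D * P) / ((1 - α) * Q) + Real.pi * (P / Q) := by gcongr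
    _ = _ := by field_simp

lemma exists_norm_cesaroKer_one_sub_le {α : ℝ} (h0 : 0 ≤ α) (h1 : α < 1) :
    ∃ C, 0 ≤ C ∧ ∀ (n : ℕ) (t : ℝ), |t| ≤ Real.pi →
      ‖cesaroKer (1 - α) n t‖ ≤ C * (((n : ℝ) + 1) * (1 + ((n : ℝ) + 1) * |t|) ^ (-(2 - α))) := by
  have hα : 0 < 1 - α := by linarith
  have hpi := Real.pi_pos
  set D := 5 / (1 - α) + Real.pi with hD
  have hDp : 0 < D := by positivity
  refine ⟨2 ^ (2 - α) * (2 + Real.pi * D / (1 - α)), by positivity, fun n t ht => ?_⟩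
  have ha : (0 : ℝ) < n + 1 := by positivity
  have hA := AA_pos (γ := 1 - α) (by linarith)
  refine le_mul_one_add_rpow ha (by linarith) (by positivity) (by positivity) ?_ fun ht0 => ?_
  · refine (norm_evenKer_le _ _ _).trans ?_
    have : ∀ k ∈ Finset.Icc (-(n : ℤ)) n,
        |AA (1 - α) (n - k.natAbs) / AA (1 - α) n| ≤ (1 : ℝ) := by
      intro k _
      rw [abs_of_pos (div_pos (hA _) (hA _)), div_le_one (hA _)]
      exact AA_monotone hα.le (by omega)
    refine (Finset.sum_le_sum this).trans ?_
    simp only [Finset.sum_const, Int.card_Icc, nsmul_eq_mul, mul_one]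
    rw [show ((n : ℤ) + 1 - -(n : ℤ)).toNat = 2 * n + 1 by omega]
    push_cast; linarith
  have htp : 0 < |t| := abs_pos.2 ht0
  have e0 : 1 - α - 1 = -α := by ring
  have h := norm_cesaroKer_le_of_powSum_sub_one (γ := 1 - α) (by linarith) n ht0 ht
    (B := D * |t| ^ (α - 1)) (by rw [e0]; exact norm_powSum_le h0 h1 n ht0 ht)
    (by rw [e0]; simpa using norm_powSum_le h0 h1 n (neg_ne_zero.2 ht0) (by rwa [abs_neg]))
  have hAl : (1 - α) * ((n : ℝ) + 1) ^ (1 - α) ≤ AA (1 - α) n := by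
    have h2 := rpow_le_AA h0 h1 n
    have h3 := AA_mul (1 - α) n
    rw [e0] at h3
    have hn : (0 : ℝ) ≤ n := by positivity
    have e : ((n : ℝ) + 1) ^ (1 - α) = ((n : ℝ) + 1) * ((n : ℝ) + 1) ^ (-α) := by
      rw [sub_eq_add_neg, Real.rpow_add ha, Real.rpow_one]
    have hq : 0 < ((n : ℝ) + 1) ^ (-α) := by positivity
    rw [e, ← mul_le_mul_iff_right₀ hα, h3]
    calc _ = ((1 - α) * (n + 1)) * ((1 - α) * ((n : ℝ) + 1) ^ (-α)) := by ring
      _ ≤ _ := by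
        gcongr
        nlinarith
  have e1 : ((n : ℝ) + 1) * (((n : ℝ) + 1) * |t|) ^ (-(2 - α)) =
      |t| ^ (α - 1) / |t| / ((n : ℝ) + 1) ^ (1 - α) := by
    rw [Real.mul_rpow ha.le htp.le, show |t| ^ (α - 1) / |t| = |t| ^ (-(2 - α)) by
      rw [← Real.rpow_sub_one htp.ne']; congr 1; ring]
    rw [show -(2 - α) = -(1 - α) - 1 by ring, Real.rpow_sub_one ha.ne' (-(1 - α)),
      Real.rpow_neg ha.le]
    field_simp
  rw [e1]
  set Q := ((n : ℝ) + 1) ^ (1 - α)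
  have hQp : 0 < Q := by positivity
  set P := |t| ^ (α - 1)
  have hPp : 0 < P := by positivity
  calc _ ≤ Real.pi * (D * P) / |t| / AA (1 - α) n := by
        rw [le_div_iff₀ (hA n), mul_comm]; exact h
    _ ≤ Real.pi * (D * P) / |t| / ((1 - α) * Q) := by gcongr
    _ = _ := by field_simp

section

open MeasureTheory

/-- Lebesgue measure on `[-π, π]`. -/
noncomputable def circMeasure : Measure ℝ := volume.restrict (Icc (-Real.pi) Real.pi)

instance : IsFiniteMeasure circMeasure := by unfold circMeasure; infer_instance

lemma Continuous.integrable_circMeasure {E : Type*} [NormedAddCommGroup E] {φ : ℝ → E}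
    (h : Continuous φ) : Integrable φ circMeasure :=
  h.continuousOn.integrableOn_compact isCompact_Icc

lemma Continuous.integrable_circMeasure_prod {E : Type*} [NormedAddCommGroup E] {φ : ℝ × ℝ → E}
    (h : Continuous φ) : Integrable φ (circMeasure.prod circMeasure) := by
  unfold circMeasure
  rw [Measure.prod_restrict, ← Measure.volume_eq_prod]
  exact h.continuousOn.integrableOn_compact (isCompact_Icc.prod isCompact_Icc)

lemma ae_circMeasure {P : ℝ → Prop} (h : ∀ t, |t| ≤ Real.pi → P t) : ∀ᵐ t ∂circMeasure, P t := by
  unfold circMeasure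
  filter_upwards [ae_restrict_mem measurableSet_Icc] with t ht
  exact h t (abs_le.2 ht)

lemma integral_circMeasure_mono {φ ψ : ℝ → ℝ} (hφ : Continuous φ) (hψ : Continuous ψ)
    (h : ∀ t, |t| ≤ Real.pi → φ t ≤ ψ t) :
    ∫ t, φ t ∂circMeasure ≤ ∫ t, ψ t ∂circMeasure :=
  integral_mono_ae hφ.integrable_circMeasure hψ.integrable_circMeasure (ae_circMeasure h)

lemma integral_circMeasure_const (c : ℝ) : ∫ _, c ∂circMeasure = 2 * Real.pi * c := by
  have : (0 : ℝ) ≤ Real.pi + Real.pi := by linarith [Real.pi_pos]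
  unfold circMeasure
  simp [Measure.real, this]
  left; ring

lemma integral_circMeasure_eq {E : Type*} [NormedAddCommGroup E] [NormedSpace ℝ E] (φ : ℝ → E) :
    ∫ t, φ t ∂circMeasure = ∫ t in (-Real.pi)..Real.pi, φ t := by
  unfold circMeasure
  rw [integral_Icc_eq_integral_Ioc, intervalIntegral.integral_of_le (by linarith [Real.pi_pos])]

lemma integral_circMeasure_shift {E : Type*} [NormedAddCommGroup E] [NormedSpace ℝ E] {φ : ℝ → E}
    (h : Function.Periodic φ (2 * Real.pi)) (x : ℝ) :
    ∫ t, φ (x + t) ∂circMeasure = ∫ t, φ t ∂circMeasure := by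
  rw [integral_circMeasure_eq, integral_circMeasure_eq,
    intervalIntegral.integral_comp_add_left (fun t => φ t) x]
  have := h.intervalIntegral_add_eq (x + -Real.pi) (-Real.pi)
  rw [show x + -Real.pi + 2 * Real.pi = x + Real.pi by ring,
    show -Real.pi + 2 * Real.pi = Real.pi by ring] at this
  exact this

lemma integral_circMeasure_eq_zero_two_pi {E : Type*} [NormedAddCommGroup E] [NormedSpace ℝ E]
    {φ : ℝ → E} (h : Function.Periodic φ (2 * Real.pi)) :
    ∫ t, φ t ∂circMeasure = ∫ t in (0 : ℝ)..(2 * Real.pi), φ t := by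
  rw [integral_circMeasure_eq]
  have := h.intervalIntegral_add_eq (-Real.pi) 0
  rw [show -Real.pi + 2 * Real.pi = Real.pi by ring, zero_add] at this
  exact this

lemma exists_integral_one_add_rpow_le {p : ℝ} (hp : 1 < p) :
    ∃ C, 0 ≤ C ∧ ∀ a : ℝ, 0 < a → ∫ t, (1 + a * |t|) ^ (-p) ∂circMeasure ≤ C / a := by
  have hint : Integrable (fun t : ℝ => (1 + ‖t‖) ^ (-p)) volume :=
    integrable_one_add_norm (by simpa using hp)
  refine ⟨∫ t : ℝ, (1 + ‖t‖) ^ (-p), integral_nonneg fun t => by positivity, fun a ha => ?_⟩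
  have e : (fun t : ℝ => (1 + a * |t|) ^ (-p)) = fun t => (fun s : ℝ => (1 + ‖s‖) ^ (-p)) (a * t) := by
    funext t
    simp [abs_of_pos ha]
  rw [e]
  have hi : Integrable (fun t => (fun s : ℝ => (1 + ‖s‖) ^ (-p)) (a * t)) volume :=
    hint.comp_mul_left' ha.ne'
  unfold circMeasure
  refine (setIntegral_le_integral hi (ae_of_all _ fun t => by positivity)).trans ?_
  have h := Measure.integral_comp_mul_left (fun s : ℝ => (1 + ‖s‖) ^ (-p)) a
  rw [abs_of_pos (inv_pos.2 ha), smul_eq_mul, ← div_eq_inv_mul] at h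
  exact h.le

lemma continuous_one_add_rpow {a : ℝ} (ha : 0 ≤ a) (p : ℝ) :
    Continuous fun t : ℝ => (1 + a * |t|) ^ p := by
  refine Continuous.rpow_const (by fun_prop) fun t => Or.inl ?_
  positivity

lemma continuous_cesaroKer (γ : ℝ) (n : ℕ) : Continuous (cesaroKer γ n) := continuous_evenKer _ _

lemma exists_integral_norm_cesaroKer_rpow_le {α x : ℝ} (h0 : 0 ≤ α) (h1 : α < 1) (hx0 : 0 < x)
    (hx : 1 < x * (1 - α)) :
    ∃ C, 0 ≤ C ∧ ∀ n : ℕ,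
      ∫ t, ‖cesaroKer (-α) n t‖ ^ x ∂circMeasure ≤ C * ((n : ℝ) + 1) ^ (x - 1) := by
  obtain ⟨C, hC, h⟩ := exists_norm_cesaroKer_neg_le h0 h1
  obtain ⟨D, hD, hd⟩ := exists_integral_one_add_rpow_le hx
  refine ⟨C ^ x * D, by positivity, fun n => ?_⟩
  have ha : (0 : ℝ) < n + 1 := by positivity
  have hc := continuous_cesaroKer (-α) n
  calc ∫ t, ‖cesaroKer (-α) n t‖ ^ x ∂circMeasure
      ≤ ∫ t, C ^ x * ((n : ℝ) + 1) ^ x * (1 + ((n : ℝ) + 1) * |t|) ^ (-(x * (1 - α)))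
          ∂circMeasure := by
        refine integral_circMeasure_mono (hc.norm.rpow_const fun _ => Or.inr hx0.le)
          (continuous_const.mul (continuous_one_add_rpow ha.le _)) fun t ht => ?_
        have hb : 0 ≤ 1 + ((n : ℝ) + 1) * |t| := by positivity
        calc ‖cesaroKer (-α) n t‖ ^ x ≤
            (C * (((n : ℝ) + 1) * (1 + ((n : ℝ) + 1) * |t|) ^ (-(1 - α)))) ^ x := by
              gcongr; exact h n t ht
          _ = _ := by
            rw [Real.mul_rpow hC (by positivity), Real.mul_rpow ha.le (by positivity),
              ← Real.rpow_mul hb]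
            ring_nf
    _ = C ^ x * ((n : ℝ) + 1) ^ x * ∫ t, (1 + ((n : ℝ) + 1) * |t|) ^ (-(x * (1 - α)))
          ∂circMeasure := integral_const_mul _ _
    _ ≤ C ^ x * ((n : ℝ) + 1) ^ x * (D / ((n : ℝ) + 1)) := by gcongr; exact hd _ ha
    _ = _ := by rw [Real.rpow_sub_one ha.ne']; ring

lemma exists_integral_norm_cesaroKer_one_sub_le {α : ℝ} (h0 : 0 ≤ α) (h1 : α < 1) :
    ∃ C, 0 ≤ C ∧ ∀ n : ℕ, ∫ t, ‖cesaroKer (1 - α) n t‖ ∂circMeasure ≤ C := by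
  obtain ⟨C, hC, h⟩ := exists_norm_cesaroKer_one_sub_le h0 h1
  obtain ⟨D, hD, hd⟩ := exists_integral_one_add_rpow_le (p := 2 - α) (by linarith)
  refine ⟨C * D, by positivity, fun n => ?_⟩
  have ha : (0 : ℝ) < n + 1 := by positivity
  calc ∫ t, ‖cesaroKer (1 - α) n t‖ ∂circMeasure
      ≤ ∫ t, C * ((n : ℝ) + 1) * (1 + ((n : ℝ) + 1) * |t|) ^ (-(2 - α)) ∂circMeasure := by
        refine integral_circMeasure_mono (continuous_cesaroKer _ _).norm
          (continuous_const.mul (continuous_one_add_rpow ha.le _)) fun t ht => ?_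
        rw [mul_assoc]; exact h n t ht
    _ = C * ((n : ℝ) + 1) * ∫ t, (1 + ((n : ℝ) + 1) * |t|) ^ (-(2 - α)) ∂circMeasure :=
        integral_const_mul _ _
    _ ≤ C * ((n : ℝ) + 1) * (D / ((n : ℝ) + 1)) := by gcongr; exact hd _ ha
    _ = _ := by field_simp

/-- Normalized convolution with a kernel over `[-π, π]` (for the reflected kernel). -/
noncomputable def circConv (K φ : ℝ → ℂ) (x : ℝ) : ℂ :=
  (2 * (Real.pi : ℂ))⁻¹ * ∫ t, K t * φ (x + t) ∂circMeasure

lemma norm_two_pi_inv : ‖(2 * (Real.pi : ℂ))⁻¹‖ = (2 * Real.pi)⁻¹ := by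
  rw [norm_inv, norm_mul, Complex.norm_real, Real.norm_eq_abs, abs_of_pos Real.pi_pos]
  simp

lemma norm_circConv_le (K φ : ℝ → ℂ) (x : ℝ) :
    ‖circConv K φ x‖ ≤ (2 * Real.pi)⁻¹ * ∫ t, ‖K t‖ * ‖φ (x + t)‖ ∂circMeasure := by
  unfold circConv
  rw [norm_mul, norm_two_pi_inv]
  have := Real.pi_pos
  gcongr
  refine (norm_integral_le_integral_norm _).trans (le_of_eq ?_)
  simp

lemma norm_circConv_le_of_le {K φ : ℝ → ℂ} (hK : Continuous K) (hφ : Continuous φ) {M : ℝ}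
    (hM : ∀ x, ‖φ x‖ ≤ M) (x : ℝ) :
    ‖circConv K φ x‖ ≤ (2 * Real.pi)⁻¹ * (∫ t, ‖K t‖ ∂circMeasure) * M := by
  refine (norm_circConv_le K φ x).trans ?_
  have := Real.pi_pos
  rw [mul_assoc, ← integral_mul_const]
  refine mul_le_mul_of_nonneg_left ?_ (by positivity)
  exact integral_circMeasure_mono (φ := fun t => ‖K t‖ * ‖φ (x + t)‖) (ψ := fun t => ‖K t‖ * M)
    (by fun_prop) (by fun_prop) fun t _ => mul_le_mul_of_nonneg_left (hM _) (norm_nonneg _)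

lemma circConv_sub {K φ ψ : ℝ → ℂ} (hK : Continuous K) (hφ : Continuous φ) (hψ : Continuous ψ)
    (x : ℝ) : circConv K (fun s => φ s - ψ s) x = circConv K φ x - circConv K ψ x := by
  unfold circConv
  rw [← mul_sub, ← integral_sub]
  · simp only [mul_sub]
  · exact (show Continuous fun t => K t * φ (x + t) by fun_prop).integrable_circMeasure
  · exact (show Continuous fun t => K t * ψ (x + t) by fun_prop).integrable_circMeasure

lemma circConv_add {K φ ψ : ℝ → ℂ} (hK : Continuous K) (hφ : Continuous φ) (hψ : Continuous ψ)
    (x : ℝ) : circConv K (fun s => φ s + ψ s) x = circConv K φ x + circConv K ψ x := by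
  unfold circConv
  rw [← mul_add, ← integral_add]
  · simp only [mul_add]
  · exact (show Continuous fun t => K t * φ (x + t) by fun_prop).integrable_circMeasure
  · exact (show Continuous fun t => K t * ψ (x + t) by fun_prop).integrable_circMeasure

lemma circConv_const_mul (K φ : ℝ → ℂ) (c : ℂ) (x : ℝ) :
    circConv K (fun s => c * φ s) x = c * circConv K φ x := by
  unfold circConv
  simp only [mul_left_comm _ c, integral_const_mul]

lemma circConv_kernel_sum {ι : Type*} (s : Finset ι) (c : ι → ℂ) {K : ι → ℝ → ℂ} {φ : ℝ → ℂ}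
    (hK : ∀ i, Continuous (K i)) (hφ : Continuous φ) (x : ℝ) :
    circConv (fun t => ∑ i ∈ s, c i * K i t) φ x = ∑ i ∈ s, c i * circConv (K i) φ x := by
  unfold circConv
  simp only [Finset.sum_mul]
  rw [integral_finsetSum]
  · rw [Finset.mul_sum]
    refine Finset.sum_congr rfl fun i _ => ?_
    simp only [mul_assoc, integral_const_mul]
    ring
  · intro i _
    have := hK i
    exact (show Continuous fun t => c i * K i t * φ (x + t) by fun_prop).integrable_circMeasure

lemma continuous_circConv_param {X : Type*} [TopologicalSpace X] [FirstCountableTopology X]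
    [LocallyCompactSpace X]
    {K : ℝ → ℂ} {G : X → ℝ → ℂ} (hK : Continuous K) (hG : Continuous fun p : X × ℝ => G p.1 p.2) :
    Continuous fun p : X × ℝ => circConv K (G p.1) p.2 := by
  unfold circConv circMeasure
  refine continuous_const.mul ?_
  refine continuous_parametric_integral_of_continuous 
    (f := fun (p : X × ℝ) (t : ℝ) => K t * G p.1 (p.2 + t)) ?_ isCompact_Icc
  have : Continuous fun q : (X × ℝ) × ℝ => G q.1.1 (q.1.2 + q.2) :=
    hG.comp (f := fun q : (X × ℝ) × ℝ => (q.1.1, q.1.2 + q.2)) (by fun_prop)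
  exact (hK.comp continuous_snd).mul this

lemma continuous_circConv {K φ : ℝ → ℂ} (hK : Continuous K) (hφ : Continuous φ) :
    Continuous (circConv K φ) := by
  have := continuous_circConv_param (X := Unit) (G := fun _ => φ) hK (by fun_prop)
  exact this.comp (f := fun x : ℝ => ((), x)) (by fun_prop)

lemma circConv_swap {K H : ℝ → ℂ} {g : ℝ → ℝ → ℂ} (hK : Continuous K) (hH : Continuous H)
    (hg : Continuous fun p : ℝ × ℝ => g p.1 p.2) (x y : ℝ) :
    circConv K (fun s => circConv H (fun t => g s t) y) x =
      circConv H (fun t => circConv K (fun s => g s t) x) y := by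
  unfold circConv
  simp only [mul_left_comm _ ((2 * (Real.pi : ℂ))⁻¹), integral_const_mul]
  congr 2
  simp only [← integral_const_mul]
  rw [integral_integral_swap]
  · simp only [mul_left_comm]
  · refine Continuous.integrable_circMeasure_prod ?_
    have : Continuous fun q : ℝ × ℝ => g (x + q.1) (y + q.2) :=
      hg.comp (f := fun q : ℝ × ℝ => (x + q.1, y + q.2)) (by fun_prop)
    simp only [Function.uncurry_def]
    fun_prop

/-- The trigonometric polynomial of degree `d` with coefficients `a`. -/
noncomputable def trigSum (d : ℕ) (a : ℤ → ℂ) (x : ℝ) : ℂ :=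
  ∑ k ∈ Finset.Icc (-(d : ℤ)) d, a k * Complex.exp (Complex.I * (k : ℂ) * (x : ℂ))

@[fun_prop]
lemma continuous_trigSum (d : ℕ) (a : ℤ → ℂ) : Continuous (trigSum d a) := by
  unfold trigSum; fun_prop

lemma periodic_exp_I_mul_int (k : ℤ) :
    Function.Periodic (fun x : ℝ => Complex.exp (Complex.I * (k : ℂ) * (x : ℂ))) (2 * Real.pi) := by
  intro x
  have : Complex.I * (k : ℂ) * ((x + 2 * Real.pi : ℝ) : ℂ) =
      Complex.I * k * x + k * (2 * Real.pi * Complex.I) := by push_cast; ring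
  simp only [this, Complex.exp_add, Complex.exp_int_mul_two_pi_mul_I, mul_one]

lemma trigSum_add (d : ℕ) (a b : ℤ → ℂ) (x : ℝ) :
    trigSum d (fun k => a k + b k) x = trigSum d a x + trigSum d b x := by
  simp [trigSum, add_mul, Finset.sum_add_distrib]

lemma trigSum_sub (d : ℕ) (a b : ℤ → ℂ) (x : ℝ) :
    trigSum d (fun k => a k - b k) x = trigSum d a x - trigSum d b x := by
  simp [trigSum, sub_mul, Finset.sum_sub_distrib]

lemma trigSum_const_mul (d : ℕ) (c : ℂ) (a : ℤ → ℂ) (x : ℝ) :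
    trigSum d (fun k => c * a k) x = c * trigSum d a x := by
  simp [trigSum, mul_assoc, Finset.mul_sum]

lemma trigSum_congr {d : ℕ} {a b : ℤ → ℂ} (h : ∀ k : ℤ, k.natAbs ≤ d → a k = b k) (x : ℝ) :
    trigSum d a x = trigSum d b x := by
  refine Finset.sum_congr rfl fun k hk => ?_
  rw [h k (by rw [Finset.mem_Icc] at hk; omega)]

lemma trigSum_single {d : ℕ} {k : ℤ} (hk : k.natAbs ≤ d) (c : ℂ) (x : ℝ) :
    trigSum d (fun r => if r = k then c else 0) x =
      c * Complex.exp (Complex.I * (k : ℂ) * (x : ℂ)) := by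
  simp only [trigSum, ite_mul, zero_mul]
  rw [Finset.sum_ite_eq' (Finset.Icc (-(d : ℤ)) d) k, if_pos]
  rw [Finset.mem_Icc]; omega

lemma trigSum_finset_sum {ι : Type*} (s : Finset ι) (d : ℕ) (a : ι → ℤ → ℂ) (x : ℝ) :
    trigSum d (fun k => ∑ i ∈ s, a i k) x = ∑ i ∈ s, trigSum d (a i) x := by
  unfold trigSum
  rw [Finset.sum_comm]
  simp [Finset.sum_mul]

lemma integral_exp_I_mul_int (k : ℤ) :
    ∫ t : ℝ, Complex.exp (Complex.I * (k : ℂ) * (t : ℂ)) ∂circMeasure =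
      if k = 0 then 2 * (Real.pi : ℂ) else 0 := by
  split_ifs with h
  · subst h
    rw [integral_circMeasure_eq]
    simp
    ring
  · have hk : Complex.I * (k : ℂ) ≠ 0 := by simp [h]
    rw [integral_circMeasure_eq, integral_exp_mul_complex hk]
    have := periodic_exp_I_mul_int k (-Real.pi)
    simp only [show -Real.pi + 2 * Real.pi = Real.pi by ring] at this
    rw [this]; simp

lemma integral_evenKer_mul_exp (c : ℕ → ℝ) (n : ℕ) (k : ℤ) :
    ∫ t : ℝ, evenKer c n t * Complex.exp (Complex.I * (k : ℂ) * (t : ℂ)) ∂circMeasure =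
      if k.natAbs ≤ n then 2 * (Real.pi : ℂ) * c k.natAbs else 0 := by
  unfold evenKer
  simp only [Finset.sum_mul]
  rw [integral_finsetSum _ fun i _ => Continuous.integrable_circMeasure (by fun_prop)]
  have : ∀ p ∈ Finset.Icc (-(n : ℤ)) n,
      ∫ t : ℝ, (c p.natAbs : ℂ) * Complex.exp (-(Complex.I * (p : ℂ) * (t : ℂ))) *
        Complex.exp (Complex.I * (k : ℂ) * (t : ℂ)) ∂circMeasure =
      if p = k then 2 * (Real.pi : ℂ) * c k.natAbs else 0 := by
    intro p _
    have e : ∀ t : ℝ, (c p.natAbs : ℂ) * Complex.exp (-(Complex.I * (p : ℂ) * (t : ℂ))) *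
        Complex.exp (Complex.I * (k : ℂ) * (t : ℂ)) =
        (c p.natAbs : ℂ) * Complex.exp (Complex.I * ((k - p : ℤ) : ℂ) * (t : ℂ)) := by
      intro t
      rw [mul_assoc, ← Complex.exp_add]
      push_cast; ring_nf
    simp only [e]
    rw [integral_const_mul, integral_exp_I_mul_int]
    by_cases h : p = k
    · subst h; simp; ring
    · rw [if_neg h, if_neg (by omega)]; simp
  rw [Finset.sum_congr rfl this, Finset.sum_ite_eq']
  congr 1
  rw [Finset.mem_Icc]
  apply propext; omega

lemma circConv_exp (K : ℝ → ℂ) (k : ℤ) (x : ℝ) :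
    circConv K (fun s => Complex.exp (Complex.I * (k : ℂ) * (s : ℂ))) x =
      ((2 * (Real.pi : ℂ))⁻¹ * ∫ t : ℝ, K t * Complex.exp (Complex.I * (k : ℂ) * (t : ℂ))
        ∂circMeasure) * Complex.exp (Complex.I * (k : ℂ) * (x : ℂ)) := by
  unfold circConv
  rw [mul_assoc, ← integral_mul_const]
  congr 2
  funext t
  rw [mul_assoc, ← Complex.exp_add]
  push_cast; ring_nf

lemma circConv_finset_sum {ι : Type*} (s : Finset ι) {K : ℝ → ℂ} {φ : ι → ℝ → ℂ}
    (hK : Continuous K) (hφ : ∀ i, Continuous (φ i)) (x : ℝ) :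
    circConv K (fun t => ∑ i ∈ s, φ i t) x = ∑ i ∈ s, circConv K (φ i) x := by
  unfold circConv
  simp only [Finset.mul_sum]
  rw [integral_finsetSum, Finset.mul_sum]
  intro i _
  have := hφ i
  exact (show Continuous fun t => K t * φ i (x + t) by fun_prop).integrable_circMeasure

lemma circConv_evenKer_trigSum (c : ℕ → ℝ) {d n : ℕ} (h : d ≤ n) (a : ℤ → ℂ) (x : ℝ) :
    circConv (evenKer c n) (trigSum d a) x = trigSum d (fun k => c k.natAbs * a k) x := by
  unfold trigSum
  rw [circConv_finset_sum _ (continuous_evenKer c n) fun i => by fun_prop]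
  refine Finset.sum_congr rfl fun k hk => ?_
  rw [circConv_const_mul, circConv_exp, integral_evenKer_mul_exp, if_pos]
  · have : (Real.pi : ℂ) ≠ 0 := by exact_mod_cast Real.pi_ne_zero
    field_simp
  · rw [Finset.mem_Icc] at hk; omega

lemma circConv_neg_exp {φ : ℝ → ℂ} (hp : Function.Periodic φ (2 * Real.pi))
    (k : ℤ) (x : ℝ) :
    circConv (fun t => Complex.exp (-(Complex.I * (k : ℂ) * (t : ℂ)))) φ x =
      ((2 * (Real.pi : ℂ))⁻¹ * ∫ t : ℝ, Complex.exp (-(Complex.I * (k : ℂ) * (t : ℂ))) * φ t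
        ∂circMeasure) * Complex.exp (Complex.I * (k : ℂ) * (x : ℂ)) := by
  unfold circConv
  have hP : Function.Periodic
      (fun t : ℝ => Complex.exp (-(Complex.I * (k : ℂ) * (t : ℂ))) * φ t) (2 * Real.pi) := by
    intro t
    have := periodic_exp_I_mul_int k t
    simp only [Complex.exp_neg] at this ⊢
    rw [this, hp]
  rw [← integral_circMeasure_shift hP x, mul_assoc, ← integral_mul_const]
  congr 2
  funext t
  rw [mul_right_comm, ← Complex.exp_add]
  push_cast; ring_nf

lemma cesaroKer_multiplier_mul {α : ℝ} (h1 : α < 1) {n k : ℕ} (hk : k ≤ n) :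
    AA (-α) (n - k) / AA (-α) n * (AA 1 (n - k) / AA 1 n) =
      (n + 1 - α) / (n + 1) * (AA (1 - α) (n - k) / AA (1 - α) n) +
        α / (n + 1) * (AA (-α) (n - k) / AA (-α) n) := by
  have hα : 0 < 1 - α := by linarith
  have hA := AA_pos (γ := -α) (by linarith) n
  have hB := AA_pos (γ := 1 - α) (by linarith) n
  have e : 1 - α - 1 = -α := by ring
  have hn := AA_mul (1 - α) n
  have hj := AA_mul (1 - α) (n - k)
  rw [e] at hn hj
  have hn' : AA (1 - α) n = (1 - α + n) * AA (-α) n / (1 - α) := by field_simp; linarith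
  have hj' : AA (1 - α) (n - k) = (1 - α + (n - k : ℕ)) * AA (-α) (n - k) / (1 - α) := by
    field_simp; linarith
  have hp : (0 : ℝ) < 1 - α + n := by positivity
  have hp' : (n : ℝ) + 1 - α ≠ 0 := by linarith
  rw [hn', hj', AA_one_left, AA_one_left, Nat.cast_sub hk]
  field_simp
  ring

lemma exists_norm_circConv_cesaroKer_one_le :
    ∃ C, 1 ≤ C ∧ ∀ (n : ℕ) {φ : ℝ → ℂ}, Continuous φ → ∀ {M : ℝ}, (∀ x, ‖φ x‖ ≤ M) →
      ∀ x, ‖circConv (cesaroKer 1 n) φ x‖ ≤ C * M := by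
  obtain ⟨C, hC, h⟩ := exists_integral_norm_cesaroKer_one_sub_le (α := 0) le_rfl one_pos
  refine ⟨(2 * Real.pi)⁻¹ * C + 1, by have := Real.pi_pos; linarith [show 0 ≤ (2 * Real.pi)⁻¹ * C by positivity], fun n φ hφ M hM x => ?_⟩
  have h' := h n
  rw [sub_zero] at h'
  have hM0 : 0 ≤ M := (norm_nonneg _).trans (hM 0)
  have hp : 0 < (2 * Real.pi)⁻¹ := by have := Real.pi_pos; positivity
  calc _ ≤ _ := norm_circConv_le_of_le (continuous_cesaroKer 1 n) hφ hM x
    _ ≤ (2 * Real.pi)⁻¹ * C * M := by gcongr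
    _ ≤ _ := by nlinarith

lemma norm_circConv_le_of_norm_le {K φ : ℝ → ℂ} (hK : Continuous K) (hφ : Continuous φ) {B M : ℝ}
    (hB : ∀ t, ‖K t‖ ≤ B) (hM : ∀ x, ‖φ x‖ ≤ M) (x : ℝ) : ‖circConv K φ x‖ ≤ B * M := by
  have hM0 : 0 ≤ M := (norm_nonneg _).trans (hM 0)
  have hp : 0 < 2 * Real.pi := by have := Real.pi_pos; positivity
  have h : ∫ t, ‖K t‖ ∂circMeasure ≤ 2 * Real.pi * B := by
    rw [← integral_circMeasure_const]
    exact integral_circMeasure_mono hK.norm continuous_const fun t _ => hB t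
  calc _ ≤ _ := norm_circConv_le_of_le hK hφ hM x
    _ ≤ (2 * Real.pi)⁻¹ * (2 * Real.pi * B) * M := by gcongr
    _ = B * M := by field_simp

lemma exists_norm_circConv_cesaroKer_cesaroKer_le {α : ℝ} (h0 : 0 ≤ α) (h1 : α < 1) :
    ∃ C, 0 ≤ C ∧ ∀ (n d : ℕ), d ≤ n → ∀ (a : ℤ → ℂ) (M : ℝ), (∀ x, ‖trigSum d a x‖ ≤ M) →
      ∀ x, ‖circConv (cesaroKer (-α) n) (circConv (cesaroKer 1 n) (trigSum d a)) x‖ ≤ C * M := by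
  obtain ⟨C, hC, h⟩ := exists_integral_norm_cesaroKer_one_sub_le h0 h1
  have hα : 0 < 1 - α := by linarith
  have hp : 0 < (2 * Real.pi)⁻¹ := by have := Real.pi_pos; positivity
  refine ⟨(2 * Real.pi)⁻¹ * C + 3 / (1 - α), by positivity, fun n d hd a M hM x => ?_⟩
  have hM0 : 0 ≤ M := (norm_nonneg _).trans (hM 0)
  have hn : (0 : ℝ) < n + 1 := by positivity
  have e1 : circConv (cesaroKer 1 n) (trigSum d a) = _ :=
    funext fun y => circConv_evenKer_trigSum _ hd a y
  have e : circConv (cesaroKer (-α) n) (circConv (cesaroKer 1 n) (trigSum d a)) x =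
      (((n + 1 - α) / (n + 1) : ℝ) : ℂ) * circConv (cesaroKer (1 - α) n) (trigSum d a) x +
      ((α / (n + 1) : ℝ) : ℂ) * circConv (cesaroKer (-α) n) (trigSum d a) x := by
    rw [e1]
    unfold cesaroKer
    rw [circConv_evenKer_trigSum _ hd, circConv_evenKer_trigSum _ hd, circConv_evenKer_trigSum _ hd,
      ← trigSum_const_mul, ← trigSum_const_mul, ← trigSum_add]
    refine trigSum_congr (fun k hk => ?_) x
    rw [← mul_assoc, ← mul_assoc, ← mul_assoc, ← add_mul, ← Complex.ofReal_mul,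
      ← Complex.ofReal_mul, ← Complex.ofReal_mul, ← Complex.ofReal_add,
      cesaroKer_multiplier_mul h1 (hk.trans hd)]
  rw [e]
  have b1 := norm_circConv_le_of_le (continuous_cesaroKer (1 - α) n) (continuous_trigSum d a) hM x
  have b2 := norm_circConv_le_of_norm_le (continuous_cesaroKer (-α) n) (continuous_trigSum d a)
    (norm_cesaroKer_neg_le_trivial h0 h1 n) hM x
  have c1 : |((n : ℝ) + 1 - α) / (n + 1)| ≤ 1 := by
    rw [abs_of_nonneg (div_nonneg (by linarith [n.cast_nonneg (α := ℝ)]) hn.le), div_le_one hn]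
    linarith
  have c2 : |α / ((n : ℝ) + 1)| ≤ 1 / (n + 1) := by
    rw [abs_of_nonneg (by positivity)]; gcongr
  refine (norm_add_le _ _).trans ?_
  rw [norm_mul, norm_mul, Complex.norm_real, Complex.norm_real, Real.norm_eq_abs, Real.norm_eq_abs,
    add_mul]
  refine add_le_add ?_ ?_
  · calc _ ≤ 1 * ((2 * Real.pi)⁻¹ * (∫ t, ‖cesaroKer (1 - α) n t‖ ∂circMeasure) * M) := by gcongr
      _ ≤ 1 * ((2 * Real.pi)⁻¹ * C * M) := by gcongr; exact h n
      _ = _ := one_mul _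
  · calc _ ≤ 1 / ((n : ℝ) + 1) * (3 / (1 - α) * (n + 1) * M) := by gcongr
      _ = _ := by field_simp

lemma exists_norm_circConv_trigSum_le {α : ℝ} (h0 : 0 ≤ α) (h1 : α < 1) :
    ∃ (q : ℕ) (C : ℝ), 1 ≤ q ∧ 0 ≤ C ∧ ∀ (n d : ℕ), q * (d + 1) ≤ n + 1 →
      ∀ (a : ℤ → ℂ) (M : ℝ), (∀ x, ‖trigSum d a x‖ ≤ M) →
        ∀ x, ‖circConv (cesaroKer (-α) n) (trigSum d a) x‖ ≤ C * M := by
  obtain ⟨C, hC, h⟩ := exists_norm_circConv_cesaroKer_cesaroKer_le h0 h1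
  obtain ⟨D, hD, hF⟩ := exists_norm_circConv_cesaroKer_one_le
  obtain ⟨q, hq⟩ := exists_nat_ge (2 * (1 + D))
  have hq1 : 1 ≤ q := by
    have : (1 : ℝ) ≤ q := by linarith
    exact_mod_cast this
  have hα : 0 < 1 - α := by linarith
  refine ⟨q, 2 * C, hq1, by positivity, fun n d hqd => ?_⟩
  have hdn : d ≤ n := by nlinarith
  have hn : (0 : ℝ) < n + 1 := by positivity
  have hd : (0 : ℝ) < d + 1 := by positivity
  have hqd' : (q : ℝ) * (d + 1) ≤ n + 1 := by exact_mod_cast hqd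
  set B : ℝ := 3 / (1 - α) * ((n : ℝ) + 1) with hB
  have key : ∀ (L : ℕ) (a : ℤ → ℂ) (M : ℝ), (∀ x, ‖trigSum d a x‖ ≤ M) →
      ∀ x, ‖circConv (cesaroKer (-α) n) (trigSum d a) x‖ ≤ (2 * C + (1 / 2) ^ L * B) * M := by
    intro L
    induction L with
    | zero =>
      intro a M hM x
      have hM0 : 0 ≤ M := (norm_nonneg _).trans (hM 0)
      have := norm_circConv_le_of_norm_le (continuous_cesaroKer (-α) n) (continuous_trigSum d a)
        (norm_cesaroKer_neg_le_trivial h0 h1 n) hM x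
      rw [← hB] at this
      nlinarith [mul_nonneg hC hM0]
    | succ L ih =>
      intro a M hM x
      have hM0 : 0 ≤ M := (norm_nonneg _).trans (hM 0)
      have hr : ∀ y, trigSum d a y - circConv (cesaroKer 1 n) (trigSum d a) y =
          (((d + 1) / (n + 1) : ℝ) : ℂ) *
            (trigSum d a y - circConv (cesaroKer 1 d) (trigSum d a) y) := by
        intro y
        unfold cesaroKer
        rw [circConv_evenKer_trigSum _ hdn, circConv_evenKer_trigSum _ le_rfl, ← trigSum_sub,
          ← trigSum_sub, ← trigSum_const_mul]
        refine trigSum_congr (fun k hk => ?_) y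
        rw [AA_one_left, AA_one_left, AA_one_left, AA_one_left, Nat.cast_sub (hk.trans hdn),
          Nat.cast_sub hk]
        have h1 : (n : ℂ) + 1 ≠ 0 := by exact_mod_cast hn.ne'
        have h2 : (d : ℂ) + 1 ≠ 0 := by exact_mod_cast hd.ne'
        push_cast
        field_simp
        ring
      have hrt : ∀ y, trigSum d a y - circConv (cesaroKer 1 n) (trigSum d a) y =
          trigSum d (fun k => a k - (AA 1 (n - k.natAbs) / AA 1 n : ℝ) * a k) y := by
        intro y
        unfold cesaroKer
        rw [circConv_evenKer_trigSum _ hdn, ← trigSum_sub]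
      have hrb : ∀ y, ‖trigSum d (fun k => a k - (AA 1 (n - k.natAbs) / AA 1 n : ℝ) * a k) y‖ ≤
          M / 2 := by
        intro y
        rw [← hrt, hr, norm_mul, Complex.norm_real, Real.norm_eq_abs, abs_of_pos (by positivity)]
        have h3 : ‖trigSum d a y - circConv (cesaroKer 1 d) (trigSum d a) y‖ ≤ M + D * M :=
          (norm_sub_le _ _).trans (add_le_add (hM y) (hF d (continuous_trigSum d a) hM y))
        calc _ ≤ ((d : ℝ) + 1) / (n + 1) * (M + D * M) := by gcongr
          _ ≤ _ := by
            rw [div_mul_eq_mul_div, div_le_iff₀ hn]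
            nlinarith [mul_le_mul_of_nonneg_right hq (mul_nonneg hd.le hM0),
              mul_le_mul_of_nonneg_right hqd' hM0]
      have hsplit : circConv (cesaroKer (-α) n) (trigSum d a) x =
          circConv (cesaroKer (-α) n) (circConv (cesaroKer 1 n) (trigSum d a)) x +
          circConv (cesaroKer (-α) n)
            (trigSum d (fun k => a k - (AA 1 (n - k.natAbs) / AA 1 n : ℝ) * a k)) x := by
        rw [← circConv_add (continuous_cesaroKer _ _)
          (continuous_circConv (continuous_cesaroKer _ _) (continuous_trigSum _ _))
          (continuous_trigSum _ _)]
        congr 1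
        funext s
        rw [← hrt]; ring
      rw [hsplit]
      refine (norm_add_le _ _).trans
        ((add_le_add (h n d hdn a M hM x) (ih _ _ hrb x)).trans (le_of_eq ?_))
      rw [pow_succ]; ring
  intro a M hM x
  have hlim : Tendsto (fun L : ℕ => (2 * C + (1 / 2 : ℝ) ^ L * B) * M) atTop
      (nhds ((2 * C + 0 * B) * M)) :=
    (((tendsto_pow_atTop_nhds_zero_of_lt_one (by norm_num) (by norm_num)).mul_const B).const_add
      (2 * C)).mul_const M
  rw [zero_mul, add_zero] at hlim
  exact ge_of_tendsto' hlim fun L => key L a M hM x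

lemma tendsto_AA_sub_div {α : ℝ} (h1 : α < 1) (k : ℕ) :
    Tendsto (fun n => AA (-α) (n - k) / AA (-α) n) atTop (nhds 1) := by
  have hpos : ∀ n, 0 < AA (-α) n := AA_pos (by linarith)
  have hinv : Tendsto (fun n : ℕ => ((n : ℝ) + 1)⁻¹) atTop (nhds 0) :=
    tendsto_inv_atTop_zero.comp (tendsto_atTop_add_const_right _ _ tendsto_natCast_atTop_atTop)
  have hstep : Tendsto (fun n => AA (-α) n / AA (-α) (n + 1)) atTop (nhds 1) := by
    have : Tendsto (fun n : ℕ => (1 - α * ((n : ℝ) + 1)⁻¹)⁻¹) atTop (nhds (1 - α * 0)⁻¹) :=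
      ((hinv.const_mul α).const_sub 1).inv₀ (by norm_num)
    rw [mul_zero, sub_zero, inv_one] at this
    refine this.congr fun n => ?_
    have hA := hpos n
    have hn : (0 : ℝ) < n + 1 := by positivity
    have h3 : (n : ℝ) + 1 - α ≠ 0 := by linarith [n.cast_nonneg (α := ℝ)]
    have h4 : -α + ((n : ℝ) + 1) ≠ 0 := by linarith [n.cast_nonneg (α := ℝ)]
    simp only [AA]
    rw [inv_eq_one_div]
    have h5 : 1 - α * ((n : ℝ) + 1)⁻¹ ≠ 0 := by
      rw [show 1 - α * ((n : ℝ) + 1)⁻¹ = ((n : ℝ) + 1 - α) / (n + 1) by field_simp]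
      positivity
    field_simp
    ring
  induction k with
  | zero => simp [div_self (hpos _).ne']
  | succ k ih =>
    have h2 : Tendsto (fun n => AA (-α) (n - k) / AA (-α) n * (AA (-α) n / AA (-α) (n + 1)))
        atTop (nhds (1 * 1)) := ih.mul hstep
    rw [mul_one] at h2
    rw [← tendsto_add_atTop_iff_nat 1]
    refine h2.congr fun n => ?_
    have hA := hpos n
    have hB := hpos (n + 1)
    rw [Nat.add_sub_add_right]
    field_simp

lemma eventually_norm_circConv_trigSum_sub_le {α : ℝ} (h1 : α < 1) (d : ℕ) {ε : ℝ} (hε : 0 < ε) :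
    ∀ᶠ n in atTop, ∀ (a : ℤ → ℂ) (M : ℝ), (∀ x, ‖trigSum d a x‖ ≤ M) →
      ∀ x, ‖circConv (cesaroKer (-α) n) (trigSum d a) x - trigSum d a x‖ ≤ ε * M := by
  have hlim : Tendsto (fun n => ∑ k ∈ Finset.Icc (-(d : ℤ)) d,
      |AA (-α) (n - k.natAbs) / AA (-α) n - 1|) atTop (nhds 0) := by
    have : Tendsto (fun n => ∑ k ∈ Finset.Icc (-(d : ℤ)) d,
        |AA (-α) (n - k.natAbs) / AA (-α) n - 1|) atTop
        (nhds (∑ k ∈ Finset.Icc (-(d : ℤ)) d, |(1 : ℝ) - 1|)) :=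
      tendsto_finsetSum _ fun k _ => ((tendsto_AA_sub_div h1 k.natAbs).sub_const 1).abs
    simpa using this
  filter_upwards [hlim.eventually_le_const hε, eventually_ge_atTop d] with n hn hdn a M hM x
  have hM0 : 0 ≤ M := (norm_nonneg _).trans (hM 0)
  have e : circConv (cesaroKer (-α) n) (trigSum d a) x - trigSum d a x =
      circConv (evenKer (fun k => AA (-α) (n - k) / AA (-α) n - 1) d) (trigSum d a) x := by
    unfold cesaroKer
    rw [circConv_evenKer_trigSum _ hdn, circConv_evenKer_trigSum _ le_rfl, ← trigSum_sub]
    refine trigSum_congr (fun k _ => ?_) x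
    push_cast; ring
  rw [e]
  refine (norm_circConv_le_of_norm_le (continuous_evenKer _ _) (continuous_trigSum d a)
    (norm_evenKer_le _ d) hM x).trans ?_
  gcongr

/-- A nonnegative kernel of mean one on the circle whose first absolute moment is at most `δ`. -/
structure IsMollifier (W : ℝ → ℝ) (δ : ℝ) : Prop where
  continuous : Continuous W
  nonneg : ∀ t, 0 ≤ W t
  integral_eq : ∫ t, W t ∂circMeasure = 2 * Real.pi
  moment_le : (2 * Real.pi)⁻¹ * ∫ t, W t * |t| ∂circMeasure ≤ δ

/-- The mean of the squared Fejér kernel. -/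
noncomputable def fejerSqMean (N : ℕ) : ℝ :=
  (2 * Real.pi)⁻¹ * ∫ t, ‖cesaroKer 1 N t‖ ^ 2 ∂circMeasure

/-- The normalized squared Fejér kernel. -/
noncomputable def jackson (N : ℕ) (t : ℝ) : ℝ := ‖cesaroKer 1 N t‖ ^ 2 / fejerSqMean N

lemma conj_evenKer (c : ℕ → ℝ) (n : ℕ) (t : ℝ) :
    (starRingEnd ℂ) (evenKer c n t) = ∑ k ∈ Finset.Icc (-(n : ℤ)) n,
      (c k.natAbs : ℂ) * Complex.exp (Complex.I * (k : ℂ) * (t : ℂ)) := by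
  unfold evenKer
  simp only [map_sum, map_mul, ← Complex.exp_conj, map_neg, Complex.conj_I, Complex.conj_ofReal,
    map_intCast]
  simp

lemma norm_sq_eq_mul_conj (z : ℂ) : ((‖z‖ ^ 2 : ℝ) : ℂ) = z * (starRingEnd ℂ) z := by
  rw [Complex.mul_conj, Complex.normSq_eq_norm_sq]

lemma integral_norm_evenKer_sq (c : ℕ → ℝ) (n : ℕ) :
    (2 * Real.pi)⁻¹ * ∫ t, ‖evenKer c n t‖ ^ 2 ∂circMeasure =
      ∑ k ∈ Finset.Icc (-(n : ℤ)) n, c k.natAbs ^ 2 := by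
  have hpi : (Real.pi : ℂ) ≠ 0 := by exact_mod_cast Real.pi_ne_zero
  have hc := continuous_evenKer c n
  apply Complex.ofReal_injective
  rw [Complex.ofReal_mul, ← integral_complex_ofReal]
  simp only [norm_sq_eq_mul_conj, conj_evenKer, Finset.mul_sum]
  rw [integral_finsetSum _ fun i _ => Continuous.integrable_circMeasure (by fun_prop)]
  simp only [mul_left_comm _ (Complex.ofReal (c _)), integral_const_mul, integral_evenKer_mul_exp]
  rw [Finset.mul_sum, Complex.ofReal_sum]
  refine Finset.sum_congr rfl fun k hk => ?_
  rw [if_pos (by rw [Finset.mem_Icc] at hk; omega)]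
  push_cast
  field_simp

lemma cube_le_three_mul_sum_sq (N : ℕ) :
    (N : ℝ) ^ 3 ≤ 3 * ∑ j ∈ Finset.range N, ((j : ℝ) + 1) ^ 2 := by
  induction N with
  | zero => simp
  | succ N ih =>
    rw [Finset.sum_range_succ]
    push_cast
    nlinarith [N.cast_nonneg (α := ℝ)]

lemma le_fejerSqMean (N : ℕ) : ((N : ℝ) + 1) / 3 ≤ fejerSqMean N := by
  unfold fejerSqMean cesaroKer
  rw [integral_norm_evenKer_sq, sum_Icc_neg_self]
  have hN : (0 : ℝ) < N + 1 := by positivity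
  have h1 : (AA 1 (N - (0 : ℤ).natAbs) / AA 1 N) ^ 2 ≤ ∑ k ∈ Finset.range (N + 1),
      (AA 1 (N - (-(k : ℤ)).natAbs) / AA 1 N) ^ 2 := by
    refine Finset.single_le_sum (f := fun k : ℕ => (AA 1 (N - (-(k : ℤ)).natAbs) / AA 1 N) ^ 2)
      (fun _ _ => sq_nonneg _) (Finset.mem_range.2 N.succ_pos)
  have h2 : ∑ k ∈ Finset.range (N + 1), (AA 1 (N - (k : ℤ).natAbs) / AA 1 N) ^ 2 =
      (∑ j ∈ Finset.range (N + 1), ((j : ℝ) + 1) ^ 2) / ((N : ℝ) + 1) ^ 2 := by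
    rw [Finset.sum_div, ← Finset.sum_range_reflect]
    refine Finset.sum_congr rfl fun k hk => ?_
    have : k ≤ N := Nat.lt_succ_iff.1 (Finset.mem_range.1 hk)
    rw [Int.natAbs_natCast, AA_one_left, AA_one_left, div_pow]
    congr 3
    rw [show N - (N + 1 - 1 - k) = k by omega]
  have h3 := cube_le_three_mul_sum_sq (N + 1)
  push_cast at h3
  have h4 : ((N : ℝ) + 1) / 3 ≤
      (∑ j ∈ Finset.range (N + 1), ((j : ℝ) + 1) ^ 2) / ((N : ℝ) + 1) ^ 2 := by
    rw [le_div_iff₀ (by positivity)]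
    nlinarith
  linarith

lemma fejerSqMean_pos (N : ℕ) : 0 < fejerSqMean N :=
  lt_of_lt_of_le (by positivity) (le_fejerSqMean N)

@[fun_prop]
lemma continuous_jackson (N : ℕ) : Continuous (jackson N) :=
  ((continuous_cesaroKer 1 N).norm.pow 2).div_const _

lemma exists_isMollifier_jackson :
    ∃ C, 0 ≤ C ∧ ∀ N : ℕ, IsMollifier (jackson N) (C / (N + 1)) := by
  obtain ⟨C, hC, h⟩ := exists_norm_cesaroKer_one_sub_le (α := 0) le_rfl one_pos
  obtain ⟨D, hD, hd⟩ := exists_integral_one_add_rpow_le (p := 3) (by norm_num)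
  have hpi := Real.pi_pos
  refine ⟨(2 * Real.pi)⁻¹ * (C ^ 2 * D * 3), by positivity, fun N => ?_⟩
  have hN : (0 : ℝ) < N + 1 := by positivity
  have hm := fejerSqMean_pos N
  refine ⟨continuous_jackson N, fun t => by unfold jackson; positivity, ?_, ?_⟩
  · unfold jackson
    rw [integral_div, div_eq_iff hm.ne', fejerSqMean]
    field_simp
  · have hb : ∫ t, jackson N t * |t| ∂circMeasure ≤
        ∫ t, C ^ 2 * (N + 1) / fejerSqMean N * (1 + ((N : ℝ) + 1) * |t|) ^ (-(3 : ℝ))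
          ∂circMeasure := by
      refine integral_circMeasure_mono (by fun_prop)
        (continuous_const.mul (continuous_one_add_rpow hN.le _)) fun t ht => ?_
      have h' := h N t ht
      rw [sub_zero, sub_zero] at h'
      set u : ℝ := 1 + ((N : ℝ) + 1) * |t| with hu
      have hu0 : 0 < u := by positivity
      have e2 : u ^ (-(2 : ℝ)) = (u ^ 2)⁻¹ := by
        rw [Real.rpow_neg hu0.le]; norm_cast
      have e3 : u ^ (-(3 : ℝ)) = (u ^ 3)⁻¹ := by
        rw [Real.rpow_neg hu0.le]; norm_cast
      rw [e2] at h'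
      rw [e3]
      unfold jackson
      rw [div_mul_eq_mul_div, div_mul_eq_mul_div]
      refine div_le_div_of_nonneg_right ?_ hm.le
      calc ‖cesaroKer 1 N t‖ ^ 2 * |t| ≤ (C * ((N + 1) * (u ^ 2)⁻¹)) ^ 2 * (u / (N + 1)) := by
            gcongr
            rw [le_div_iff₀ hN]; linarith
        _ = C ^ 2 * (N + 1) * (u ^ 3)⁻¹ := by field_simp
    calc (2 * Real.pi)⁻¹ * ∫ t, jackson N t * |t| ∂circMeasure
        ≤ (2 * Real.pi)⁻¹ * (C ^ 2 * (N + 1) / fejerSqMean N * (D / (N + 1))) := by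
          gcongr
          refine hb.trans ?_
          rw [integral_const_mul]
          gcongr
          exact hd _ hN
      _ = (2 * Real.pi)⁻¹ * (C ^ 2 * D / fejerSqMean N) := by field_simp
      _ ≤ (2 * Real.pi)⁻¹ * (C ^ 2 * D / ((N + 1) / 3)) := by
          gcongr; exact le_fejerSqMean N
      _ = _ := by field_simp

lemma exists_circConv_jackson_eq (N : ℕ) {φ : ℝ → ℂ} (hc : Continuous φ)
    (hp : Function.Periodic φ (2 * Real.pi)) :
    ∃ a, circConv (fun t => (jackson N t : ℂ)) φ = trigSum (2 * N) a := by
  set c : ℕ → ℝ := fun k => AA 1 (N - k) / AA 1 N with hcdef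
  set s := Finset.Icc (-(N : ℤ)) N with hs
  set F : ℤ → ℂ := fun r => (2 * (Real.pi : ℂ))⁻¹ *
    ∫ t : ℝ, Complex.exp (-(Complex.I * (r : ℂ) * (t : ℂ))) * φ t ∂circMeasure with hF
  have hker : ∀ t : ℝ, (jackson N t : ℂ) = ∑ i ∈ s ×ˢ s,
      ((c i.1.natAbs : ℂ) * c i.2.natAbs / fejerSqMean N) *
        Complex.exp (-(Complex.I * ((i.1 - i.2 : ℤ) : ℂ) * (t : ℂ))) := by
    intro t
    unfold jackson
    rw [Complex.ofReal_div, norm_sq_eq_mul_conj]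
    unfold cesaroKer
    rw [conj_evenKer, evenKer, Finset.sum_mul_sum, ← Finset.sum_product', Finset.sum_div]
    refine Finset.sum_congr rfl fun i _ => ?_
    have : Complex.exp (-(Complex.I * ((i.1 - i.2 : ℤ) : ℂ) * (t : ℂ))) =
        Complex.exp (-(Complex.I * (i.1 : ℂ) * (t : ℂ))) *
          Complex.exp (Complex.I * (i.2 : ℂ) * (t : ℂ)) := by
      rw [← Complex.exp_add]; push_cast; ring_nf
    rw [this]; ring
  refine ⟨fun k => ∑ i ∈ s ×ˢ s, if k = i.1 - i.2 then
    ((c i.1.natAbs : ℂ) * c i.2.natAbs / fejerSqMean N) * F (i.1 - i.2) else 0, funext fun x => ?_⟩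
  simp only [hker]
  rw [circConv_kernel_sum _ _ (fun i => by fun_prop) hc, trigSum_finset_sum]
  refine Finset.sum_congr rfl fun i hi => ?_
  have hk : (i.1 - i.2).natAbs ≤ 2 * N := by
    rw [Finset.mem_product, Finset.mem_Icc, Finset.mem_Icc] at hi
    omega
  rw [trigSum_single hk, circConv_neg_exp hp, hF]
  ring

namespace IsMollifier

variable {W : ℝ → ℝ} {δ : ℝ}

lemma continuous_ofReal (h : IsMollifier W δ) : Continuous fun t => (W t : ℂ) :=
  Complex.continuous_ofReal.comp h.continuous

lemma mono (h : IsMollifier W δ) {δ' : ℝ} (hδ : δ ≤ δ') : IsMollifier W δ' :=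
  ⟨h.continuous, h.nonneg, h.integral_eq, h.moment_le.trans hδ⟩

lemma norm_circConv_le (h : IsMollifier W δ) {φ : ℝ → ℂ} (hφ : Continuous φ) {M : ℝ}
    (hM : ∀ x, ‖φ x‖ ≤ M) (x : ℝ) : ‖circConv (fun t => (W t : ℂ)) φ x‖ ≤ M := by
  refine (norm_circConv_le_of_le h.continuous_ofReal hφ hM x).trans (le_of_eq ?_)
  have hpi := Real.pi_pos
  simp only [Complex.norm_real, Real.norm_eq_abs, abs_of_nonneg (h.nonneg _)]
  rw [h.integral_eq]
  field_simp

lemma circConv_const (h : IsMollifier W δ) (c : ℂ) (x : ℝ) :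
    circConv (fun t => (W t : ℂ)) (fun _ => c) x = c := by
  unfold circConv
  have : (Real.pi : ℂ) ≠ 0 := by exact_mod_cast Real.pi_ne_zero
  rw [integral_mul_const, integral_complex_ofReal, h.integral_eq]
  push_cast
  field_simp

lemma norm_sub_circConv_le (h : IsMollifier W δ) {φ : ℝ → ℂ} (hφ : Continuous φ) (x : ℝ) :
    ‖φ x - circConv (fun t => (W t : ℂ)) φ x‖ ≤
      (2 * Real.pi)⁻¹ * ∫ t, W t * ‖φ (x + t) - φ x‖ ∂circMeasure := by
  have hs := circConv_sub h.continuous_ofReal hφ (continuous_const (y := φ x)) x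
  rw [h.circConv_const] at hs
  rw [norm_sub_rev, ← hs]
  refine (_root_.norm_circConv_le _ _ x).trans (le_of_eq ?_)
  simp only [Complex.norm_real, Real.norm_eq_abs, abs_of_nonneg (h.nonneg _)]

end IsMollifier

lemma continuous_integral_circMeasure {X E : Type*} [TopologicalSpace X]
    [FirstCountableTopology X] [LocallyCompactSpace X] [NormedAddCommGroup E] [NormedSpace ℝ E]
    {G : X → ℝ → E} (hG : Continuous fun p : X × ℝ => G p.1 p.2) :
    Continuous fun x => ∫ t, G x t ∂circMeasure :=
  continuous_parametric_integral_of_continuous (f := G) hG isCompact_Icc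

lemma integral_circMeasure_comm {E : ℝ → ℝ → ℝ} (hE : Continuous fun p : ℝ × ℝ => E p.1 p.2) :
    ∫ s, ∫ t, E s t ∂circMeasure ∂circMeasure = ∫ t, ∫ s, E s t ∂circMeasure ∂circMeasure :=
  integral_integral_swap (f := E) hE.integrable_circMeasure_prod

lemma Continuous.swap_args {E : Type*} [TopologicalSpace E] {g : ℝ → ℝ → E}
    (hg : Continuous fun p : ℝ × ℝ => g p.1 p.2) : Continuous fun p : ℝ × ℝ => g p.2 p.1 :=
  hg.comp continuous_swap

lemma Continuous.comp_args {X E : Type*} [TopologicalSpace X] [TopologicalSpace E] {g : ℝ → ℝ → E}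
    (hg : Continuous fun p : ℝ × ℝ => g p.1 p.2) {a b : X → ℝ} (ha : Continuous a)
    (hb : Continuous b) : Continuous fun p => g (a p) (b p) :=
  hg.comp (ha.prodMk hb)

/-- Averaging in a parameter does not increase integrals. -/
lemma integral_kernel_average_le {W : ℝ → ℝ} (hW : Continuous W) (hW0 : ∀ t, 0 ≤ W t)
    {E : ℝ → ℝ → ℝ} (hE : Continuous fun p : ℝ × ℝ => E p.1 p.2) {B : ℝ → ℝ} (hB : Continuous B)
    (h : ∀ t, |t| ≤ Real.pi → ∫ s, E s t ∂circMeasure ≤ B t) :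
    ∫ s, (2 * Real.pi)⁻¹ * ∫ t, W t * E s t ∂circMeasure ∂circMeasure ≤
      (2 * Real.pi)⁻¹ * ∫ t, W t * B t ∂circMeasure := by
  have hpi := Real.pi_pos
  have hWE : Continuous fun p : ℝ × ℝ => W p.2 * E p.1 p.2 :=
    (hW.comp continuous_snd).mul hE
  rw [integral_const_mul, integral_circMeasure_comm hWE]
  refine mul_le_mul_of_nonneg_left ?_ (by positivity)
  refine integral_circMeasure_mono (continuous_integral_circMeasure
    (G := fun t s => W t * E s t) ((hW.comp continuous_fst).mul hE.swap_args))
    (hW.mul hB) fun t ht => ?_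
  rw [integral_const_mul]
  exact mul_le_mul_of_nonneg_left (h t ht) (hW0 t)

lemma circConv_periodic (K : ℝ → ℂ) {φ : ℝ → ℂ} (h : Function.Periodic φ (2 * Real.pi)) :
    Function.Periodic (circConv K φ) (2 * Real.pi) := by
  intro x
  unfold circConv
  simp only [add_right_comm x (2 * Real.pi), h _]

lemma continuous_circConv_fst {K : ℝ → ℂ} {g : ℝ → ℝ → ℂ} (hK : Continuous K)
    (hg : Continuous fun p : ℝ × ℝ => g p.1 p.2) :
    Continuous fun p : ℝ × ℝ => circConv K (fun s => g s p.2) p.1 :=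
  (continuous_circConv_param (G := fun y s => g s y) hK hg.swap_args).comp continuous_swap

lemma continuous_circConv_snd {K : ℝ → ℂ} {g : ℝ → ℝ → ℂ} (hK : Continuous K)
    (hg : Continuous fun p : ℝ × ℝ => g p.1 p.2) :
    Continuous fun p : ℝ × ℝ => circConv K (g p.1) p.2 :=
  continuous_circConv_param hK hg

/-- Functions that are continuous, periodic, bounded by `M` and whose sections are
Lipschitz in mean with constant `V`. -/
structure VarClass (M V : ℝ) (g : ℝ → ℝ → ℂ) : Prop where
  continuous : Continuous fun p : ℝ × ℝ => g p.1 p.2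
  periodic_fst : ∀ y, Function.Periodic (fun x => g x y) (2 * Real.pi)
  periodic_snd : ∀ x, Function.Periodic (g x) (2 * Real.pi)
  norm_le : ∀ x y, ‖g x y‖ ≤ M
  integral_fst_le : ∀ h y, |h| ≤ Real.pi → ∫ s, ‖g (s + h) y - g s y‖ ∂circMeasure ≤ V * |h|
  integral_snd_le : ∀ h x, |h| ≤ Real.pi → ∫ t, ‖g x (t + h) - g x t‖ ∂circMeasure ≤ V * |h|

namespace VarClass

variable {M V : ℝ} {g : ℝ → ℝ → ℂ}

lemma swap (h : VarClass M V g) : VarClass M V fun x y => g y x :=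
  ⟨h.continuous.swap_args, h.periodic_snd, h.periodic_fst, fun x y => h.norm_le y x,
    h.integral_snd_le, h.integral_fst_le⟩

lemma continuous_left (h : VarClass M V g) (y : ℝ) : Continuous fun x => g x y :=
  h.continuous.comp_args continuous_id continuous_const

lemma continuous_right (h : VarClass M V g) (x : ℝ) : Continuous (g x) :=
  h.continuous.comp_args continuous_const continuous_id

lemma bound_nonneg (h : VarClass M V g) : 0 ≤ M := (norm_nonneg _).trans (h.norm_le 0 0)

lemma var_nonneg (h : VarClass M V g) : 0 ≤ V := by
  have := h.integral_fst_le Real.pi 0 (abs_of_pos Real.pi_pos).le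
  have h0 : 0 ≤ ∫ s, ‖g (s + Real.pi) 0 - g s 0‖ ∂circMeasure :=
    integral_nonneg fun _ => norm_nonneg _
  rw [abs_of_pos Real.pi_pos] at this
  nlinarith [Real.pi_pos]

lemma sub {M' V' : ℝ} {g' : ℝ → ℝ → ℂ} (h : VarClass M V g) (h' : VarClass M' V' g') :
    VarClass (M + M') (V + V') fun x y => g x y - g' x y := by
  refine ⟨h.continuous.sub h'.continuous, fun y => (h.periodic_fst y).sub (h'.periodic_fst y),
    fun x => (h.periodic_snd x).sub (h'.periodic_snd x),
    fun x y => (norm_sub_le _ _).trans (add_le_add (h.norm_le x y) (h'.norm_le x y)), ?_, ?_⟩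
  · intro r y hr
    have c1 := h.continuous_left y
    have c2 := h'.continuous_left y
    rw [add_mul]
    refine le_trans ?_ (add_le_add (h.integral_fst_le r y hr) (h'.integral_fst_le r y hr))
    rw [← integral_add (Continuous.integrable_circMeasure (by fun_prop))
      (Continuous.integrable_circMeasure (by fun_prop))]
    refine integral_circMeasure_mono (by fun_prop) (by fun_prop) fun t _ => ?_
    rw [sub_sub_sub_comm]
    exact norm_sub_le _ _
  · intro r x hr
    have c1 := h.continuous_right x
    have c2 := h'.continuous_right x
    rw [add_mul]
    refine le_trans ?_ (add_le_add (h.integral_snd_le r x hr) (h'.integral_snd_le r x hr))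
    rw [← integral_add (Continuous.integrable_circMeasure (by fun_prop))
      (Continuous.integrable_circMeasure (by fun_prop))]
    refine integral_circMeasure_mono (by fun_prop) (by fun_prop) fun t _ => ?_
    rw [sub_sub_sub_comm]
    exact norm_sub_le _ _

end VarClass

namespace IsMollifier

variable {W : ℝ → ℝ} {δ : ℝ}

/-- Mollification does not increase mean norms over a parameter. -/
lemma integral_norm_circConv_le (hW : IsMollifier W δ) {D : ℝ → ℝ → ℂ}
    (hD : Continuous fun p : ℝ × ℝ => D p.1 p.2) {x B : ℝ}
    (h : ∀ t, ∫ r, ‖D r (x + t)‖ ∂circMeasure ≤ B) :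
    ∫ r, ‖circConv (fun t => (W t : ℂ)) (D r) x‖ ∂circMeasure ≤ B := by
  have hc : Continuous fun p : ℝ × ℝ => ‖D p.1 (x + p.2)‖ :=
    (hD.comp_args continuous_fst (continuous_const.add continuous_snd)).norm
  have hpi := Real.pi_pos
  have hWc := hW.continuous
  calc ∫ r, ‖circConv (fun t => (W t : ℂ)) (D r) x‖ ∂circMeasure
      ≤ ∫ r, (2 * Real.pi)⁻¹ * ∫ t, W t * ‖D r (x + t)‖ ∂circMeasure ∂circMeasure := by
        refine integral_circMeasure_mono ?_ ?_ fun r _ => ?_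
        · exact ((continuous_circConv_snd hW.continuous_ofReal hD).comp
            (Continuous.prodMk_left x)).norm
        · refine continuous_const.mul (continuous_integral_circMeasure ?_)
          exact (hW.continuous.comp continuous_snd).mul hc
        · refine (_root_.norm_circConv_le _ _ x).trans (le_of_eq ?_)
          simp only [Complex.norm_real, Real.norm_eq_abs, abs_of_nonneg (hW.nonneg _)]
    _ ≤ (2 * Real.pi)⁻¹ * ∫ t, W t * B ∂circMeasure :=
        integral_kernel_average_le hW.continuous hW.nonneg hc continuous_const fun t _ => h t
    _ = B := by
        rw [integral_mul_const, hW.integral_eq]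
        field_simp

lemma varClass_circConv_fst (hW : IsMollifier W δ) {M V : ℝ} {g : ℝ → ℝ → ℂ}
    (hg : VarClass M V g) :
    VarClass M V fun x y => circConv (fun t => (W t : ℂ)) (fun s => g s y) x := by
  refine ⟨continuous_circConv_fst hW.continuous_ofReal hg.continuous,
    fun y => circConv_periodic _ (hg.periodic_fst y), fun x y => ?_,
    fun x y => hW.norm_circConv_le (hg.continuous_left y) (fun s => hg.norm_le s y) x, ?_, ?_⟩
  · simp only [hg.periodic_snd _ y]
  · intro r y hr
    have c := hg.continuous_left y
    have e : ∀ s, circConv (fun t => (W t : ℂ)) (fun s => g s y) (s + r) -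
        circConv (fun t => (W t : ℂ)) (fun s => g s y) s =
        circConv (fun t => (W t : ℂ)) (fun t => g (s + t + r) y - g (s + t) y) 0 := by
      intro s
      rw [circConv_sub hW.continuous_ofReal (by fun_prop) (by fun_prop)]
      simp only [circConv, zero_add, add_right_comm s r]
    simp only [e]
    refine hW.integral_norm_circConv_le (D := fun s t => g (s + t + r) y - g (s + t) y)
      (by fun_prop) fun t => ?_
    have hp : Function.Periodic (fun s => ‖g (s + r) y - g s y‖) (2 * Real.pi) := by
      intro s
      have h1 := hg.periodic_fst y (s + r)
      have h2 := hg.periodic_fst y s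
      simp only [add_right_comm s (2 * Real.pi) r, h1, h2]
    have := integral_circMeasure_shift hp t
    simp only [zero_add]
    simp only [add_comm t] at this
    rw [this]
    exact hg.integral_fst_le r y hr
  · intro r x hr
    have e : ∀ t, circConv (fun t => (W t : ℂ)) (fun s => g s (t + r)) x -
        circConv (fun t => (W t : ℂ)) (fun s => g s t) x =
        circConv (fun t => (W t : ℂ)) (fun s => g s (t + r) - g s t) x := fun t =>
      (circConv_sub hW.continuous_ofReal (hg.continuous_left _) (hg.continuous_left _) x).symm
    simp only [e]
    refine hW.integral_norm_circConv_le (D := fun t s => g s (t + r) - g s t) ?_ fun s =>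
      hg.integral_snd_le r (x + s) hr
    exact (hg.continuous.comp_args continuous_snd (by fun_prop)).sub
      (hg.continuous.comp_args continuous_snd (by fun_prop))

lemma varClass_circConv_snd (hW : IsMollifier W δ) {M V : ℝ} {g : ℝ → ℝ → ℂ}
    (hg : VarClass M V g) :
    VarClass M V fun x y => circConv (fun t => (W t : ℂ)) (g x) y :=
  (hW.varClass_circConv_fst hg.swap).swap

lemma integral_norm_sub_circConv_le (hW : IsMollifier W δ) {M V : ℝ} {g : ℝ → ℝ → ℂ}
    (hg : VarClass M V g) (y : ℝ) :
    ∫ s, ‖g s y - circConv (fun t => (W t : ℂ)) (fun s => g s y) s‖ ∂circMeasure ≤ V * δ := by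
  have c := hg.continuous_left y
  have hWc := hW.continuous
  have hc : Continuous fun p : ℝ × ℝ => ‖g (p.1 + p.2) y - g p.1 y‖ := by fun_prop
  calc _ ≤ ∫ s, (2 * Real.pi)⁻¹ * ∫ t, W t * ‖g (s + t) y - g s y‖ ∂circMeasure ∂circMeasure := by
        refine integral_circMeasure_mono ?_ ?_ fun s _ => hW.norm_sub_circConv_le c s
        · exact (c.sub (continuous_circConv hW.continuous_ofReal c)).norm
        · refine continuous_const.mul (continuous_integral_circMeasure ?_)
          exact (hW.continuous.comp continuous_snd).mul hc
    _ ≤ (2 * Real.pi)⁻¹ * ∫ t, W t * (V * |t|) ∂circMeasure :=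
        integral_kernel_average_le hW.continuous hW.nonneg hc (by fun_prop) fun t ht =>
          hg.integral_fst_le t y ht
    _ = V * ((2 * Real.pi)⁻¹ * ∫ t, W t * |t| ∂circMeasure) := by
        simp only [mul_left_comm _ V, integral_const_mul]
    _ ≤ V * δ := mul_le_mul_of_nonneg_left hW.moment_le hg.var_nonneg

end IsMollifier

/-- A kernel at scale `1 / a` controlled by a mollifier at the same scale. -/
structure GoodKernel (v C a : ℝ) (K : ℝ → ℂ) (W : ℝ → ℝ) : Prop where
  pos : 0 < a
  one_le : 1 ≤ C
  continuous : Continuous K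
  mollifier : IsMollifier W (C / a)
  norm_circConv_circConv_le : ∀ {φ : ℝ → ℂ}, Continuous φ → Function.Periodic φ (2 * Real.pi) →
    ∀ {M : ℝ}, (∀ x, ‖φ x‖ ≤ M) →
      ∀ x, ‖circConv K (circConv (fun t => (W t : ℂ)) φ) x‖ ≤ C * M
  integral_rpow_le : ∫ t, ‖K t‖ ^ (1 / (1 - v)) ∂circMeasure ≤ C * a ^ (1 / (1 - v) - 1)

lemma exists_goodKernel_cesaroKer {α v : ℝ} (h0 : 0 < α) (hv : α < v) (hv1 : v < 1) :
    ∃ C, ∀ᶠ n : ℕ in atTop, ∃ W, GoodKernel v C (n + 1) (cesaroKer (-α) n) W := by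
  have h1 : α < 1 := hv.trans hv1
  have hx : 0 < 1 - v := by linarith
  obtain ⟨q, C₁, hq, hC₁, hT⟩ := exists_norm_circConv_trigSum_le h0.le h1
  obtain ⟨C₂, hC₂, hJ⟩ := exists_isMollifier_jackson
  obtain ⟨C₃, hC₃, hI⟩ := exists_integral_norm_cesaroKer_rpow_le (x := 1 / (1 - v)) h0.le h1
    (by positivity) (by rw [div_mul_eq_mul_div, lt_div_iff₀ hx]; linarith)
  refine ⟨1 + C₁ + C₂ * (3 * q) + C₃, ?_⟩
  filter_upwards [eventually_ge_atTop q] with n hn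
  have ha : (0 : ℝ) < n + 1 := by positivity
  have hq0 : (0 : ℝ) < q := by exact_mod_cast hq
  set N := (n + 1) / (3 * q) with hN
  have hN1 : N * (3 * q) ≤ n + 1 := Nat.div_mul_le_self _ _
  have hN2 : n + 1 < (N + 1) * (3 * q) := by
    have := Nat.lt_mul_div_succ (n + 1) (show 0 < 3 * q by omega)
    rw [← hN] at this
    linarith
  have hN2' : (n : ℝ) + 1 ≤ (N + 1) * (3 * q) := by exact_mod_cast hN2.le
  have hNd : q * (2 * N + 1) ≤ n + 1 := by
    rcases Nat.eq_zero_or_pos N with h | h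
    · rw [h]; omega
    · nlinarith
  have hC3q : 0 ≤ C₂ * (3 * q) := by positivity
  refine ⟨jackson N, ha, by linarith, continuous_cesaroKer _ _, (hJ N).mono ?_, ?_, ?_⟩
  · rw [div_le_div_iff₀ (by positivity) ha]
    calc C₂ * ((n : ℝ) + 1) ≤ C₂ * ((N + 1) * (3 * q)) := by gcongr
      _ = C₂ * (3 * q) * (N + 1) := by ring
      _ ≤ _ := by gcongr; linarith
  · intro φ hφ hp M hM x
    obtain ⟨b, hb⟩ := exists_circConv_jackson_eq N hφ hp
    have hM0 : 0 ≤ M := (norm_nonneg _).trans (hM 0)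
    have hbM : ∀ y, ‖trigSum (2 * N) b y‖ ≤ M := fun y => by
      rw [← hb]; exact (hJ N).norm_circConv_le hφ hM y
    rw [hb]
    refine (hT n (2 * N) hNd b M hbM x).trans ?_
    gcongr
    linarith
  · refine (hI n).trans ?_
    gcongr
    linarith

lemma le_rpow_mul_rpow {F M r : ℝ} (hF0 : 0 ≤ F) (hF : F ≤ M) (hr1 : r ≤ 1) :
    F ≤ M ^ (1 - r) * F ^ r := by
  rcases hF0.eq_or_lt with h | h
  · rw [← h]
    exact mul_nonneg (Real.rpow_nonneg (h.trans_le hF) _) (Real.rpow_nonneg le_rfl _)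
  · calc F = F ^ (1 - r) * F ^ r := by rw [← Real.rpow_add h]; simp
      _ ≤ _ := by
        refine mul_le_mul_of_nonneg_right (Real.rpow_le_rpow hF0 hF (by linarith))
          (Real.rpow_nonneg hF0 _)

lemma rpow_scaled {k a v : ℝ} (hk : 0 ≤ k) (ha : 0 < a) (hv : v < 1) :
    (k ^ (1 / (1 - v)) * a ^ (1 - 1 / (1 - v))) ^ (1 - v) * a ^ v = k := by
  have h : 1 - v ≠ 0 := by linarith
  rw [Real.mul_rpow (by positivity) (by positivity), ← Real.rpow_mul hk, ← Real.rpow_mul ha.le,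
    one_div_mul_cancel h, Real.rpow_one, mul_assoc, ← Real.rpow_add ha]
  rw [show (1 - 1 / (1 - v)) * (1 - v) + v = 0 by field_simp; ring, Real.rpow_zero, mul_one]

lemma mul_le_young_one {F M k a v : ℝ} (hF0 : 0 ≤ F) (hF : F ≤ M) (hk : 0 ≤ k) (ha : 0 < a)
    (hv0 : 0 < v) (hv : v < 1) :
    k * F ≤ M ^ (1 - v) * (v * (a * F) +
      (1 - v) * (k ^ (1 / (1 - v)) * a ^ (1 - 1 / (1 - v)))) := by
  set A := k ^ (1 / (1 - v)) * a ^ (1 - 1 / (1 - v)) with hA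
  have hA0 : 0 ≤ A := by positivity
  have hM0 : 0 ≤ M := hF0.trans hF
  have hkA : A ^ (1 - v) * a ^ v = k := rpow_scaled hk ha hv
  calc k * F ≤ k * (M ^ (1 - v) * F ^ v) :=
        mul_le_mul_of_nonneg_left (le_rpow_mul_rpow hF0 hF hv.le) hk
    _ = M ^ (1 - v) * ((a * F) ^ v * A ^ (1 - v)) := by
        rw [Real.mul_rpow ha.le hF0]
        nth_rewrite 1 [← hkA]; ring
    _ ≤ _ := by
        refine mul_le_mul_of_nonneg_left ?_ (by positivity)
        exact Real.geom_mean_le_arith_mean2_weighted hv0.le (by linarith) (by positivity) hA0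
          (by ring)

lemma mul_le_young_two {F M k l a b u v : ℝ} (hF0 : 0 ≤ F) (hF : F ≤ M) (hk : 0 ≤ k) (hl : 0 ≤ l)
    (ha : 0 < a) (hb : 0 < b) (hu : 0 < u) (hv : 0 < v) (huv : u + v < 1) :
    k * (l * F) ≤ M ^ (1 - (u + v)) *
      ((k ^ (1 / (1 - v)) * a ^ (1 - 1 / (1 - v))) * (b * F) +
        (l ^ (1 / (1 - u)) * b ^ (1 - 1 / (1 - u))) * (a * F) +
        (k ^ (1 / (1 - v)) * a ^ (1 - 1 / (1 - v))) *
          (l ^ (1 / (1 - u)) * b ^ (1 - 1 / (1 - u)))) := by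
  set A := k ^ (1 / (1 - v)) * a ^ (1 - 1 / (1 - v)) with hA
  set B := l ^ (1 / (1 - u)) * b ^ (1 - 1 / (1 - u)) with hB
  have hA0 : 0 ≤ A := by positivity
  have hB0 : 0 ≤ B := by positivity
  have hM0 : 0 ≤ M := hF0.trans hF
  have hkA : A ^ (1 - v) * a ^ v = k := rpow_scaled hk ha (by linarith)
  have hlB : B ^ (1 - u) * b ^ u = l := rpow_scaled hl hb (by linarith)
  set w := 1 - (u + v) with hw
  have hw0 : 0 < w := by linarith
  have eA : A ^ (1 - v) = A ^ u * A ^ w := by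
    rw [← Real.rpow_add_of_nonneg hA0 hu.le hw0.le]; congr 1; ring
  have eB : B ^ (1 - u) = B ^ v * B ^ w := by
    rw [← Real.rpow_add_of_nonneg hB0 hv.le hw0.le]; congr 1; ring
  calc k * (l * F) ≤ k * (l * (M ^ w * F ^ (u + v))) := by
        gcongr
        exact le_rpow_mul_rpow hF0 hF huv.le
    _ = M ^ w * ((A * (b * F)) ^ u * (B * (a * F)) ^ v * (A * B) ^ w) := by
        rw [Real.mul_rpow hA0 (by positivity), Real.mul_rpow hb.le hF0,
          Real.mul_rpow hB0 (by positivity), Real.mul_rpow ha.le hF0, Real.mul_rpow hA0 hB0,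
          Real.rpow_add_of_nonneg hF0 hu.le hv.le]
        nth_rewrite 1 [← hkA]
        nth_rewrite 1 [← hlB]
        rw [eA, eB]; ring
    _ ≤ M ^ w * (u * (A * (b * F)) + v * (B * (a * F)) + w * (A * B)) := by
        refine mul_le_mul_of_nonneg_left ?_ (by positivity)
        exact Real.geom_mean_le_arith_mean3_weighted hu.le hv.le hw0.le (by positivity)
          (by positivity) (by positivity) (by rw [hw]; ring)
    _ ≤ _ := by
        refine mul_le_mul_of_nonneg_left ?_ (by positivity)
        have h1 : 0 ≤ A * (b * F) := by positivity
        have h2 : 0 ≤ B * (a * F) := by positivity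
        have h3 : 0 ≤ A * B := by positivity
        nlinarith

lemma two_pi_inv_le_one : (2 * Real.pi)⁻¹ ≤ 1 :=
  inv_le_one_of_one_le₀ (by linarith [Real.pi_gt_three])

namespace GoodKernel

variable {v C a : ℝ} {K : ℝ → ℂ} {W : ℝ → ℝ}

lemma integral_scaled_le (h : GoodKernel v C a K W) :
    ∫ t, ‖K t‖ ^ (1 / (1 - v)) * a ^ (1 - 1 / (1 - v)) ∂circMeasure ≤ C := by
  have ha := h.pos
  rw [integral_mul_const]
  calc _ ≤ C * a ^ (1 / (1 - v) - 1) * a ^ (1 - 1 / (1 - v)) := by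
        gcongr; exact h.integral_rpow_le
    _ = C := by
        rw [mul_assoc, ← Real.rpow_add ha]; simp

lemma continuous_scaled (h : GoodKernel v C a K W) (hv : v < 1) :
    Continuous fun t => ‖K t‖ ^ (1 / (1 - v)) * a ^ (1 - 1 / (1 - v)) := by
  refine Continuous.mul (h.continuous.norm.rpow_const fun _ => Or.inr ?_) continuous_const
  have : 0 < 1 - v := by linarith
  positivity

lemma norm_circConv_le (h : GoodKernel v C a K W) (hv0 : 0 < v) (hv : v < 1) {φ : ℝ → ℂ}
    (hφ : Continuous φ) {M V : ℝ} (hM : ∀ x, ‖φ x‖ ≤ M) (hV : 0 ≤ V) (x : ℝ)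
    (hint : ∫ t, ‖φ (x + t)‖ ∂circMeasure ≤ V / a) :
    ‖circConv K φ x‖ ≤ M ^ (1 - v) * (V + C) := by
  have ha := h.pos
  have hM0 : 0 ≤ M := (norm_nonneg _).trans (hM 0)
  have hKc := h.continuous
  have hA := h.continuous_scaled hv
  have hC := h.one_le
  have hI : ∫ t, ‖K t‖ * ‖φ (x + t)‖ ∂circMeasure ≤ M ^ (1 - v) * (V + C) := by
    calc _ ≤ ∫ t, M ^ (1 - v) * (v * (a * ‖φ (x + t)‖) +
          (1 - v) * (‖K t‖ ^ (1 / (1 - v)) * a ^ (1 - 1 / (1 - v)))) ∂circMeasure :=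
          integral_circMeasure_mono (by fun_prop) (by fun_prop) fun t _ =>
            mul_le_young_one (norm_nonneg _) (hM _) (norm_nonneg _) ha hv0 hv
      _ = M ^ (1 - v) * (v * (a * ∫ t, ‖φ (x + t)‖ ∂circMeasure) +
          (1 - v) * ∫ t, ‖K t‖ ^ (1 / (1 - v)) * a ^ (1 - 1 / (1 - v)) ∂circMeasure) := by
          rw [integral_const_mul, integral_add (Continuous.integrable_circMeasure (by fun_prop))
            (Continuous.integrable_circMeasure (by fun_prop)), integral_const_mul,
            integral_const_mul, integral_const_mul]
      _ ≤ M ^ (1 - v) * (v * (a * (V / a)) + (1 - v) * C) := by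
          have : 0 < 1 - v := by linarith
          gcongr
          exact h.integral_scaled_le
      _ ≤ _ := by
          rw [mul_div_cancel₀ _ ha.ne']
          gcongr <;> nlinarith
  refine (_root_.norm_circConv_le K φ x).trans (le_trans ?_ hI)
  exact mul_le_of_le_one_left (integral_nonneg fun t => by positivity) two_pi_inv_le_one

lemma norm_circConv_circConv_two_le (hK : GoodKernel v C a K W) {u b : ℝ} {H : ℝ → ℂ} {U : ℝ → ℝ}
    (hH : GoodKernel u C b H U) (hu : 0 < u) (hv : 0 < v) (huv : u + v < 1) {g : ℝ → ℝ → ℂ}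
    (hg : Continuous fun p : ℝ × ℝ => g p.1 p.2) {M V : ℝ} (hM : ∀ x y, ‖g x y‖ ≤ M)
    (hV : 0 ≤ V) (x y : ℝ) (h1 : ∀ t, ∫ s, ‖g (x + s) t‖ ∂circMeasure ≤ V / a)
    (h2 : ∀ s, ∫ t, ‖g s (y + t)‖ ∂circMeasure ≤ V / b) :
    ‖circConv K (fun s => circConv H (g s) y) x‖ ≤ M ^ (1 - (u + v)) * (C * V + C * V + C * C) := by
  have ha := hK.pos
  have hb := hH.pos
  have hC : 0 ≤ C := zero_le_one.trans hK.one_le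
  have hM0 : 0 ≤ M := (norm_nonneg _).trans (hM 0 0)
  have hKc := hK.continuous
  have hHc := hH.continuous
  have hAc := hK.continuous_scaled (by linarith)
  have hBc := hH.continuous_scaled (by linarith)
  set A : ℝ → ℝ := fun s => ‖K s‖ ^ (1 / (1 - v)) * a ^ (1 - 1 / (1 - v)) with hA
  set B : ℝ → ℝ := fun t => ‖H t‖ ^ (1 / (1 - u)) * b ^ (1 - 1 / (1 - u)) with hB
  have hA0 : ∀ s, 0 ≤ A s := fun s => by rw [hA]; positivity
  have hB0 : ∀ s, 0 ≤ B s := fun s => by rw [hB]; positivity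
  have hAI : ∫ s, A s ∂circMeasure ≤ C := hK.integral_scaled_le
  have hBI : ∫ s, B s ∂circMeasure ≤ C := hH.integral_scaled_le
  set F : ℝ → ℝ → ℝ := fun s t => ‖g (x + s) (y + t)‖ with hF
  have hFc : Continuous fun p : ℝ × ℝ => F p.1 p.2 :=
    (hg.comp_args (by fun_prop : Continuous fun p : ℝ × ℝ => x + p.1) (by fun_prop)).norm
  have hFr : ∀ s, Continuous (F s) := fun s => hFc.comp_args continuous_const continuous_id
  have hFl : ∀ t, Continuous fun s => F s t := fun t => hFc.comp_args continuous_id continuous_const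
  have hfst : ∀ {φ : ℝ → ℝ}, Continuous φ → Continuous fun p : ℝ × ℝ => φ p.1 :=
    fun h => h.comp continuous_fst
  have hsnd : ∀ {φ : ℝ → ℝ}, Continuous φ → Continuous fun p : ℝ × ℝ => φ p.2 :=
    fun h => h.comp continuous_snd
  have c1 : Continuous fun p : ℝ × ℝ => A p.1 * (b * F p.1 p.2) :=
    (hfst hAc).mul (continuous_const.mul hFc)
  have c2 : Continuous fun p : ℝ × ℝ => B p.2 * (a * F p.1 p.2) :=
    (hsnd hBc).mul (continuous_const.mul hFc)
  have c3 : Continuous fun p : ℝ × ℝ => A p.1 * B p.2 := (hfst hAc).mul (hsnd hBc)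
  have i1 : ∫ s, ∫ t, A s * (b * F s t) ∂circMeasure ∂circMeasure ≤ C * V := by
    calc _ ≤ ∫ s, A s * V ∂circMeasure := by
          refine integral_circMeasure_mono (continuous_integral_circMeasure c1)
            (hAc.mul continuous_const) fun s _ => ?_
          rw [integral_const_mul, integral_const_mul]
          have := (le_div_iff₀' hb).1 (h2 (x + s))
          exact mul_le_mul_of_nonneg_left this (hA0 s)
      _ ≤ C * V := by rw [integral_mul_const]; gcongr
  have i2 : ∫ s, ∫ t, B t * (a * F s t) ∂circMeasure ∂circMeasure ≤ C * V := by
    rw [integral_circMeasure_comm c2]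
    calc _ ≤ ∫ t, B t * V ∂circMeasure := by
          refine integral_circMeasure_mono (continuous_integral_circMeasure
            (G := fun t s => B t * (a * F s t)) ((hfst hBc).mul (continuous_const.mul hFc.swap_args)))
            (hBc.mul continuous_const) fun t _ => ?_
          rw [integral_const_mul, integral_const_mul]
          have := (le_div_iff₀' ha).1 (h1 (y + t))
          exact mul_le_mul_of_nonneg_left this (hB0 t)
      _ ≤ C * V := by rw [integral_mul_const]; gcongr
  have i3 : ∫ s, ∫ t, A s * B t ∂circMeasure ∂circMeasure ≤ C * C := by
    simp only [integral_const_mul, integral_mul_const]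
    exact mul_le_mul hAI hBI (integral_nonneg hB0) hC
  have hpt : ∫ s, ∫ t, ‖K s‖ * (‖H t‖ * F s t) ∂circMeasure ∂circMeasure ≤
      M ^ (1 - (u + v)) * (C * V + C * V + C * C) := by
    have c4 : Continuous fun p : ℝ × ℝ => M ^ (1 - (u + v)) *
        (A p.1 * (b * F p.1 p.2) + B p.2 * (a * F p.1 p.2) + A p.1 * B p.2) :=
      continuous_const.mul ((c1.add c2).add c3)
    have c5 : Continuous fun p : ℝ × ℝ => ‖K p.1‖ * (‖H p.2‖ * F p.1 p.2) :=
      (hfst hKc.norm).mul ((hsnd hHc.norm).mul hFc)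
    calc _ ≤ ∫ s, ∫ t, M ^ (1 - (u + v)) *
          (A s * (b * F s t) + B t * (a * F s t) + A s * B t) ∂circMeasure ∂circMeasure := by
          refine integral_circMeasure_mono (continuous_integral_circMeasure c5)
            (continuous_integral_circMeasure c4) fun s _ => ?_
          exact integral_circMeasure_mono (c5.comp (Continuous.prodMk_right s))
            (c4.comp (Continuous.prodMk_right s)) fun t _ =>
            mul_le_young_two (norm_nonneg _) (hM _ _) (norm_nonneg _) (norm_nonneg _) ha hb hu hv huv
      _ = M ^ (1 - (u + v)) * (∫ s, ∫ t, A s * (b * F s t) ∂circMeasure ∂circMeasure +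
          ∫ s, ∫ t, B t * (a * F s t) ∂circMeasure ∂circMeasure +
          ∫ s, ∫ t, A s * B t ∂circMeasure ∂circMeasure) := by
          have e12 : Continuous fun s => ∫ t, A s * (b * F s t) ∂circMeasure +
              ∫ t, B t * (a * F s t) ∂circMeasure :=
            (continuous_integral_circMeasure c1).add (continuous_integral_circMeasure c2)
          rw [← integral_add (continuous_integral_circMeasure c1).integrable_circMeasure
            (continuous_integral_circMeasure c2).integrable_circMeasure,
            ← integral_add e12.integrable_circMeasure
            (continuous_integral_circMeasure c3).integrable_circMeasure, ← integral_const_mul]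
          congr 1
          funext s
          have d1 : Continuous fun t => A s * (b * F s t) := c1.comp (Continuous.prodMk_right s)
          have d2 : Continuous fun t => B t * (a * F s t) := c2.comp (Continuous.prodMk_right s)
          have d3 : Continuous fun t => A s * B t := c3.comp (Continuous.prodMk_right s)
          have d12 : Continuous fun t => A s * (b * F s t) + B t * (a * F s t) := d1.add d2
          rw [integral_const_mul, integral_add d12.integrable_circMeasure
            d3.integrable_circMeasure, integral_add d1.integrable_circMeasure
            d2.integrable_circMeasure]
      _ ≤ _ := by gcongr
  refine le_trans ?_ hpt
  have hcs : Continuous fun s => circConv H (g s) y :=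
    (continuous_circConv_snd hHc hg).comp (Continuous.prodMk_left y)
  refine (_root_.norm_circConv_le K _ x).trans ?_
  refine (mul_le_of_le_one_left (integral_nonneg fun t => by positivity) two_pi_inv_le_one).trans ?_
  refine integral_circMeasure_mono (hKc.norm.mul
    (hcs.comp (by fun_prop : Continuous fun s => x + s)).norm) (continuous_integral_circMeasure
    (G := fun s t => ‖K s‖ * (‖H t‖ * F s t)) ((hfst hKc.norm).mul ((hsnd hHc.norm).mul hFc)))
    fun s _ => ?_
  rw [integral_const_mul]
  refine mul_le_mul_of_nonneg_left ?_ (norm_nonneg _)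
  refine (_root_.norm_circConv_le H _ y).trans ?_
  exact mul_le_of_le_one_left (integral_nonneg fun t => by positivity) two_pi_inv_le_one

/-- One-variable means are bounded on functions whose sections are Lipschitz in mean. -/
lemma norm_circConv_fst_le (hK : GoodKernel v C a K W) (hv0 : 0 < v) (hv : v < 1) {M V : ℝ}
    {g : ℝ → ℝ → ℂ} (hg : VarClass M V g) (x y : ℝ) :
    ‖circConv K (fun s => g s y) x‖ ≤ (2 * M) ^ (1 - v) * (V * C + C) + C * M := by
  have hm := hK.mollifier
  have hc := hg.continuous_left y
  have hWc := hm.varClass_circConv_fst hg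
  have hWcy := hWc.continuous_left y
  have hs := hg.sub hWc
  have hC := hK.one_le
  have e : circConv K (fun s => g s y) x =
      circConv K (fun s => g s y - circConv (fun t => (W t : ℂ)) (fun s => g s y) s) x +
      circConv K (circConv (fun t => (W t : ℂ)) (fun s => g s y)) x := by
    rw [circConv_sub hK.continuous hc hWcy]; ring
  rw [e]
  refine (norm_add_le _ _).trans (add_le_add ?_ ?_)
  · refine hK.norm_circConv_le (φ := fun s => g s y - circConv (fun t => (W t : ℂ))
      (fun s => g s y) s) hv0 hv (hc.sub hWcy) (fun s => ?_)
      (mul_nonneg hg.var_nonneg (by linarith)) x ?_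
    · rw [two_mul]; exact hs.norm_le s y
    · have hp : Function.Periodic
          (fun s => ‖g s y - circConv (fun t => (W t : ℂ)) (fun s => g s y) s‖) (2 * Real.pi) :=
        fun s => congrArg norm (hs.periodic_fst y s)
      rw [integral_circMeasure_shift hp x, mul_div_assoc]
      exact hm.integral_norm_sub_circConv_le hg y
  · exact hK.norm_circConv_circConv_le hc (hg.periodic_fst y) (fun s => hg.norm_le s y) x

end GoodKernel

/-- The quantity that controls double means of functions in `VarClass M V`. -/
noncomputable def doubleBound (u v C V M : ℝ) : ℝ :=
  C * ((2 * M) ^ (1 - v) * (V * C + C) + C * M) +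
    (C * ((2 * M) ^ (1 - u) * (V * C + C)) +
      (4 * M) ^ (1 - (u + v)) * (C * (2 * V * C) + C * (2 * V * C) + C * C))

lemma norm_circConv_circConv_le_doubleBound {u v C a b : ℝ} {K H : ℝ → ℂ} {W U : ℝ → ℝ}
    (hK : GoodKernel v C a K W) (hH : GoodKernel u C b H U) (hu : 0 < u) (hv : 0 < v)
    (huv : u + v < 1) {M V : ℝ} {g : ℝ → ℝ → ℂ} (hg : VarClass M V g) (x y : ℝ) :
    ‖circConv K (fun s => circConv H (g s) y) x‖ ≤ doubleBound u v C V M := by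
  have hKc := hK.continuous
  have hHc := hH.continuous
  have hW := hK.mollifier
  have hU := hH.mollifier
  have hC := hK.one_le
  have hV := hg.var_nonneg
  have ha := hK.pos
  have hb := hH.pos
  have hUg := hU.varClass_circConv_snd hg
  have hψ := hg.sub hUg
  set Ug : ℝ → ℝ → ℂ := fun x y => circConv (fun t => (U t : ℂ)) (g x) y with hUgd
  set ψ : ℝ → ℝ → ℂ := fun x y => g x y - Ug x y with hψd
  have hWψ := hW.varClass_circConv_fst hψ
  have hχ := hψ.sub hWψ
  set Wψ : ℝ → ℝ → ℂ := fun x y => circConv (fun t => (W t : ℂ)) (fun s => ψ s y) x with hWψd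
  set χ : ℝ → ℝ → ℂ := fun x y => ψ x y - Wψ x y with hχd
  have hcH : ∀ {G : ℝ → ℝ → ℂ}, (Continuous fun p : ℝ × ℝ => G p.1 p.2) →
      Continuous fun s => circConv H (G s) y := fun hG =>
    (continuous_circConv_snd hHc hG).comp (Continuous.prodMk_left y)
  have hψint : ∀ s, ∫ t, ‖ψ s t‖ ∂circMeasure ≤ V * C / b := fun s => by
    rw [mul_div_assoc]
    exact hU.integral_norm_sub_circConv_le hg.swap s
  have split : circConv K (fun s => circConv H (g s) y) x =
      circConv K (fun s => circConv H (Ug s) y) x +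
      (circConv K (fun s => circConv H (Wψ s) y) x +
        circConv K (fun s => circConv H (χ s) y) x) := by
    have e1 : Continuous fun s => circConv H (Wψ s) y + circConv H (χ s) y :=
      (hcH hWψ.continuous).add (hcH hχ.continuous)
    rw [← circConv_add hKc (hcH hWψ.continuous) (hcH hχ.continuous),
      ← circConv_add hKc (hcH hUg.continuous) e1]
    congr 1
    funext s
    have e2 : Continuous fun t => Wψ s t + χ s t :=
      (hWψ.continuous_right s).add (hχ.continuous_right s)
    rw [← circConv_add hHc (hWψ.continuous_right s) (hχ.continuous_right s),
      ← circConv_add hHc (hUg.continuous_right s) e2]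
    congr 1
    funext t
    simp only [hχd, hψd]; ring
  rw [split]
  refine (norm_add_le _ _).trans (add_le_add ?_ ((norm_add_le _ _).trans (add_le_add ?_ ?_)))
  · have e : circConv K (fun s => circConv H (Ug s) y) x =
        circConv H (circConv (fun t => (U t : ℂ)) fun t => circConv K (fun s => g s t) x) y := by
      rw [circConv_swap hKc hHc hUg.continuous]
      congr 1
      funext t
      exact circConv_swap hKc hU.continuous_ofReal hg.continuous x t
    rw [e]
    refine hH.norm_circConv_circConv_le ?_ ?_ (fun t => ?_) y
    · exact (continuous_circConv_fst hKc hg.continuous).comp (Continuous.prodMk_right x)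
    · intro t
      simp only [hg.periodic_snd _ t]
    · exact hK.norm_circConv_fst_le hv (by linarith) hg x t
  · have e : circConv K (fun s => circConv H (Wψ s) y) x =
        circConv K (circConv (fun t => (W t : ℂ)) fun s => circConv H (ψ s) y) x := by
      congr 1
      funext s
      exact (circConv_swap hW.continuous_ofReal hHc hψ.continuous s y).symm
    rw [e]
    refine hK.norm_circConv_circConv_le (hcH hψ.continuous) ?_ (fun s => ?_) x
    · intro s
      have : ψ (s + 2 * Real.pi) = ψ s := funext fun t => hψ.periodic_fst t s
      simp only [this]
    · refine hH.norm_circConv_le hu (by linarith) (hψ.continuous_right s)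
        (fun t => (hψ.norm_le s t).trans_eq (two_mul M).symm)
        (mul_nonneg hV (by linarith)) y ?_
      rw [integral_circMeasure_shift (φ := fun t => ‖ψ s t‖)
        fun t => congrArg norm (hψ.periodic_snd s t)]
      exact hψint s
  · refine hK.norm_circConv_circConv_two_le hH hu hv huv hχ.continuous
      (fun s t => (hχ.norm_le s t).trans_eq (by ring)) (by nlinarith [mul_nonneg hV (zero_le_one.trans hC)]) x y
      (fun t => ?_) fun s => ?_
    · rw [integral_circMeasure_shift (φ := fun s => ‖χ s t‖)
        fun s => congrArg norm (hχ.periodic_fst t s)]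
      refine (hW.integral_norm_sub_circConv_le hψ t).trans_eq (by ring)
    · rw [integral_circMeasure_shift (φ := fun t => ‖χ s t‖)
        fun t => congrArg norm (hχ.periodic_snd s t)]
      have c1 := hψ.continuous_right s
      have c2 := hWψ.continuous_right s
      have h2 : ∫ t, ‖Wψ s t‖ ∂circMeasure ≤ V * C / b :=
        hW.integral_norm_circConv_le (D := fun t r => ψ r t) hψ.continuous.swap_args
          fun r => hψint (s + r)
      calc ∫ t, ‖χ s t‖ ∂circMeasure ≤ ∫ t, (‖ψ s t‖ + ‖Wψ s t‖) ∂circMeasure :=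
            integral_circMeasure_mono (hχ.continuous_right s).norm (by fun_prop) fun t _ =>
              norm_sub_le _ _
        _ = ∫ t, ‖ψ s t‖ ∂circMeasure + ∫ t, ‖Wψ s t‖ ∂circMeasure :=
            integral_add c1.norm.integrable_circMeasure c2.norm.integrable_circMeasure
        _ ≤ V * C / b + V * C / b := add_le_add (hψint s) h2
        _ = _ := by ring

lemma tendsto_doubleBound {u v : ℝ} (hu : 0 < u) (hv : 0 < v) (huv : u + v < 1) (C V : ℝ) :
    Tendsto (doubleBound u v C V) (nhds 0) (nhds 0) := by
  have h : ∀ {c r : ℝ}, 0 < r → ContinuousAt (fun M : ℝ => (c * M) ^ r) 0 := fun hr =>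
    (Real.continuousAt_rpow_const _ _ (Or.inr hr.le)).comp (by fun_prop)
  have h1 := h (c := 2) (r := 1 - v) (by linarith)
  have h2 := h (c := 2) (r := 1 - u) (by linarith)
  have h3 := h (c := 4) (r := 1 - (u + v)) (by linarith)
  have hc : ContinuousAt (doubleBound u v C V) 0 := by
    unfold doubleBound
    fun_prop
  have h0 : doubleBound u v C V 0 = 0 := by
    unfold doubleBound
    simp only [mul_zero]
    rw [Real.zero_rpow (show 1 - v ≠ 0 by linarith), Real.zero_rpow (show 1 - u ≠ 0 by linarith),
      Real.zero_rpow (show 1 - (u + v) ≠ 0 by linarith)]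
    ring
  simpa [ContinuousAt, h0] using hc

lemma GoodKernel.mono {v C C' a : ℝ} {K : ℝ → ℂ} {W : ℝ → ℝ} (h : GoodKernel v C a K W)
    (hC : C ≤ C') : GoodKernel v C' a K W where
  pos := h.pos
  one_le := h.one_le.trans hC
  continuous := h.continuous
  mollifier := h.mollifier.mono (div_le_div_of_nonneg_right hC h.pos.le)
  norm_circConv_circConv_le hφ hp _ hM x :=
    (h.norm_circConv_circConv_le hφ hp hM x).trans
      (mul_le_mul_of_nonneg_right hC ((norm_nonneg _).trans (hM 0)))
  integral_rpow_le := h.integral_rpow_le.trans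
    (mul_le_mul_of_nonneg_right hC (Real.rpow_nonneg h.pos.le _))

lemma eVariationOn_le_of_nonoverlapIcc {φ : ℝ → ℝ} {V : ℝ≥0∞}
    (h : ∀ (n : ℕ) (I : Fin n → ℝ × ℝ), NonoverlapIcc n I →
      ENNReal.ofReal (∑ i, |φ (I i).2 - φ (I i).1|) ≤ V) :
    eVariationOn φ (Icc 0 (2 * Real.pi)) ≤ V := by
  rw [eVariationOn.eVariationOn_eq_strictMonoOn]
  refine iSup_le ?_
  rintro ⟨n, u, hu, hus⟩
  have hmem : ∀ {i : ℕ}, i ≤ n → u i ∈ Icc 0 (2 * Real.pi) := fun hi => hus _ (mem_Iic.2 hi)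
  have hle : ∀ {i j : ℕ}, i ≤ j → j ≤ n → u i ≤ u j := fun hij hj =>
    hu.monotoneOn (mem_Iic.2 (hij.trans hj)) (mem_Iic.2 hj) hij
  have hI : NonoverlapIcc n fun i : Fin n => (u i, u (i + 1)) := by
    refine ⟨fun i => ⟨(hmem i.2.le).1, hu (mem_Iic.2 i.2.le) (mem_Iic.2 i.2) (Nat.lt_succ_self _),
      (hmem i.2).2⟩, fun i j hij => ?_⟩
    rcases lt_or_gt_of_ne hij with hlt | hlt
    · exact Or.inl (hle (Nat.succ_le_of_lt hlt) j.2.le)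
    · exact Or.inr (hle (Nat.succ_le_of_lt hlt) i.2.le)
  refine le_trans (le_of_eq ?_) (h n _ hI)
  rw [ENNReal.ofReal_sum_of_nonneg fun i _ => abs_nonneg _, Finset.sum_range]
  refine Finset.sum_congr rfl fun i _ => ?_
  rw [edist_dist, Real.dist_eq]

lemma eVariationOn_four_pi_le {φ : ℝ → ℝ} (hp : Function.Periodic φ (2 * Real.pi)) {V : ℝ≥0∞}
    (h : eVariationOn φ (Icc 0 (2 * Real.pi)) ≤ V) :
    eVariationOn φ (Icc 0 (4 * Real.pi)) ≤ V + V := by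
  have hpi := Real.pi_pos
  have e : eVariationOn φ (Icc (2 * Real.pi) (4 * Real.pi)) =
      eVariationOn φ (Icc 0 (2 * Real.pi)) := by
    have := eVariationOn.comp_eq_of_monotoneOn φ (t := Icc 0 (2 * Real.pi))
      (fun x => x + 2 * Real.pi) fun a _ b _ hab => by simpa using hab
    rw [image_add_const_Icc, show φ ∘ (fun x => x + 2 * Real.pi) = φ from funext hp,
      show (0 : ℝ) + 2 * Real.pi = 2 * Real.pi by ring,
      show 2 * Real.pi + 2 * Real.pi = 4 * Real.pi by ring] at this
    exact this.symm
  have := eVariationOn.Icc_add_Icc φ (s := univ) (show (0 : ℝ) ≤ 2 * Real.pi by linarith)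
    (show 2 * Real.pi ≤ 4 * Real.pi by linarith) (mem_univ _)
  simp only [univ_inter] at this
  rw [← this, e]
  exact add_le_add h h

lemma integral_abs_sub_le_of_eVariationOn {φ : ℝ → ℝ} (hc : Continuous φ) {V : ℝ} (hV : 0 ≤ V)
    (hvar : eVariationOn φ (Icc 0 (4 * Real.pi)) ≤ ENNReal.ofReal V) {h : ℝ} (h0 : 0 ≤ h)
    (hpi : h ≤ Real.pi) :
    ∫ s in (0 : ℝ)..(2 * Real.pi), |φ (s + h) - φ s| ≤ V * h := by
  have hpos := Real.pi_pos
  set S : Set ℝ := Icc 0 (4 * Real.pi) with hS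
  set p : ℝ → ℝ := fun x => (eVariationOn φ (S ∩ Iic x)).toReal with hp
  have hle : ∀ x, eVariationOn φ (S ∩ Iic x) ≤ ENNReal.ofReal V := fun x =>
    (eVariationOn.mono φ inter_subset_left).trans hvar
  have hfin : ∀ x, eVariationOn φ (S ∩ Iic x) ≠ ⊤ := fun x =>
    ((hle x).trans_lt ENNReal.ofReal_lt_top).ne
  have hmono : Monotone p := fun x y hxy => ENNReal.toReal_mono (hfin y)
    (eVariationOn.mono φ (inter_subset_inter_right _ (Iic_subset_Iic.2 hxy)))
  have hp0 : ∀ x, 0 ≤ p x := fun x => ENNReal.toReal_nonneg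
  have hpV : ∀ x, p x ≤ V := fun x => ENNReal.toReal_le_of_le_ofReal hV (hle x)
  have hstep : ∀ a ∈ S, ∀ b ∈ S, a ≤ b → |φ b - φ a| ≤ p b - p a := by
    intro a ha b hb hab
    have h1 : eVariationOn φ (S ∩ Iic a) + edist (φ b) (φ a) ≤ eVariationOn φ (S ∩ Iic b) := by
      calc _ ≤ eVariationOn φ (S ∩ Iic a) + eVariationOn φ (Icc a b) := by
            gcongr
            exact eVariationOn.edist_le φ (right_mem_Icc.2 hab) (left_mem_Icc.2 hab)
        _ ≤ eVariationOn φ (S ∩ Iic a ∪ Icc a b) :=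
            eVariationOn.add_le_union φ fun x hx y hy => hx.2.trans hy.1
        _ ≤ _ := by
            refine eVariationOn.mono φ (union_subset
              (inter_subset_inter_right _ (Iic_subset_Iic.2 hab)) fun x hx => ?_)
            exact ⟨⟨ha.1.trans hx.1, hx.2.trans hb.2⟩, hx.2⟩
    have h2 := ENNReal.toReal_mono (hfin b) h1
    rw [ENNReal.toReal_add (hfin a) (edist_ne_top _ _), edist_dist,
      ENNReal.toReal_ofReal dist_nonneg, Real.dist_eq] at h2
    simp only [hp]
    linarith
  have hi : ∀ a b, IntervalIntegrable p volume a b := fun a b => hmono.intervalIntegrable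
  have hi' : IntervalIntegrable (fun s => p (s + h)) volume 0 (2 * Real.pi) :=
    Monotone.intervalIntegrable fun x y hxy => hmono (by linarith)
  have hconst : ∀ a : ℝ, ∫ _ in a..(a + h), V = V * h := fun a => by simp; ring
  calc ∫ s in (0 : ℝ)..(2 * Real.pi), |φ (s + h) - φ s|
      ≤ ∫ s in (0 : ℝ)..(2 * Real.pi), (p (s + h) - p s) := by
        refine intervalIntegral.integral_mono_on (by linarith)
          (Continuous.intervalIntegrable (by fun_prop) _ _) (hi'.sub (hi _ _)) fun s hs => ?_
        exact hstep s ⟨hs.1, by linarith [hs.2]⟩ (s + h) ⟨by linarith [hs.1], by linarith [hs.2]⟩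
          (by linarith)
    _ = (∫ s in (2 * Real.pi)..(2 * Real.pi + h), p s) - ∫ s in (0 : ℝ)..h, p s := by
        rw [intervalIntegral.integral_sub hi' (hi _ _),
          intervalIntegral.integral_comp_add_right (fun s => p s) h, zero_add]
        have e1 := intervalIntegral.integral_add_adjacent_intervals (hi 0 h) (hi h (2 * Real.pi + h))
        have e2 := intervalIntegral.integral_add_adjacent_intervals (hi 0 (2 * Real.pi))
          (hi (2 * Real.pi) (2 * Real.pi + h))
        linarith
    _ ≤ ∫ s in (2 * Real.pi)..(2 * Real.pi + h), p s := by
        have : 0 ≤ ∫ s in (0 : ℝ)..h, p s :=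
          intervalIntegral.integral_nonneg h0 fun s _ => hp0 s
        linarith
    _ ≤ ∫ _ in (2 * Real.pi)..(2 * Real.pi + h), V :=
        intervalIntegral.integral_mono_on (by linarith) (hi _ _) (by simp) fun s _ => hpV s
    _ = V * h := hconst _

/-- A continuous periodic function of bounded variation is Lipschitz in mean. -/
lemma integral_circMeasure_abs_sub_le {φ : ℝ → ℝ} (hc : Continuous φ)
    (hp : Function.Periodic φ (2 * Real.pi)) {V : ℝ} (hV : 0 ≤ V)
    (hvar : eVariationOn φ (Icc 0 (2 * Real.pi)) ≤ ENNReal.ofReal V) {h : ℝ}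
    (hh : |h| ≤ Real.pi) :
    ∫ s, |φ (s + h) - φ s| ∂circMeasure ≤ 2 * V * |h| := by
  have hvar' : eVariationOn φ (Icc 0 (4 * Real.pi)) ≤ ENNReal.ofReal (2 * V) := by
    rw [two_mul, ENNReal.ofReal_add hV hV]
    exact eVariationOn_four_pi_le hp hvar
  have hper : ∀ r : ℝ, Function.Periodic (fun s => |φ (s + r) - φ s|) (2 * Real.pi) := by
    intro r s
    simp only [add_right_comm s (2 * Real.pi) r, hp (s + r), hp s]
  rcases le_total 0 h with h0 | h0
  · rw [abs_of_nonneg h0] at hh ⊢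
    rw [integral_circMeasure_eq_zero_two_pi (hper h)]
    exact integral_abs_sub_le_of_eVariationOn hc (by linarith) hvar' h0 hh
  · rw [abs_of_nonpos h0] at hh ⊢
    have e : ∀ s, |φ (s + h) - φ s| = |φ ((h + s) + -h) - φ (h + s)| := fun s => by
      rw [abs_sub_comm]; congr 3 <;> ring
    simp only [e]
    rw [integral_circMeasure_shift (hper (-h)) h, integral_circMeasure_eq_zero_two_pi (hper (-h))]
    exact integral_abs_sub_le_of_eVariationOn hc (by linarith) hvar' (by linarith) hh

lemma exists_mem_Icc_periodic_eq {E : Type*} {φ : ℝ → E}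
    (hp : Function.Periodic φ (2 * Real.pi)) (y : ℝ) :
    ∃ z ∈ Icc 0 (2 * Real.pi), φ y = φ z := by
  obtain ⟨z, hz, e⟩ := hp.exists_mem_Ico₀ Real.two_pi_pos y
  exact ⟨z, Ico_subset_Icc_self hz, e⟩

lemma integral_norm_sub_le_of_pv {f : ℝ → ℝ → ℝ} (hc : Continuous fun q : ℝ × ℝ => f q.1 q.2)
    (hper : Periodic2 f) {V : ℝ} (hV : 0 ≤ V)
    (h : ∀ y ∈ Icc 0 (2 * Real.pi), ∀ (n : ℕ) (I : Fin n → ℝ × ℝ), NonoverlapIcc n I →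
      ENNReal.ofReal (∑ i, |f (I i).2 y - f (I i).1 y|) ≤ ENNReal.ofReal V)
    (r y : ℝ) (hr : |r| ≤ Real.pi) :
    ∫ s, ‖(f (s + r) y : ℂ) - f s y‖ ∂circMeasure ≤ 2 * V * |r| := by
  obtain ⟨z, hz, e⟩ := exists_mem_Icc_periodic_eq (φ := fun y s => f s y)
    (fun y => funext fun s => (hper s y).2) y
  have e' : ∀ s, f s y = f s z := fun s => congrFun e s
  have en : ∀ s, ‖(f (s + r) y : ℂ) - f s y‖ = |f (s + r) z - f s z| := fun s => by
    rw [← Complex.ofReal_sub, Complex.norm_real, Real.norm_eq_abs, e', e']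
  simp only [en]
  exact integral_circMeasure_abs_sub_le (φ := fun s => f s z)
    (hc.comp_args continuous_id continuous_const) (fun s => (hper s z).1) hV
    (eVariationOn_le_of_nonoverlapIcc (h z hz)) hr

lemma exists_varClass {f : ℝ → ℝ → ℝ} (hc : Continuous fun q : ℝ × ℝ => f q.1 q.2)
    (hper : Periodic2 f) (h1 : PV1pow 1 f ≠ ⊤) (h2 : PV2pow 1 f ≠ ⊤) :
    ∃ M V, VarClass M V fun x y => (f x y : ℂ) := by
  set V := max (PV1pow 1 f).toReal (PV2pow 1 f).toReal with hV
  have hV0 : 0 ≤ V := ENNReal.toReal_nonneg.trans (le_max_left _ _)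
  have hV1 : PV1pow 1 f ≤ ENNReal.ofReal V :=
    (ENNReal.ofReal_toReal h1).symm.le.trans (ENNReal.ofReal_le_ofReal (le_max_left _ _))
  have hV2 : PV2pow 1 f ≤ ENNReal.ofReal V :=
    (ENNReal.ofReal_toReal h2).symm.le.trans (ENNReal.ofReal_le_ofReal (le_max_right _ _))
  obtain ⟨M, hM⟩ := (isCompact_Icc.prod isCompact_Icc :
    IsCompact (Icc (0 : ℝ) (2 * Real.pi) ×ˢ Icc (0 : ℝ) (2 * Real.pi))).exists_bound_of_continuousOn
      hc.continuousOn
  refine ⟨M, 2 * V, ⟨Complex.continuous_ofReal.comp hc, fun y x => ?_, fun x y => ?_,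
    fun x y => ?_, fun r y hr => ?_, fun r x hr => ?_⟩⟩
  · simp only [(hper x y).1]
  · simp only [(hper x y).2]
  · obtain ⟨x', hx', ex⟩ := exists_mem_Icc_periodic_eq (φ := fun x => f x y)
      (fun x => (hper x y).1) x
    obtain ⟨y', hy', ey⟩ := exists_mem_Icc_periodic_eq (φ := fun y => f x' y)
      (fun y => (hper x' y).2) y
    rw [Complex.norm_real]
    rw [ex, ey]
    exact hM (x', y') ⟨hx', hy'⟩
  · refine integral_norm_sub_le_of_pv hc hper hV0 (fun z hz n I hI => ?_) r y hr
    refine le_trans (le_trans ?_ (le_iSup₂_of_le z hz (le_iSup₂_of_le n I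
      (le_iSup_of_le hI le_rfl)))) hV1
    simp
  · refine integral_norm_sub_le_of_pv (f := fun y x => f x y) hc.swap_args
      (fun a b => ⟨(hper b a).2, (hper b a).1⟩) hV0 (fun z hz n I hI => ?_) r x hr
    refine le_trans (le_trans ?_ (le_iSup₂_of_le z hz (le_iSup₂_of_le n I
      (le_iSup_of_le hI le_rfl)))) hV2
    simp

lemma VarClass.of_norm_le {M M' V : ℝ} {g : ℝ → ℝ → ℂ} (h : VarClass M V g)
    (hM : ∀ x y, ‖g x y‖ ≤ M') : VarClass M' V g :=
  { h with norm_le := hM }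

lemma VarClass.exists_norm_sub_le {M V : ℝ} {g : ℝ → ℝ → ℂ} (h : VarClass M V g) {ε : ℝ}
    (hε : 0 < ε) : ∃ D, 0 ≤ D ∧ ∀ x y r, |r| ≤ Real.pi → ‖g (x + r) y - g x y‖ ≤ ε + D * |r| := by
  have hpi := Real.pi_pos
  have hM := h.bound_nonneg
  have hK : IsCompact (Icc (-Real.pi) (3 * Real.pi) ×ˢ Icc (0 : ℝ) (2 * Real.pi)) :=
    isCompact_Icc.prod isCompact_Icc
  have hu := hK.uniformContinuousOn_of_continuous h.continuous.continuousOn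
  obtain ⟨δ, hδ, H⟩ := Metric.uniformContinuousOn_iff.1 hu ε hε
  refine ⟨2 * M / δ, by positivity, fun x y r hr => ?_⟩
  obtain ⟨x', hx', ex⟩ := exists_mem_Icc_periodic_eq (φ := fun x => g (x + r) y - g x y)
    (fun x => by simp only [add_right_comm x (2 * Real.pi) r, h.periodic_fst y _]) x
  obtain ⟨y', hy', ey⟩ := exists_mem_Icc_periodic_eq (φ := fun y => g (x' + r) y - g x' y)
    (fun y => by simp only [h.periodic_snd _ y]) y
  rw [ex, ey]
  obtain ⟨hr1, hr2⟩ := abs_le.1 hr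
  rcases lt_or_ge |r| δ with hlt | hge
  · have hd := H (x' + r, y') ⟨⟨by linarith [hx'.1], by linarith [hx'.2]⟩, hy'⟩ (x', y')
      ⟨⟨by linarith [hx'.1], by linarith [hx'.2]⟩, hy'⟩ (by simpa [Prod.dist_eq] using hlt)
    rw [dist_eq_norm] at hd
    have : 0 ≤ 2 * M / δ * |r| := by positivity
    linarith
  · have h1 : 2 * M ≤ 2 * M / δ * |r| := by
      rw [div_mul_eq_mul_div, le_div_iff₀ hδ]
      gcongr
    have := norm_sub_le (g (x' + r) y') (g x' y')
    linarith [h.norm_le (x' + r) y', h.norm_le x' y']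

lemma IsMollifier.norm_sub_circConv_le_of_modulus {W : ℝ → ℝ} {δ : ℝ} (hW : IsMollifier W δ)
    {φ : ℝ → ℂ} (hφ : Continuous φ) {ε D : ℝ} (hD : 0 ≤ D) {x : ℝ}
    (h : ∀ r, |r| ≤ Real.pi → ‖φ (x + r) - φ x‖ ≤ ε + D * |r|) :
    ‖φ x - circConv (fun t => (W t : ℂ)) φ x‖ ≤ ε + D * δ := by
  have hpi := Real.pi_pos
  have hWc := hW.continuous
  refine (hW.norm_sub_circConv_le hφ x).trans ?_
  calc _ ≤ (2 * Real.pi)⁻¹ * ∫ t, (ε * W t + D * (W t * |t|)) ∂circMeasure := by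
        refine mul_le_mul_of_nonneg_left ?_ (by positivity)
        refine integral_circMeasure_mono (by fun_prop) (by fun_prop) fun t ht => ?_
        have := mul_le_mul_of_nonneg_left (h t ht) (hW.nonneg t)
        linarith
    _ = ε + D * ((2 * Real.pi)⁻¹ * ∫ t, W t * |t| ∂circMeasure) := by
        rw [integral_add (Continuous.integrable_circMeasure (by fun_prop))
          (Continuous.integrable_circMeasure (by fun_prop)), integral_const_mul,
          integral_const_mul, hW.integral_eq]
        field_simp
    _ ≤ _ := by gcongr; exact hW.moment_le

/-- The product Jackson mean of order `N`. -/
noncomputable def jacksonMean (N : ℕ) (g : ℝ → ℝ → ℂ) (x y : ℝ) : ℂ :=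
  circConv (fun t => (jackson N t : ℂ)) (fun s => circConv (fun t => (jackson N t : ℂ)) (g s) y) x

section jacksonMean

variable {M V : ℝ} {g : ℝ → ℝ → ℂ}

lemma VarClass.jacksonMean (h : VarClass M V g) (N : ℕ) : VarClass M V (jacksonMean N g) := by
  obtain ⟨C, -, hW⟩ := exists_isMollifier_jackson
  exact (hW N).varClass_circConv_fst ((hW N).varClass_circConv_snd h)

lemma VarClass.exists_norm_sub_jacksonMean_le (h : VarClass M V g) {η : ℝ} (hη : 0 < η) :
    ∃ N, ∀ x y, ‖g x y - _root_.jacksonMean N g x y‖ ≤ η := by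
  obtain ⟨C, hC, hW⟩ := exists_isMollifier_jackson
  obtain ⟨D, hD, H⟩ := h.exists_norm_sub_le (show 0 < η / 4 by linarith)
  obtain ⟨D', hD', H'⟩ := h.swap.exists_norm_sub_le (show 0 < η / 4 by linarith)
  obtain ⟨N, hN⟩ := exists_nat_gt ((D + D') * C / (η / 2))
  have hN1 : (D + D') * (C / (N + 1)) ≤ η / 2 := by
    rw [div_lt_iff₀ (by linarith)] at hN
    rw [← mul_div_assoc, div_le_iff₀ (by positivity)]
    nlinarith
  refine ⟨N, fun x y => ?_⟩
  have hU := (hW N).varClass_circConv_snd h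
  have c1 := h.continuous_left y
  have c2 := hU.continuous_left y
  have e : g x y - _root_.jacksonMean N g x y =
      (g x y - circConv (fun t => (jackson N t : ℂ)) (fun s => g s y) x) +
      circConv (fun t => (jackson N t : ℂ))
        (fun s => g s y - circConv (fun t => (jackson N t : ℂ)) (g s) y) x := by
    rw [circConv_sub (hW N).continuous_ofReal c1 c2, _root_.jacksonMean]
    ring
  rw [e]
  have b1 := (hW N).norm_sub_circConv_le_of_modulus c1 hD fun r hr => H x y r hr
  have b2 := (hW N).norm_circConv_le (c1.sub c2) (fun s =>
    (hW N).norm_sub_circConv_le_of_modulus (h.continuous_right s) hD' fun r hr => H' y s r hr) x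
  have b3 := norm_add_le (g x y - circConv (fun t => (jackson N t : ℂ)) (fun s => g s y) x)
    (circConv (fun t => (jackson N t : ℂ))
        (fun s => g s y - circConv (fun t => (jackson N t : ℂ)) (g s) y) x)
  refine b3.trans ((add_le_add b1 b2).trans ?_)
  linarith

lemma continuous_circConv_section {K : ℝ → ℂ} (hK : Continuous K)
    (hg : Continuous fun p : ℝ × ℝ => g p.1 p.2) (y : ℝ) :
    Continuous fun s => circConv K (g s) y :=
  (continuous_circConv_snd hK hg).comp (Continuous.prodMk_left y)

lemma VarClass.exists_jacksonMean_section_eq (h : VarClass M V g) (N : ℕ) (x : ℝ) :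
    ∃ a, _root_.jacksonMean N g x = trigSum (2 * N) a := by
  obtain ⟨C, -, hW⟩ := exists_isMollifier_jackson
  have hJ := (hW N).continuous_ofReal
  have hUf := (hW N).varClass_circConv_fst h
  obtain ⟨a, ha⟩ := exists_circConv_jackson_eq N (hUf.continuous_right x) (hUf.periodic_snd x)
  refine ⟨a, ?_⟩
  rw [← ha]
  funext t
  exact circConv_swap hJ hJ h.continuous x t

lemma VarClass.exists_circConv_jacksonMean_eq (h : VarClass M V g) (N : ℕ) {H : ℝ → ℂ}
    (hH : Continuous H) (y : ℝ) :
    ∃ a, (fun s => circConv H (_root_.jacksonMean N g s) y) = trigSum (2 * N) a := by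
  obtain ⟨C, -, hW⟩ := exists_isMollifier_jackson
  have hJ := (hW N).continuous_ofReal
  have hU := (hW N).varClass_circConv_snd h
  have hper : ∀ s, g (s + 2 * Real.pi) = g s := fun s => funext fun t => h.periodic_fst t s
  obtain ⟨a, ha⟩ := exists_circConv_jackson_eq N
    (continuous_circConv_section (g := fun x y => circConv (fun t => (jackson N t : ℂ)) (g x) y)
      hH hU.continuous y) fun s => by simp only [hper s]
  refine ⟨a, ?_⟩
  rw [← ha]
  funext s
  exact (circConv_swap hJ hH hU.continuous s y).symm

/-- Double Cesàro means of a fixed trigonometric polynomial converge uniformly. -/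
lemma VarClass.eventually_norm_cesaroKer_jacksonMean_sub_le (h : VarClass M V g) (N : ℕ)
    {α β : ℝ} (hα : α < 1) (hβ : β < 1) {η : ℝ} (hη : 0 < η) :
    ∀ᶠ nm : ℕ × ℕ in atTop, ∀ x y,
      ‖circConv (cesaroKer (-α) nm.1)
          (fun s => circConv (cesaroKer (-β) nm.2) (_root_.jacksonMean N g s) y) x -
        _root_.jacksonMean N g x y‖ ≤ η := by
  have hM := h.bound_nonneg
  obtain ⟨T, hT, hsec, hmean⟩ : ∃ T : ℝ → ℝ → ℂ, T = _root_.jacksonMean N g ∧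
      (∀ x, ∃ a, T x = trigSum (2 * N) a) ∧
      ∀ {H : ℝ → ℂ}, Continuous H → ∀ y, ∃ a, (fun s => circConv H (T s) y) = trigSum (2 * N) a :=
    ⟨_, rfl, h.exists_jacksonMean_section_eq N, fun hH y => h.exists_circConv_jacksonMean_eq N hH y⟩
  have hTM : ∀ x y, ‖T x y‖ ≤ M := hT ▸ (h.jacksonMean N).norm_le
  rw [← hT]
  obtain ⟨ε, hε, hε1, hεη⟩ : ∃ ε, 0 < ε ∧ ε ≤ 1 ∧ ε * (3 * (M + 1)) ≤ η := by
    refine ⟨min 1 (η / (3 * (M + 1))), by positivity, min_le_left _ _, ?_⟩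
    rw [← le_div_iff₀ (by positivity)]
    exact min_le_right _ _
  rw [← prod_atTop_atTop_eq]
  filter_upwards [(eventually_norm_circConv_trigSum_sub_le hα (2 * N) hε).prod_mk
    (eventually_norm_circConv_trigSum_sub_le hβ (2 * N) hε)] with nm hnm x y
  obtain ⟨h1, h2⟩ := hnm
  have hH : Continuous (cesaroKer (-β) nm.2) := continuous_evenKer _ _
  generalize cesaroKer (-β) nm.2 = H at *
  generalize cesaroKer (-α) nm.1 = K at *
  have B2 : ∀ s, ‖circConv H (T s) y - T s y‖ ≤ ε * M := by
    intro s
    obtain ⟨a, e⟩ := hsec s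
    rw [e]
    exact h2 a M (fun t => e ▸ hTM s t) y
  have B1 : ‖circConv K (fun s => circConv H (T s) y) x - circConv H (T x) y‖ ≤ ε * (2 * M) := by
    obtain ⟨a, e⟩ := hmean hH y
    have e' : ∀ s, circConv H (T s) y = trigSum (2 * N) a s := fun s => congrFun e s
    rw [e, e']
    refine h1 a (2 * M) (fun s => ?_) x
    rw [← e']
    have h3 := norm_sub_norm_le (circConv H (T s) y) (T s y)
    have h4 : ε * M ≤ 1 * M := by gcongr
    linarith [B2 s, hTM s y]
  have := norm_sub_le_norm_sub_add_norm_sub (circConv K (fun s => circConv H (T s) y) x)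
    (circConv H (T x) y) (T x y)
  nlinarith [B2 x]

end jacksonMean

lemma norm_circConv_circConv_sub_le {K H : ℝ → ℂ} {g T : ℝ → ℝ → ℂ} (hK : Continuous K)
    (hH : Continuous H) (hg : Continuous fun p : ℝ × ℝ => g p.1 p.2)
    (hT : Continuous fun p : ℝ × ℝ => T p.1 p.2) (x y : ℝ) :
    ‖circConv K (fun s => circConv H (g s) y) x - g x y‖ ≤
      ‖circConv K (fun s => circConv H (fun t => g s t - T s t) y) x‖ +
      ‖circConv K (fun s => circConv H (T s) y) x - T x y‖ + ‖g x y - T x y‖ := by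
  have e : circConv K (fun s => circConv H (fun t => g s t - T s t) y) x =
      circConv K (fun s => circConv H (g s) y) x - circConv K (fun s => circConv H (T s) y) x := by
    rw [← circConv_sub hK (continuous_circConv_section hH hg y)
      (continuous_circConv_section hH hT y)]
    congr 1
    funext s
    exact circConv_sub hH (hg.comp (Continuous.prodMk_right s))
      (hT.comp (Continuous.prodMk_right s)) y
  rw [e, norm_sub_rev (g x y)]
  have t1 := norm_sub_le_norm_sub_add_norm_sub (circConv K (fun s => circConv H (g s) y) x)
    (circConv K (fun s => circConv H (T s) y) x) (g x y)
  have t2 := norm_sub_le_norm_sub_add_norm_sub (circConv K (fun s => circConv H (T s) y) x)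
    (T x y) (g x y)
  linarith

/-- Uniform convergence of the double Cesàro means, written as convolutions. -/
lemma VarClass.eventually_norm_cesaroKer_sub_le {M V : ℝ} {g : ℝ → ℝ → ℂ} (h : VarClass M V g)
    {α β : ℝ} (hα : 0 < α) (hβ : 0 < β) (hab : α + β < 1) {η : ℝ} (hη : 0 < η) :
    ∀ᶠ nm : ℕ × ℕ in atTop, ∀ x y,
      ‖circConv (cesaroKer (-α) nm.1)
          (fun s => circConv (cesaroKer (-β) nm.2) (g s) y) x - g x y‖ ≤ η := by
  obtain ⟨v, u, hαv, hβu, huv⟩ : ∃ v u, α < v ∧ β < u ∧ u + v < 1 :=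
    ⟨α + (1 - (α + β)) / 4, β + (1 - (α + β)) / 4, by linarith, by linarith, by linarith⟩
  have hu0 : 0 < u := hβ.trans hβu
  have hv0 : 0 < v := hα.trans hαv
  obtain ⟨C₁, G₁⟩ := exists_goodKernel_cesaroKer hα hαv (by linarith)
  obtain ⟨C₂, G₂⟩ := exists_goodKernel_cesaroKer hβ hβu (by linarith)
  obtain ⟨C, hC₁, hC₂⟩ : ∃ C, C₁ ≤ C ∧ C₂ ≤ C := ⟨_, le_max_left _ _, le_max_right _ _⟩
  obtain ⟨ρ, hρ, hb⟩ := Metric.tendsto_nhds_nhds.1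
    (tendsto_doubleBound hu0 hv0 huv C (V + V)) (η / 3) (by linarith)
  obtain ⟨N, hN⟩ := h.exists_norm_sub_jacksonMean_le
    (show 0 < min (ρ / 2) (η / 3) by positivity)
  have hT := h.jacksonMean N
  have E := h.eventually_norm_cesaroKer_jacksonMean_sub_le N (show α < 1 by linarith)
    (show β < 1 by linarith) (show 0 < η / 3 by linarith)
  generalize _root_.jacksonMean N g = T at *
  have hd := (h.sub hT).of_norm_le fun x y => (hN x y).trans (min_le_left _ _)
  have hbd : doubleBound u v C (V + V) (ρ / 2) ≤ η / 3 := by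
    have := hb (x := ρ / 2) (by rw [Real.dist_eq, sub_zero, abs_of_pos (by linarith)]; linarith)
    rw [Real.dist_eq, sub_zero] at this
    exact (le_abs_self _).trans this.le
  have G := G₁.prod_mk G₂
  rw [prod_atTop_atTop_eq] at G
  filter_upwards [E, G] with nm hE hG x y
  obtain ⟨⟨W, hK⟩, ⟨U, hH⟩⟩ := hG
  have B := norm_circConv_circConv_le_doubleBound (hK.mono hC₁) (hH.mono hC₂) hu0 hv0 huv hd x y
  have B3 := (hN x y).trans (min_le_right _ _)
  have := norm_circConv_circConv_sub_le hK.continuous hH.continuous h.continuous hT.continuous x y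
  linarith [hE x y]

lemma sum_range_sum_Icc_eq {E : Type*} [AddCommGroup E] [Module ℂ E] (γ : ℝ) (n : ℕ) (φ : ℤ → E) :
    ∑ i ∈ Finset.range (n + 1), (AA (γ - 1) (n - i) : ℂ) • ∑ p ∈ Finset.Icc (-(i : ℤ)) i, φ p =
      ∑ p ∈ Finset.Icc (-(n : ℤ)) n, (AA γ (n - p.natAbs) : ℂ) • φ p := by
  have h : ∀ i ∈ Finset.range (n + 1),
      (AA (γ - 1) (n - i) : ℂ) • ∑ p ∈ Finset.Icc (-(i : ℤ)) i, φ p =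
        ∑ p ∈ Finset.Icc (-(n : ℤ)) n,
          if p.natAbs ≤ i then (AA (γ - 1) (n - i) : ℂ) • φ p else 0 := by
    intro i hi
    rw [Finset.mem_range] at hi
    rw [Finset.smul_sum, ← Finset.sum_filter]
    refine Finset.sum_congr ?_ fun _ _ => rfl
    ext p
    simp only [Finset.mem_filter, Finset.mem_Icc]
    omega
  rw [Finset.sum_congr rfl h, Finset.sum_comm]
  refine Finset.sum_congr rfl fun p hp => ?_
  rw [Finset.mem_Icc] at hp
  have e : ∀ i, (if p.natAbs ≤ i then (AA (γ - 1) (n - i) : ℂ) • φ p else 0) =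
      (if p.natAbs ≤ i then (AA (γ - 1) (n - i) : ℂ) else 0) • φ p := fun i => by
    split_ifs <;> simp
  simp only [e]
  rw [← Finset.sum_smul]
  congr 1
  rw [← AA_sum, ← Finset.sum_filter, Complex.ofReal_sum]
  refine Finset.sum_nbij' (fun i => n - i) (fun j => n - j) ?_ ?_ ?_ ?_ ?_
  all_goals
    intro i hi
    simp only [Finset.mem_filter, Finset.mem_range] at hi ⊢
    try omega

lemma circConv_evenKer_eq (c : ℕ → ℝ) (n : ℕ) {φ : ℝ → ℂ} (hc : Continuous φ)
    (hp : Function.Periodic φ (2 * Real.pi)) (x : ℝ) :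
    circConv (evenKer c n) φ x = ∑ k ∈ Finset.Icc (-(n : ℤ)) n, (c k.natAbs : ℂ) *
      (((2 * (Real.pi : ℂ))⁻¹ * ∫ t in (0 : ℝ)..(2 * Real.pi),
        Complex.exp (-(Complex.I * (k : ℂ) * (t : ℂ))) * φ t) *
          Complex.exp (Complex.I * (k : ℂ) * (x : ℂ))) := by
  unfold evenKer
  rw [circConv_kernel_sum _ _ (fun k => by fun_prop) hc]
  refine Finset.sum_congr rfl fun k _ => ?_
  rw [circConv_neg_exp hp, integral_circMeasure_eq_zero_two_pi]
  intro t
  simp only [hp t]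
  congr 1
  have := periodic_exp_I_mul_int (-k) t
  simpa [neg_mul, mul_neg] using this

lemma circConv_evenKer_evenKer_eq (c d : ℕ → ℝ) (n m : ℕ) {f : ℝ → ℝ → ℝ}
    (hc : Continuous fun q : ℝ × ℝ => f q.1 q.2) (hper : Periodic2 f) (x y : ℝ) :
    circConv (evenKer c n) (fun s => circConv (evenKer d m) (fun t => (f s t : ℂ)) y) x =
      ∑ p ∈ Finset.Icc (-(n : ℤ)) n, ∑ q ∈ Finset.Icc (-(m : ℤ)) m,
        (c p.natAbs : ℂ) * ((d q.natAbs : ℂ) * (fCoef f p q *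
          Complex.exp (Complex.I * (p : ℂ) * (x : ℂ)) *
          Complex.exp (Complex.I * (q : ℂ) * (y : ℂ)))) := by
  have hfc : Continuous fun q : ℝ × ℝ => (f q.1 q.2 : ℂ) := Complex.continuous_ofReal.comp hc
  have hH : Continuous (evenKer d m) := continuous_evenKer _ _
  have c1 : Continuous fun s => circConv (evenKer d m) (fun t => (f s t : ℂ)) y :=
    (continuous_circConv_snd (g := fun s t => (f s t : ℂ)) hH hfc).comp (Continuous.prodMk_left y)
  rw [circConv_evenKer_eq c n c1 fun s => by simp only [(hper s _).1]]
  refine Finset.sum_congr rfl fun p _ => ?_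
  have hG : ∀ q : ℤ, Continuous fun s : ℝ => ∫ t in (0 : ℝ)..(2 * Real.pi),
      Complex.exp (-(Complex.I * (q : ℂ) * (t : ℂ))) * (f s t : ℂ) := fun q =>
    intervalIntegral.continuous_parametric_intervalIntegral_of_continuous' (by fun_prop) _ _
  have e : ∀ s, circConv (evenKer d m) (fun t => (f s t : ℂ)) y =
      ∑ q ∈ Finset.Icc (-(m : ℤ)) m, (d q.natAbs : ℂ) *
      (((2 * (Real.pi : ℂ))⁻¹ * ∫ t in (0 : ℝ)..(2 * Real.pi),
        Complex.exp (-(Complex.I * (q : ℂ) * (t : ℂ))) * (f s t : ℂ)) *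
          Complex.exp (Complex.I * (q : ℂ) * (y : ℂ))) := fun s =>
    circConv_evenKer_eq d m (hfc.comp (Continuous.prodMk_right s))
      (fun t => congrArg Complex.ofReal (hper s t).2) y
  simp only [e, Finset.mul_sum]
  rw [intervalIntegral.integral_finsetSum]
  · rw [Finset.mul_sum, Finset.sum_mul, Finset.mul_sum]
    refine Finset.sum_congr rfl fun q _ => ?_
    congr 1
    have e2 : fCoef f p q = (4 * (Real.pi : ℂ) ^ 2)⁻¹ * ∫ s in (0 : ℝ)..(2 * Real.pi),
        Complex.exp (-(Complex.I * (p : ℂ) * (s : ℂ))) * ∫ t in (0 : ℝ)..(2 * Real.pi),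
          Complex.exp (-(Complex.I * (q : ℂ) * (t : ℂ))) * (f s t : ℂ) := by
      unfold fCoef
      congr 1
      refine intervalIntegral.integral_congr fun s _ => ?_
      rw [← intervalIntegral.integral_const_mul]
      refine intervalIntegral.integral_congr fun t _ => ?_
      ring
    have e3 : ∀ s : ℝ, Complex.exp (-(Complex.I * (p : ℂ) * (s : ℂ))) * ((d q.natAbs : ℂ) *
        (((2 * (Real.pi : ℂ))⁻¹ * ∫ t in (0 : ℝ)..(2 * Real.pi),
          Complex.exp (-(Complex.I * (q : ℂ) * (t : ℂ))) * (f s t : ℂ)) *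
          Complex.exp (Complex.I * (q : ℂ) * (y : ℂ)))) =
        ((d q.natAbs : ℂ) * (2 * (Real.pi : ℂ))⁻¹ * Complex.exp (Complex.I * (q : ℂ) * (y : ℂ))) *
        (Complex.exp (-(Complex.I * (p : ℂ) * (s : ℂ))) * ∫ t in (0 : ℝ)..(2 * Real.pi),
          Complex.exp (-(Complex.I * (q : ℂ) * (t : ℂ))) * (f s t : ℂ)) := fun s => by ring
    simp only [e3]
    rw [intervalIntegral.integral_const_mul, e2]
    have : (4 * (Real.pi : ℂ) ^ 2)⁻¹ = (2 * (Real.pi : ℂ))⁻¹ * (2 * (Real.pi : ℂ))⁻¹ := by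
      rw [← mul_inv]; congr 1; ring
    rw [this]
    ring
  · intro q _
    have := hG q
    exact Continuous.intervalIntegrable (by fun_prop) _ _

lemma cesaro_eq_circConv {γ δ : ℝ} {f : ℝ → ℝ → ℝ}
    (hc : Continuous fun q : ℝ × ℝ => f q.1 q.2) (hper : Periodic2 f) (n m : ℕ) (x y : ℝ) :
    cesaro f γ δ n m x y =
      circConv (cesaroKer γ n) (fun s => circConv (cesaroKer δ m) (fun t => (f s t : ℂ)) y) x := by
  unfold cesaroKer
  rw [circConv_evenKer_evenKer_eq _ _ _ _ hc hper]
  set Φ : ℤ → ℤ → ℂ := fun p q => fCoef f p q * Complex.exp (Complex.I * (p : ℂ) * (x : ℂ)) *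
          Complex.exp (Complex.I * (q : ℂ) * (y : ℂ)) with hΦ
  have h1 : ∀ i, ∑ j ∈ Finset.range (m + 1),
      ((AA (γ - 1) (n - i) * AA (δ - 1) (m - j) : ℝ) : ℂ) * SRect f i j x y =
      (AA (γ - 1) (n - i) : ℂ) • ∑ p ∈ Finset.Icc (-(i : ℤ)) i,
        ∑ q ∈ Finset.Icc (-(m : ℤ)) m, (AA δ (m - q.natAbs) : ℂ) • Φ p q := by
    intro i
    have : ∀ p, ∑ q ∈ Finset.Icc (-(m : ℤ)) m, (AA δ (m - q.natAbs) : ℂ) • Φ p q =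
        ∑ j ∈ Finset.range (m + 1), (AA (δ - 1) (m - j) : ℂ) •
          ∑ q ∈ Finset.Icc (-(j : ℤ)) j, Φ p q := fun p => (sum_range_sum_Icc_eq δ m (Φ p)).symm
    simp only [this]
    rw [Finset.sum_comm, Finset.smul_sum]
    refine Finset.sum_congr rfl fun j _ => ?_
    rw [← Finset.smul_sum, smul_smul, smul_eq_mul, Complex.ofReal_mul]
    rfl
  unfold cesaro
  simp only [h1]
  rw [sum_range_sum_Icc_eq γ n]
  rw [Finset.mul_sum]
  refine Finset.sum_congr rfl fun p _ => ?_
  rw [Finset.smul_sum, Finset.mul_sum]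
  refine Finset.sum_congr rfl fun q _ => ?_
  simp only [smul_eq_mul]
  push_cast
  rw [one_div, mul_inv]
  ring

end

/-- Goginava: for `α, β > 0` with `α + β < 1`, the `(C; -α, -β)` means
of the double Fourier series of any continuous `2π`-periodic `f ∈ PBV` converge to `f`
uniformly on `[0,2π]²`. -/
theorem stmt17 (α β : ℝ) (hα : 0 < α) (hβ : 0 < β) (hab : α + β < 1)
    (f : ℝ → ℝ → ℝ) (hcont : Continuous fun q : ℝ × ℝ => f q.1 q.2)
    (hper : Periodic2 f)
    (h1 : PV1pow 1 f ≠ ⊤) (h2 : PV2pow 1 f ≠ ⊤) :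
    TendstoUniformlyOn
      (fun nm : ℕ × ℕ => fun q : ℝ × ℝ => cesaro f (-α) (-β) nm.1 nm.2 q.1 q.2)
      (fun q : ℝ × ℝ => ((f q.1 q.2 : ℝ) : ℂ)) atTop
      (Icc (0:ℝ) (2 * Real.pi) ×ˢ Icc (0:ℝ) (2 * Real.pi)) := by
  obtain ⟨M, V, hg⟩ := exists_varClass hcont hper h1 h2
  rw [Metric.tendstoUniformlyOn_iff]
  intro ε hε
  filter_upwards [hg.eventually_norm_cesaroKer_sub_le hα hβ hab (half_pos hε)] with nm h q _
  rw [dist_comm, dist_eq_norm, cesaro_eq_circConv hcont hper]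
  exact (h q.1 q.2).trans_lt (half_lt_self hε)
end
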